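/- Let H ⊆ (Fin k)^ℤ be an effective one-dimensional subshift and let H' ⊆ H be a nonempty one-dimensional SFT. Let h be a Π₁-computable real with 0 ≤ h ≤ h(H'). Then there exists a two-dimensional sofic subshift X ⊆ (Fin k)^{ℤ²} such that X is nonempty, h(X) = h, and π_{e1}(X) = H. -/

import Mathlib

open Filter

/-- Shift on one-dimensional configurations: `(shift1 p x) k = x (k - p)`. -/
def shift1 {A : Type*} (p : ℤ) (x : ℤ → A) : ℤ → A := fun k => x (k - p)

/-- Shift on two-dimensional configurations: `(shift2 v x) k = x (k - v)`. -/
def shift2 {A : Type*} (v : ℤ × ℤ) (x : ℤ × ℤ → A) : ℤ × ℤ → A := fun k => x (k - v)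

/-- The finite word `w` occurs in the bi-infinite sequence `x`. -/
def occursIn1 {A : Type*} (w : List A) (x : ℤ → A) : Prop :=
  ∃ i : ℤ, ∀ (n : ℕ) (h : n < w.length), x (i + n) = w.get ⟨n, h⟩

/-- The one-dimensional SFT avoiding the finite set `F` of forbidden words. -/
def SFT1 {A : Type*} (F : Finset (List A)) : Set (ℤ → A) :=
  {x | ∀ w ∈ F, ¬ occursIn1 w x}

/-- `H` is a one-dimensional subshift of finite type. -/
def IsSFT1 {A : Type*} (H : Set (ℤ → A)) : Prop :=
  ∃ F : Finset (List A), H = SFT1 F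

/-- A finite two-dimensional pattern: a finite support together with values. -/
structure Pattern2 (A : Type*) where
  support : Finset (ℤ × ℤ)
  val : ℤ × ℤ → A

/-- The pattern `p` occurs in the configuration `x`. -/
def Pattern2.OccursIn {A : Type*} (p : Pattern2 A) (x : ℤ × ℤ → A) : Prop :=
  ∃ v : ℤ × ℤ, ∀ u ∈ p.support, x (u + v) = p.val u

/-- The two-dimensional SFT avoiding the finite set `F` of forbidden patterns. -/
def SFT2 {A : Type*} (F : Finset (Pattern2 A)) : Set (ℤ × ℤ → A) :=
  {x | ∀ p ∈ F, ¬ p.OccursIn x}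

/-- The SFT `X_F` with added horizontal constraints from `H`: every row lies in `H`
and no pattern of `F` occurs. -/
def XHF {A : Type*} (H : Set (ℤ → A)) (F : Finset (Pattern2 A)) : Set (ℤ × ℤ → A) :=
  {x | (∀ j : ℤ, (fun k => x (k, j)) ∈ H) ∧ ∀ p ∈ F, ¬ p.OccursIn x}

/-- The combined subshift: rows in `H`, columns in `V`. -/
def XHV {A : Type*} (H V : Set (ℤ → A)) : Set (ℤ × ℤ → A) :=
  {x | (∀ j : ℤ, (fun k => x (k, j)) ∈ H) ∧ ∀ i : ℤ, (fun l => x (i, l)) ∈ V}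

/-- Number of restrictions of elements of `X` to `[0,m) × [0,n)`. -/
noncomputable def patCount2 {A : Type*} (X : Set (ℤ × ℤ → A)) (m n : ℕ) : ℕ :=
  Set.ncard {p : Fin m → Fin n → A |
    ∃ x ∈ X, ∀ (i : Fin m) (j : Fin n), x ((i : ℤ), (j : ℤ)) = p i j}

/-- Topological entropy of a two-dimensional subshift. -/
noncomputable def entropy2 {A : Type*} (X : Set (ℤ × ℤ → A)) : ℝ :=
  ⨅ n : ℕ, Real.logb 2 (patCount2 X (n + 1) (n + 1)) / ((n : ℝ) + 1) ^ 2

/-- The word `w` belongs to the language of `H`. -/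
def wordIn {A : Type*} (H : Set (ℤ → A)) (w : List A) : Prop :=
  ∃ x ∈ H, occursIn1 w x

/-- Number of length-`n` words in the language of `H`. -/
noncomputable def wordCount {A : Type*} (H : Set (ℤ → A)) (n : ℕ) : ℕ :=
  Set.ncard {w : List A | w.length = n ∧ wordIn H w}

/-- Topological entropy of a one-dimensional subshift. -/
noncomputable def entropy1 {A : Type*} (H : Set (ℤ → A)) : ℝ :=
  ⨅ n : ℕ, Real.logb 2 (wordCount H (n + 1)) / ((n : ℝ) + 1)

/-- `X` is a two-dimensional subshift (closed and shift-invariant). -/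
def IsSubshift2 {A : Type*} [TopologicalSpace A] (X : Set (ℤ × ℤ → A)) : Prop :=
  IsClosed X ∧ ∀ (v : ℤ × ℤ) (x : ℤ × ℤ → A), x ∈ X → shift2 v x ∈ X

/-- `X` is an `(m,n)`-th root of `Y`. -/
def IsRoot {A B : Type*} [TopologicalSpace A] [TopologicalSpace B]
    (X : Set (ℤ × ℤ → A)) (Y : Set (ℤ × ℤ → B)) (m n : ℕ) : Prop :=
  ∃ Z : Set (ℤ × ℤ → A), Z ⊆ X ∧ IsClopen {x : X | (x : ℤ × ℤ → A) ∈ Z} ∧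
    shift2 ((m : ℤ), 0) '' Z = Z ∧ shift2 (0, (n : ℤ)) '' Z = Z ∧
    (∃ φ : Z ≃ₜ Y,
      ∀ (x : Z) (k₁ k₂ : ℤ)
        (hx : shift2 (k₁ * (m : ℤ), k₂ * (n : ℤ)) (x : ℤ × ℤ → A) ∈ Z),
        (φ ⟨shift2 (k₁ * (m : ℤ), k₂ * (n : ℤ)) (x : ℤ × ℤ → A), hx⟩ : ℤ × ℤ → B) =
          shift2 (k₁, k₂) (φ x : ℤ × ℤ → B)) ∧
    (∀ i j : ℕ, i < m → j < n → shift2 ((i : ℤ), (j : ℤ)) '' Z ⊆ X) ∧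
    ∀ x ∈ X, ∃! q : Fin m × Fin n, x ∈ shift2 ((q.1 : ℤ), (q.2 : ℤ)) '' Z

/-- The vertex shift (nearest-neighbor SFT) of a directed graph on `A`. -/
def vertexShift {A : Type*} (E : A → A → Prop) : Set (ℤ → A) :=
  {x | ∀ i : ℤ, E (x i) (x (i + 1))}

/-- Strongly connected component: a maximal nonempty set whose vertices are pairwise
joined by nonempty directed paths. -/
def IsSCC {A : Type*} (E : A → A → Prop) (S : Set A) : Prop :=
  S.Nonempty ∧ (∀ a ∈ S, ∀ b ∈ S, Relation.TransGen E a b) ∧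
    ∀ T : Set A, S ⊆ T → (∀ a ∈ T, ∀ b ∈ T, Relation.TransGen E a b) → T = S

def ReflexiveType {A : Type*} (E : A → A → Prop) (S : Set A) : Prop :=
  ∀ v ∈ S, E v v

def SymmetricType {A : Type*} (E : A → A → Prop) (S : Set A) : Prop :=
  ∀ v ∈ S, ∀ w ∈ S, v ≠ w → E v w → E w v

def StateSplitType {A : Type*} (E : A → A → Prop) (S : Set A) : Prop :=
  ∃ p : ℕ, 0 < p ∧ ∃ f : A → ZMod p,
    (∀ i : ZMod p, ∃ v ∈ S, f v = i) ∧
    ∀ v ∈ S, ∀ w ∈ S, (E v w ↔ f w = f v + 1)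

/-- Condition D: all SCCs share one of the three types. -/
def ConditionD {A : Type*} (E : A → A → Prop) : Prop :=
  (∀ S : Set A, IsSCC E S → ReflexiveType E S) ∨
  (∀ S : Set A, IsSCC E S → SymmetricType E S) ∨
  (∀ S : Set A, IsSCC E S → StateSplitType E S)

/-- A real is Π₁-computable (right-recursively enumerable). -/
def Pi1Computable (x : ℝ) : Prop :=
  ∃ f : ℕ → ℚ, Computable f ∧ Antitone f ∧
    Tendsto (fun n => (f n : ℝ)) atTop (nhds x)

/-- A computable real number. -/
def IsComputableReal (x : ℝ) : Prop :=
  ∃ f : ℕ → ℚ, Computable f ∧ ∀ n : ℕ, |(f n : ℝ) - x| ≤ (2 : ℝ) ^ (-(n : ℤ))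

/-- `w` is a finite concatenation of copies of `w₁` and `w₂`. -/
def IsConcat {A : Type*} (w₁ w₂ w : List A) : Prop :=
  ∃ L : List (List A), (∀ v ∈ L, v = w₁ ∨ v = w₂) ∧ w = L.flatten

/-- Transitivity of a one-dimensional subshift. -/
def Transitive1 {A : Type*} (H : Set (ℤ → A)) : Prop :=
  ∀ u w : List A, wordIn H u → wordIn H w → ∃ v : List A, wordIn H (u ++ v ++ w)

/-- The subshift of elements of `H` avoiding the word `u`. -/
def avoidWord {A : Type*} (H : Set (ℤ → A)) (u : List A) : Set (ℤ → A) :=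
  {x ∈ H | ¬ occursIn1 u x}

/-- `H` is an effective one-dimensional subshift: its forbidden words are enumerated by a
computable function. -/
def IsEffective1 {k : ℕ} (H : Set (ℤ → Fin k)) : Prop :=
  ∃ f : ℕ → Option (List (Fin k)), Computable f ∧
    H = {x | ∀ (n : ℕ) (w : List (Fin k)), f n = some w → ¬ occursIn1 w x}

/-- `X` is a two-dimensional sofic subshift: the image of a two-dimensional SFT under a
continuous shift-commuting map. -/
def IsSofic2 {k : ℕ} (X : Set (ℤ × ℤ → Fin k)) : Prop :=
  ∃ (k' : ℕ) (F : Finset (Pattern2 (Fin k')))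
    (Φ : (ℤ × ℤ → Fin k') → (ℤ × ℤ → Fin k)),
    Continuous Φ ∧
    (∀ (v : ℤ × ℤ) (x : ℤ × ℤ → Fin k'), Φ (shift2 v x) = shift2 v (Φ x)) ∧
    X = Φ '' SFT2 F

namespace Sim

/-- Consecutive cells satisfying `P` along a bi-infinite line are related by `E`. -/
def Skip {C : Type} (P : C → Prop) (E : C → C → Prop) (r : ℤ → C) : Prop :=
  ∀ i j, i < j → P (r i) → P (r j) → (∀ m, i < m → m < j → ¬ P (r m)) → E (r i) (r j)

/-- Configuration sets that are letter-to-letter images of finite-alphabet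
nearest-neighbour constraints. -/
def Sofic {C : Type} (V : Set (ℤ → ℤ → C)) : Prop :=
  ∃ (D : Type) (_ : Finite D) (π : D → C) (h v : D → D → Prop), ∀ x, x ∈ V ↔
    ∃ c : ℤ → ℤ → D, (∀ i j, h (c i j) (c (i + 1) j) ∧ v (c i j) (c i (j + 1))) ∧
      ∀ i j, π (c i j) = x i j

theorem Sofic.inter {C : Type} {V W : Set (ℤ → ℤ → C)} (hV : Sofic V) (hW : Sofic W) :
    Sofic (V ∩ W) := by
  obtain ⟨D, _, π, h, v, H⟩ := hV
  obtain ⟨D', _, π', h', v', H'⟩ := hW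
  refine ⟨{p : D × D' // π p.1 = π' p.2}, inferInstance, fun p => π p.1.1,
    fun p q => h p.1.1 q.1.1 ∧ h' p.1.2 q.1.2, fun p q => v p.1.1 q.1.1 ∧ v' p.1.2 q.1.2, ?_⟩
  intro x
  rw [Set.mem_inter_iff, H, H']
  constructor
  · rintro ⟨⟨c, hc, hx⟩, c', hc', hx'⟩
    refine ⟨fun i j => ⟨(c i j, c' i j), by rw [hx, hx']⟩, fun i j => ?_, fun i j => hx i j⟩
    exact ⟨⟨(hc i j).1, (hc' i j).1⟩, (hc i j).2, (hc' i j).2⟩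
  · rintro ⟨c, hc, hx⟩
    refine ⟨⟨fun i j => (c i j).1.1, fun i j => ⟨(hc i j).1.1, (hc i j).2.1⟩, hx⟩,
      fun i j => (c i j).1.2, fun i j => ⟨(hc i j).1.2, (hc i j).2.2⟩, fun i j => ?_⟩
    exact (c i j).2.symm.trans (hx i j)

theorem Sofic.preimage {C C' : Type} [Finite C'] (f : C' → C) {V : Set (ℤ → ℤ → C)}
    (hV : Sofic V) : Sofic {x : ℤ → ℤ → C' | (fun i j => f (x i j)) ∈ V} := by
  obtain ⟨D, _, π, h, v, H⟩ := hV
  refine ⟨{p : D × C' // π p.1 = f p.2}, inferInstance, fun p => p.1.2,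
    fun p q => h p.1.1 q.1.1, fun p q => v p.1.1 q.1.1, ?_⟩
  intro x
  rw [Set.mem_ofPred_eq, H]
  constructor
  · rintro ⟨c, hc, hx⟩
    exact ⟨fun i j => ⟨(c i j, x i j), hx i j⟩, hc, fun i j => rfl⟩
  · rintro ⟨c, hc, hx⟩
    exact ⟨fun i j => (c i j).1.1, hc, fun i j => (c i j).2.trans (congrArg f (hx i j))⟩

theorem Sofic.image {C C' : Type} (f : C → C') {V : Set (ℤ → ℤ → C)}
    (hV : Sofic V) : Sofic {y : ℤ → ℤ → C' | ∃ x ∈ V, ∀ i j, f (x i j) = y i j} := by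
  obtain ⟨D, _, π, h, v, H⟩ := hV
  refine ⟨D, inferInstance, fun d => f (π d), h, v, ?_⟩
  intro y
  simp only [Set.mem_ofPred_eq, H]
  constructor
  · rintro ⟨x, ⟨c, hc, hx⟩, hy⟩
    exact ⟨c, hc, fun i j => by rw [hx, hy]⟩
  · rintro ⟨c, hc, hx⟩
    exact ⟨fun i j => π (c i j), ⟨c, hc, fun i j => rfl⟩, hx⟩

theorem Sofic.transpose {C : Type} {V : Set (ℤ → ℤ → C)}
    (hV : Sofic V) : Sofic {x : ℤ → ℤ → C | (fun i j => x j i) ∈ V} := by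
  obtain ⟨D, _, π, h, v, H⟩ := hV
  refine ⟨D, inferInstance, π, v, h, ?_⟩
  intro x
  rw [Set.mem_ofPred_eq, H]
  constructor
  · rintro ⟨c, hc, hx⟩
    exact ⟨fun i j => c j i, fun i j => (hc j i).symm, fun i j => hx j i⟩
  · rintro ⟨c, hc, hx⟩
    exact ⟨fun i j => c j i, fun i j => (hc j i).symm, fun i j => hx j i⟩

theorem sofic_adj {C : Type} [Finite C] (h v : C → C → Prop) :
    Sofic {x : ℤ → ℤ → C | ∀ i j, h (x i j) (x (i + 1) j) ∧ v (x i j) (x i (j + 1))} := by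
  refine ⟨C, inferInstance, id, h, v, fun x => ?_⟩
  constructor
  · intro hx
    exact ⟨x, hx, fun i j => rfl⟩
  · rintro ⟨c, hc, hx⟩
    have : c = x := by ext i j; exact hx i j
    exact this ▸ hc

theorem sofic_hskip {C : Type} [Finite C] (P : C → Prop) (E : C → C → Prop) :
    Sofic {x : ℤ → ℤ → C | ∀ j, Skip P E (fun i => x i j)} := by
  classical
  refine ⟨C × Option C, inferInstance, Prod.fst,
    fun a b => b.2 = (if P a.1 then some a.1 else a.2) ∧ (P a.1 → ∀ d ∈ a.2, E d a.1),
    fun _ _ => True, fun x => ?_⟩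
  constructor
  · intro hx
    let Q : ℤ → ℤ → ℤ → Prop := fun i j m => m < i ∧ P (x m j) ∧ ∀ n, m < n → n < i → ¬ P (x n j)
    have uniq : ∀ i j m m', Q i j m → Q i j m' → m = m' := by
      rintro i j m m' ⟨h1, h2, h3⟩ ⟨h1', h2', h3'⟩
      rcases lt_trichotomy m m' with h | h | h
      · exact absurd h2' (h3 _ h h1')
      · exact h
      · exact absurd h2 (h3' _ h h1)
    let mem : ℤ → ℤ → Option C := fun i j => if h : ∃ m, Q i j m then some (x h.choose j) else none
    have mem_eq : ∀ i j m, Q i j m → mem i j = some (x m j) := by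
      intro i j m hm
      have h : ∃ m, Q i j m := ⟨m, hm⟩
      simp only [mem, dif_pos h]
      rw [uniq i j _ _ h.choose_spec hm]
    refine ⟨fun i j => (x i j, mem i j), fun i j => ⟨⟨?_, ?_⟩, trivial⟩, fun i j => rfl⟩
    · show mem (i + 1) j = if P (x i j) then some (x i j) else mem i j
      split_ifs with hp
      · exact mem_eq _ _ _ ⟨by omega, hp, fun n h1 h2 => by omega⟩
      · by_cases h : ∃ m, Q i j m
        · obtain ⟨m, hm⟩ := h
          rw [mem_eq i j m hm]
          refine mem_eq _ _ _ ⟨by have := hm.1; omega, hm.2.1, fun n h1 h2 => ?_⟩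
          rcases (show n < i ∨ n = i by omega) with h | rfl
          · exact hm.2.2 n h1 h
          · exact hp
        · have h' : ¬ ∃ m, Q (i + 1) j m := by
            rintro ⟨m, h1, h2, h3⟩
            rcases (show m < i ∨ m = i by omega) with h4 | rfl
            · exact h ⟨m, h4, h2, fun n a b => h3 n a (by omega)⟩
            · exact hp h2
          simp only [mem, dif_neg h, dif_neg h']
    · intro hp d hd
      change d ∈ mem i j at hd
      by_cases h : ∃ m, Q i j m
      · obtain ⟨m, hm⟩ := h
        rw [mem_eq i j m hm] at hd
        cases hd
        exact hx j m i hm.1 hm.2.1 hp hm.2.2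
      · simp [mem, dif_neg h] at hd
  · rintro ⟨c, hc, hx⟩ j i i' hlt hp hp' hno
    have key : ∀ n : ℕ, i + 1 + n ≤ i' → (c (i + 1 + n) j).2 = some (x i j) := by
      intro n
      induction n with
      | zero =>
        intro _
        have := (hc i j).1.1
        rw [hx, if_pos hp] at this
        simpa using this
      | succ n ih =>
        intro hn
        have := (hc (i + 1 + n) j).1.1
        rw [hx, if_neg (hno _ (by omega) (by push_cast at hn; omega)),
          ih (by push_cast at hn; omega)] at this
        push_cast
        rwa [← add_assoc]
    have := key (i' - i - 1).toNat (by omega)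
    rw [show i + 1 + ((i' - i - 1).toNat : ℤ) = i' by omega] at this
    have h2 := (hc i' j).1.2
    rw [hx] at h2
    exact h2 hp' _ this

theorem sofic_vskip {C : Type} [Finite C] (P : C → Prop) (E : C → C → Prop) :
    Sofic {x : ℤ → ℤ → C | ∀ i, Skip P E (x i)} :=
  (sofic_hskip P E).transpose

/-- The rows of the configuration avoid a finite set of words. -/
theorem sofic_rows {C : Type} [Finite C] (F : Finset (List C)) :
    Sofic {x : ℤ → ℤ → C | ∀ j, (fun i => x i j) ∈ SFT1 F} := by
  obtain ⟨M, hM⟩ : ∃ M : ℕ, ∀ w ∈ F, w.length ≤ M :=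
    ⟨F.sup List.length, fun w hw => Finset.le_sup (f := List.length) hw⟩
  refine ⟨Fin (M + 1) → C, inferInstance, fun d => d 0,
    fun a b => (∀ n : ℕ, ∀ hn : n + 1 < M + 1, b ⟨n, by omega⟩ = a ⟨n + 1, hn⟩) ∧
      ∀ w ∈ F, ¬ ∀ (n : ℕ) (h : n < w.length) (h' : n < M + 1), a ⟨n, h'⟩ = w.get ⟨n, h⟩,
    fun _ _ => True, fun x => ?_⟩
  constructor
  · intro hx
    refine ⟨fun i j n => x (i + n.1) j, fun i j => ⟨⟨fun n hn => ?_, fun w hw h => ?_⟩, trivial⟩,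
      fun i j => by simp⟩
    · simp only; congr 1; push_cast; ring
    · exact hx j w hw ⟨i, fun n hn => h n hn (by have := hM w hw; omega)⟩
  · rintro ⟨c, hc, hx⟩ j w hw ⟨i, hi⟩
    have key : ∀ (n : ℕ) (i : ℤ) (hn : n < M + 1), c i j ⟨n, hn⟩ = x (i + n) j := by
      intro n
      induction n with
      | zero => intro i hn; simpa using hx i j
      | succ n ih =>
        intro i hn
        rw [← (hc i j).1.1 n hn, ih]
        congr 1; push_cast; ring
    refine (hc i j).1.2 w hw fun n hn hn' => ?_
    rw [key]
    exact hi n hn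

theorem Sofic.isSofic2 {k : ℕ} {V : Set (ℤ → ℤ → Fin k)} (hV : Sofic V) :
    IsSofic2 {x : ℤ × ℤ → Fin k | (fun i j => x (i, j)) ∈ V} := by
  classical
  obtain ⟨D, _, π, h, v, H⟩ := hV
  obtain ⟨k', ⟨e⟩⟩ := Finite.exists_equiv_fin D
  let pat : (ℤ × ℤ) → Fin k' × Fin k' → Pattern2 (Fin k') := fun u p =>
    ⟨{0, u}, fun z => if z = 0 then p.1 else p.2⟩
  let Fh := (Finset.univ.filter fun p : Fin k' × Fin k' => ¬ h (e.symm p.1) (e.symm p.2)).image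
    (pat (1, 0))
  let Fv := (Finset.univ.filter fun p : Fin k' × Fin k' => ¬ v (e.symm p.1) (e.symm p.2)).image
    (pat (0, 1))
  have occ : ∀ u, u ≠ 0 → ∀ p (x : ℤ × ℤ → Fin k'),
      (pat u p).OccursIn x ↔ ∃ z, x z = p.1 ∧ x (u + z) = p.2 := by
    intro u hu p x
    simp [Pattern2.OccursIn, pat, hu]
  have memF : ∀ x : ℤ × ℤ → Fin k', x ∈ SFT2 (Fh ∪ Fv) ↔
      (∀ i j, h (e.symm (x (i, j))) (e.symm (x (i + 1, j))) ∧
        v (e.symm (x (i, j))) (e.symm (x (i, j + 1)))) := by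
    intro x
    simp only [SFT2, Set.mem_ofPred_eq]
    constructor
    · intro hx i j
      constructor
      · by_contra hcon
        refine hx (pat (1, 0) (x (i, j), x (i + 1, j))) ?_ ?_
        · refine Finset.mem_union_left _ (Finset.mem_image_of_mem _ ?_)
          simpa using hcon
        · rw [occ _ (by simp)]
          exact ⟨(i, j), rfl, by simp [add_comm]⟩
      · by_contra hcon
        refine hx (pat (0, 1) (x (i, j), x (i, j + 1))) ?_ ?_
        · refine Finset.mem_union_right _ (Finset.mem_image_of_mem _ ?_)
          simpa using hcon
        · rw [occ _ (by simp)]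
          exact ⟨(i, j), rfl, by simp [add_comm]⟩
    · intro hx p hp
      rcases Finset.mem_union.1 hp with hp | hp
      · obtain ⟨q, hq, rfl⟩ := Finset.mem_image.1 hp
        rw [occ _ (by simp)]
        rintro ⟨⟨i, j⟩, h1, h2⟩
        have := (hx i j).1
        rw [show ((1, 0) : ℤ × ℤ) + (i, j) = (i + 1, j) by simp [add_comm]] at h2
        rw [h1, h2] at this
        exact (Finset.mem_filter.1 hq).2 this
      · obtain ⟨q, hq, rfl⟩ := Finset.mem_image.1 hp
        rw [occ _ (by simp)]
        rintro ⟨⟨i, j⟩, h1, h2⟩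
        have := (hx i j).2
        rw [show ((0, 1) : ℤ × ℤ) + (i, j) = (i, j + 1) by simp [add_comm]] at h2
        rw [h1, h2] at this
        exact (Finset.mem_filter.1 hq).2 this
  refine ⟨k', Fh ∪ Fv, fun x z => π (e.symm (x z)), ?_, ?_, ?_⟩
  · refine continuous_pi fun z => ?_
    exact (continuous_of_discreteTopology (f := fun a : Fin k' => π (e.symm a))).comp
      (continuous_apply z)
  · intro u x
    rfl
  · ext x
    rw [Set.mem_ofPred_eq, H]
    constructor
    · rintro ⟨c, hc, hx⟩
      refine ⟨fun z => e (c z.1 z.2), ?_, ?_⟩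
      · rw [memF]
        intro i j
        simpa using hc i j
      · ext ⟨i, j⟩
        simp [hx]
    · rintro ⟨y, hy, rfl⟩
      exact ⟨fun i j => e.symm (y (i, j)), (memF y).1 hy, fun i j => rfl⟩

/-- Local rules for growing triangles: row `n` has cells `0, …, n`. -/
structure TriSys (A : Type) where
  S : Type
  fin : Finite S
  H : S → S → Prop
  V : S → S → Prop
  L : S → Prop
  Dg : S → Prop
  inp : S → A

/-- The first `N` rows of `T` satisfy the local rules and carry the input `b` on the diagonal. -/
structure TriSys.Tri {A : Type} (X : TriSys A) (N : ℕ) (T : ℕ → ℕ → X.S) (b : ℕ → A) : Prop where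
  L : ∀ n < N, X.L (T 0 n)
  H : ∀ k n, k < n → n < N → X.H (T k n) (T (k + 1) n)
  V : ∀ k n, k ≤ n → n + 1 < N → X.V (T k n) (T k (n + 1))
  Dg : ∀ n < N, X.Dg (T n n)
  inp : ∀ n < N, X.inp (T n n) = b n

/-- One-sided cellular dynamics with a global control reading the first cell. -/
structure CA (A Q D : Type) where
  q0 : Q
  blank : D
  δ : Q → D → Q
  F : Q → D → Option D → D → D → A → D

section CellularDynamics

variable {A Q D : Type}

def CA.next (M : CA A Q D) (b : ℕ → A) (x : Q × (ℕ → D)) : Q × (ℕ → D) :=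
  (M.δ x.1 (x.2 0), fun k => M.F x.1 (x.2 0) (if k = 0 then none else some (x.2 (k - 1)))
    (x.2 k) (x.2 (k + 1)) (b k))

def CA.run (M : CA A Q D) (b : ℕ → A) : ℕ → Q × (ℕ → D)
  | 0 => (M.q0, fun _ => M.blank)
  | t + 1 => M.next b (M.run b t)

/-- Cells of the triangles simulating a cellular dynamics. -/
structure CACell (A Q D : Type) (Qf : Set Q) where
  q : Qf
  top : D
  left : Option D
  cur : D
  right : Option D
  inp : A

theorem CACell.finite [Finite A] [Finite D] {Qf : Set Q} (hQ : Qf.Finite) :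
    Finite (CACell A Q D Qf) := by
  have := hQ.to_subtype
  refine Finite.of_injective
    (fun x : CACell A Q D Qf => (x.q, x.top, x.left, x.cur, x.right, x.inp)) ?_
  rintro ⟨⟩ ⟨⟩ h
  simpa using h

def CA.triSys [Finite A] [Finite D] (M : CA A Q D) {Qf : Set Q} (hQ : Qf.Finite)
    (bad : Q → Prop) : TriSys A where
  S := CACell A Q D Qf
  fin := CACell.finite hQ
  H x y := y.q = x.q ∧ y.top = x.top ∧ x.right = some y.cur ∧ y.left = some x.cur
  V x y := y.q.1 = M.δ x.q.1 x.top ∧ y.inp = x.inp ∧ ¬ bad x.q.1 ∧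
    y.cur = M.F x.q.1 x.top x.left x.cur (x.right.getD M.blank) x.inp
  L x := x.left = none ∧ x.top = x.cur ∧ (x.right = none → x.q.1 = M.q0)
  Dg x := x.right = none ∧ x.cur = M.blank
  inp x := x.inp

theorem CA.triSys_spec [Finite A] [Finite D] (M : CA A Q D) {Qf : Set Q} (hQ : Qf.Finite)
    (bad : Q → Prop) (hrun : ∀ b t, (M.run b t).1 ∈ Qf)
    (hblank : ∀ b t k, t ≤ k → (M.run b t).2 k = M.blank) (b : ℕ → A) :
    ((∀ t, ¬ bad (M.run b t).1) → ∃ T, ∀ N, (M.triSys hQ bad).Tri N T b) ∧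
    ((∃ t, bad (M.run b t).1) → ∃ N, ∀ T, ¬ (M.triSys hQ bad).Tri N T b) := by
  constructor
  · intro hgood
    let T : ℕ → ℕ → CACell A Q D Qf := fun k n =>
      { q := ⟨(M.run b n).1, hrun b n⟩
        top := (M.run b n).2 0
        left := if k = 0 then none else some ((M.run b n).2 (k - 1))
        cur := (M.run b n).2 k
        right := if k < n then some ((M.run b n).2 (k + 1)) else none
        inp := b k }
    refine ⟨T, fun N => ⟨fun n _ => ⟨?_, ?_, ?_⟩, fun k n hk _ => ⟨?_, ?_, ?_, ?_⟩,
      fun k n hk _ => ⟨?_, ?_, ?_, ?_⟩, fun n _ => ⟨?_, ?_⟩, fun n _ => ?_⟩⟩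
    · simp [T]
    · simp [T]
    · rcases Nat.eq_zero_or_pos n with rfl | hn
      · simp [T, CA.run]
      · simp [T, hn]
    · simp [T]
    · simp [T]
    · simp [T, hk]
    · simp [T]
    · simp [T, CA.run, CA.next]
    · simp [T]
    · exact hgood n
    · have : (if k < n then some ((M.run b n).2 (k + 1)) else none).getD M.blank =
          (M.run b n).2 (k + 1) := by
        split_ifs with h
        · rfl
        · exact (hblank b n (k + 1) (by omega)).symm
      simp only [T, this]
      simp [CA.run, CA.next]
    · simp [T]
    · exact hblank b n n le_rfl
    · simp [T]; rfl
  · rintro ⟨t, ht⟩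
    refine ⟨t + 2, fun T hT => ?_⟩
    have key : ∀ n, n < t + 2 → ∀ k ≤ n, (T k n).q.1 = (M.run b n).1 ∧
        (T k n).top = (M.run b n).2 0 ∧ (T k n).cur = (M.run b n).2 k ∧ (T k n).inp = b k ∧
        (T k n).right = (if k < n then some ((M.run b n).2 (k + 1)) else none) ∧
        (T k n).left = (if k = 0 then none else some ((M.run b n).2 (k - 1))) := by
      intro n
      induction n with
      | zero =>
        intro hn k hk
        obtain rfl : k = 0 := by omega
        obtain ⟨h1, h2, h3⟩ := hT.L 0 hn
        obtain ⟨h4, h5⟩ := hT.Dg 0 hn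
        exact ⟨h3 h4, by rw [h2, h5]; rfl, by rw [h5]; rfl, hT.inp 0 hn, by simpa using h4,
          by simpa using h1⟩
      | succ n ih =>
        intro hn
        have ih := ih (by omega)
        have hcur : ∀ k ≤ n + 1, (T k (n + 1)).cur = (M.run b (n + 1)).2 k ∧
            (T k (n + 1)).inp = b k := by
          intro k hk
          rcases Nat.lt_or_ge n k with h | h
          · obtain rfl : k = n + 1 := by omega
            rw [(hT.Dg (n + 1) hn).2, hblank b _ _ le_rfl]
            exact ⟨rfl, hT.inp _ hn⟩
          · obtain ⟨h1, h2, h3, h4, h5, h6⟩ := ih k h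
            obtain ⟨_, hi, _, hc⟩ := hT.V k n h hn
            refine ⟨?_, hi.trans h4⟩
            rw [hc, h1, h2, h3, h4, h5, h6]
            have : (if k < n then some ((M.run b n).2 (k + 1)) else none).getD M.blank =
                (M.run b n).2 (k + 1) := by
              split_ifs with h
              · rfl
              · exact (hblank b n (k + 1) (by omega)).symm
            rw [this]
            rfl
        intro k hk
        have hqt : (T k (n + 1)).q.1 = (M.run b (n + 1)).1 ∧
            (T k (n + 1)).top = (M.run b (n + 1)).2 0 := by
          clear * - hT hk hn ih hcur
          induction k with
          | zero =>
            obtain ⟨h1, h2, _⟩ := ih 0 (by omega)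
            refine ⟨?_, ?_⟩
            · rw [(hT.V 0 n (by omega) hn).1, h1, h2]; rfl
            · rw [(hT.L (n + 1) hn).2.1, (hcur 0 (by omega)).1]
          | succ k ihk =>
            obtain ⟨h1, h2, _, _⟩ := hT.H k (n + 1) (by omega) hn
            rw [h1, h2]
            exact ihk (by omega)
        refine ⟨hqt.1, hqt.2, (hcur k hk).1, (hcur k hk).2, ?_, ?_⟩
        · split_ifs with h
          · rw [(hT.H k (n + 1) h hn).2.2.1, (hcur (k + 1) (by omega)).1]
          · obtain rfl : k = n + 1 := by omega
            exact (hT.Dg (n + 1) hn).1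
        · split_ifs with h
          · subst h; exact (hT.L (n + 1) hn).1
          · obtain ⟨k, rfl⟩ := Nat.exists_eq_succ_of_ne_zero h
            rw [(hT.H k (n + 1) (by omega) hn).2.2.2, (hcur k (by omega)).1]
            rfl
    refine (hT.V 0 t (by omega) (by omega)).2.2.1 ?_
    rwa [(key t (by omega) 0 (by omega)).1]

end CellularDynamics

section TMSim

open Turing Turing.PartrecToTM2

/-- Control states of the checking procedure. -/
inductive Ctrl where
  | start | ld0 | ld1 | ld | lz (n : ℕ) | run (q : Stmt') (v : Option Γ') | ans | rej

/-- Actions on the input queue. -/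
inductive UAct where
  | nop | pop | load

/-- Actions on a stack. -/
inductive SAct where
  | nop | pop | clear | push (g : Γ')

abbrev StkAct := K' → SAct

def only (s : K') (a : SAct) : StkAct := Function.update (fun _ => SAct.nop) s a

variable {k : ℕ}

/-- One step of the control, reading the top of the queue and of the stacks. -/
def act (c : ToPartrec.Code) : Ctrl → Option (Fin k) → (K' → Option Γ') →
    Ctrl × UAct × Bool × StkAct
  | .start, _, _ => (.ld0, .load, false, fun _ => .clear)
  | .ld0, _, _ => (.ld1, .nop, false, only .main (.push .cons))
  | .ld1, _, _ => (.ld, .nop, false, only .main (.push .bit1))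
  | .ld, some a, _ => (.lz a, .pop, false, only .main (.push .bit1))
  | .ld, none, _ => (.run (tr (trNormal c .halt)) none, .nop, false, fun _ => .nop)
  | .lz 0, _, _ => (.ld, .nop, false, fun _ => .nop)
  | .lz (n + 1), _, _ => (.lz n, .nop, false, only .main (.push .bit0))
  | .run (.push s f q) v, _, _ => (.run q v, .nop, false, only s (.push (f v)))
  | .run (.peek s f q) v, _, S => (.run q (f v (S s)), .nop, false, fun _ => .nop)
  | .run (.pop s f q) v, _, S => (.run q (f v (S s)), .nop, false, only s .pop)
  | .run (.load f q) v, _, _ => (.run q (f v), .nop, false, fun _ => .nop)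
  | .run (.branch f q₁ q₂) v, _, _ => (.run (cond (f v) q₁ q₂) v, .nop, false, fun _ => .nop)
  | .run (.goto f) v, _, _ => (.run (tr (f v)) v, .nop, false, fun _ => .nop)
  | .run .halt _, _, _ => (.ans, .nop, false, fun _ => .nop)
  | .ans, _, S => if S .main = some .bit1 then (.start, .nop, true, fun _ => .nop)
      else (.rej, .nop, false, fun _ => .nop)
  | .rej, _, _ => (.rej, .nop, false, fun _ => .nop)

/-- States of the checking procedure. -/
structure St (k : ℕ) where
  q : Ctrl
  U : List (Fin k)
  m : ℕ
  S : K' → List Γ'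

def pre (b : ℕ → Fin k) (m : ℕ) : List (Fin k) := (List.range m).map b

def UAct.app (b : ℕ → Fin k) (m : ℕ) : UAct → List (Fin k) → List (Fin k)
  | .nop, U => U
  | .pop, U => U.tail
  | .load, _ => pre b m

def SAct.app : SAct → List Γ' → List Γ'
  | .nop, l => l
  | .pop, l => l.tail
  | .clear, _ => []
  | .push g, l => g :: l

def St.act (c : ToPartrec.Code) (x : St k) : Ctrl × UAct × Bool × StkAct :=
  Sim.act c x.q x.U.head? (fun s => (x.S s).head?)

def St.step (c : ToPartrec.Code) (b : ℕ → Fin k) (x : St k) : St k where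
  q := (x.act c).1
  U := (x.act c).2.1.app b x.m x.U
  m := if (x.act c).2.2.1 then x.m + 1 else x.m
  S := fun s => ((x.act c).2.2.2 s).app (x.S s)

def St.init : St k := ⟨.start, [], 0, fun _ => []⟩

abbrev TapeCell (k : ℕ) := Option (Fin k) × Bool × (K' → Option Γ')

instance : Finite K' := Finite.of_surjective
  (fun i : Fin 4 => ![K'.main, K'.rev, K'.aux, K'.stack] i) fun s => by
    cases s
    exacts [⟨0, rfl⟩, ⟨1, rfl⟩, ⟨2, rfl⟩, ⟨3, rfl⟩]

/-- The checking procedure as a cellular dynamics. -/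
def checkCA (k : ℕ) (c : ToPartrec.Code) : CA (Fin k) Ctrl (TapeCell k) where
  q0 := .start
  blank := (none, false, fun _ => none)
  δ q d := (Sim.act c q d.1 d.2.2).1
  F q d l x r a :=
    (match (Sim.act c q d.1 d.2.2).2.1 with
      | .nop => x.1
      | .pop => r.1
      | .load => if x.2.1 then some a else none,
    (if (Sim.act c q d.1 d.2.2).2.2.1 then (match l with | none => true | some l => l.2.1)
      else x.2.1),
    fun s => match (Sim.act c q d.1 d.2.2).2.2.2 s with
      | .nop => x.2.2 s
      | .pop => r.2.2 s
      | .clear => none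
      | .push g => match l with | none => some g | some l => l.2.2 s)

def St.tape (x : St k) (i : ℕ) : TapeCell k :=
  (x.U[i]?, decide (i < x.m), fun s => (x.S s)[i]?)

theorem checkCA_run (c : ToPartrec.Code) (b : ℕ → Fin k) (t : ℕ) :
    (checkCA k c).run b t = (((St.step c b)^[t] St.init).q, ((St.step c b)^[t] St.init).tape) := by
  induction t with
  | zero =>
    simp only [CA.run, Function.iterate_zero, id]
    refine Prod.ext rfl (funext fun i => ?_)
    simp [checkCA, St.tape, St.init]
  | succ t ih =>
    rw [CA.run, ih, Function.iterate_succ_apply']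
    generalize (St.step c b)^[t] St.init = x
    have hact : Sim.act c x.q (x.tape 0).1 (x.tape 0).2.2 = x.act c := by
      simp [St.act, St.tape, List.head?_eq_getElem?]
    refine Prod.ext ?_ (funext fun i => ?_)
    · simp only [CA.next, checkCA]
      rw [hact]
      rfl
    · simp only [CA.next, checkCA]
      rw [hact]
      rcases i with _ | i
      · refine Prod.ext ?_ (Prod.ext ?_ (funext fun s => ?_))
        · simp only [St.step, St.tape]
          rcases (x.act c).2.1 <;> simp [UAct.app, pre]
          rcases x.m <;> simp [List.range_succ_eq_map]
        · simp only [St.step, St.tape]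
          split_ifs <;> simp
        · simp only [St.step, St.tape]
          rcases (x.act c).2.2.2 s <;> simp [SAct.app]
      · refine Prod.ext ?_ (Prod.ext ?_ (funext fun s => ?_))
        · simp only [St.step, St.tape]
          rcases (x.act c).2.1 <;> simp [UAct.app, pre]
          by_cases h : i + 1 < x.m <;> simp [h]
        · simp only [St.step, St.tape]
          by_cases h : (x.act c).2.2.1 = true <;> simp [h]
        · simp only [St.step, St.tape]
          rcases (x.act c).2.2.2 s <;> simp [SAct.app]

theorem St.size (c : ToPartrec.Code) (b : ℕ → Fin k) (t : ℕ) :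
    ((St.step c b)^[t] St.init).U.length ≤ t ∧ ((St.step c b)^[t] St.init).m ≤ t ∧
      ∀ s, (((St.step c b)^[t] St.init).S s).length ≤ t := by
  induction t with
  | zero => simp [St.init]
  | succ t ih =>
    rw [Function.iterate_succ_apply']
    revert ih
    generalize (St.step c b)^[t] St.init = x
    rintro ⟨h1, h2, h3⟩
    refine ⟨?_, ?_, fun s => ?_⟩
    · simp only [St.step]
      rcases (x.act c).2.1 <;> simp [UAct.app, pre] <;> omega
    · simp only [St.step]
      split_ifs <;> omega
    · simp only [St.step]
      have := h3 s
      rcases (x.act c).2.2.2 s <;> simp [SAct.app] <;> omega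

theorem checkCA_blank (c : ToPartrec.Code) (b : ℕ → Fin k) (t i : ℕ) (h : t ≤ i) :
    ((checkCA k c).run b t).2 i = (checkCA k c).blank := by
  rw [checkCA_run]
  obtain ⟨h1, h2, h3⟩ := St.size c b t
  refine Prod.ext ?_ (Prod.ext ?_ (funext fun s => ?_))
  · simp only [St.tape, checkCA, List.getElem?_eq_none_iff]; omega
  · simp only [St.tape, checkCA, decide_eq_false_iff_not]; omega
  · simp only [St.tape, checkCA, List.getElem?_eq_none_iff]
    have := h3 s; omega

/-- The control states that can occur. -/
def ctrlSet (k : ℕ) (c : ToPartrec.Code) : Set Ctrl :=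
  {q | match q with
    | .lz n => n ≤ k
    | .run s _ => some s ∈ TM2.stmts tr (codeSupp c .halt)
    | _ => True}

theorem ctrlSet_finite (k : ℕ) (c : ToPartrec.Code) : (ctrlSet k c).Finite := by
  have h : ctrlSet k c ⊆ {.start, .ld0, .ld1, .ld, .ans, .rej} ∪ Ctrl.lz '' {n | n ≤ k} ∪
      (fun p : Option Stmt' × Option Γ' => Ctrl.run (p.1.getD .halt) p.2) ''
        ({o : Option Stmt' | o ∈ TM2.stmts tr (codeSupp c .halt)} ×ˢ Set.univ) := by
    rintro q hq
    rcases q with _ | _ | _ | _ | n | ⟨s, v⟩ | _ | _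
    any_goals (left; left; simp; done)
    · left; right; exact ⟨n, hq, rfl⟩
    · right; exact ⟨(some s, v), ⟨hq, trivial⟩, rfl⟩
  refine Set.Finite.subset (((Set.toFinite _).union ((Set.finite_le_nat k).image _)).union
    (Set.Finite.image _ (Set.Finite.prod (TM2.stmts tr (codeSupp c .halt)).finite_toSet
      Set.finite_univ))) h

theorem act_ctrlSet (c : ToPartrec.Code) (q : Ctrl) (u : Option (Fin k)) (S : K' → Option Γ')
    (hq : q ∈ ctrlSet k c) : (act c q u S).1 ∈ ctrlSet k c := by
  classical
  have hsupp := tr_supports c .halt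
  have hlabel : ∀ l ∈ codeSupp c .halt, some (tr l) ∈ TM2.stmts tr (codeSupp c .halt) := by
    intro l hl
    exact Finset.some_mem_insertNone.2 (Finset.mem_biUnion.2 ⟨l, hl, TM2.stmts₁_self⟩)
  rcases q with _ | _ | _ | _ | n | ⟨s, v⟩ | _ | _
  · trivial
  · trivial
  · trivial
  · rcases u with _ | a
    · exact hlabel _ hsupp.1
    · exact a.2.le
  · rcases n with _ | n
    · trivial
    · exact Nat.le_of_succ_le hq
  · change some s ∈ TM2.stmts tr (codeSupp c .halt) at hq
    cases s with
    | push s f q => exact TM2.stmts_trans (by simp [TM2.stmts₁, TM2.stmts₁_self]) hq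
    | peek s f q => exact TM2.stmts_trans (by simp [TM2.stmts₁, TM2.stmts₁_self]) hq
    | pop s f q => exact TM2.stmts_trans (by simp [TM2.stmts₁, TM2.stmts₁_self]) hq
    | load f q => exact TM2.stmts_trans (by simp [TM2.stmts₁, TM2.stmts₁_self]) hq
    | branch f q₁ q₂ =>
      change some (cond (f v) q₁ q₂) ∈ TM2.stmts tr (codeSupp c .halt)
      cases f v
      · change some q₂ ∈ _
        exact TM2.stmts_trans (by simp [TM2.stmts₁, TM2.stmts₁_self]) hq
      · change some q₁ ∈ _
        exact TM2.stmts_trans (by simp [TM2.stmts₁, TM2.stmts₁_self]) hq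
    | goto f =>
      exact hlabel _ (@TM2.stmts_supportsStmt _ _ _ _ ⟨trNormal c .halt⟩ _ _ _ hsupp hq v)
    | halt => trivial
  · simp only [act]
    split_ifs <;> trivial
  · trivial

end TMSim

section TMRun

open Turing Turing.PartrecToTM2

variable {k : ℕ} (c : ToPartrec.Code) (b : ℕ → Fin k)

/-- Reachability for the checking procedure. -/
def St.Reach (x y : St k) : Prop := ∃ n, (St.step c b)^[n] x = y

variable {c b}

theorem St.Reach.trans {x y z : St k} : x.Reach c b y → y.Reach c b z → x.Reach c b z := by
  rintro ⟨n, rfl⟩ ⟨m, rfl⟩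
  exact ⟨m + n, Function.iterate_add_apply _ _ _ _⟩

theorem St.Reach.refl {x : St k} : x.Reach c b x := ⟨0, rfl⟩

theorem St.Reach.single {x : St k} : x.Reach c b (x.step c b) := ⟨1, rfl⟩

theorem St.Reach.head {x y : St k} (h : (x.step c b).Reach c b y) : x.Reach c b y :=
  St.Reach.single.trans h

theorem app_only (S : K' → List Γ') (s : K') (a : SAct) :
    (fun t => (only s a t).app (S t)) = Function.update S s (a.app (S s)) := by
  funext t
  by_cases h : t = s
  · subst h; simp [only]
  · simp [only, h, SAct.app]

theorem trNat_bit1 (n : ℕ) : trNat (2 * n + 1) = Γ'.bit1 :: trNat n := by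
  obtain ⟨p, rfl⟩ : ∃ p : Num, (p : ℕ) = n := ⟨n, Num.to_of_nat n⟩
  have : ((2 * (p : ℕ) + 1 : ℕ) : Num) = p.bit1 := by
    rw [← Num.of_to_nat p.bit1, Num.cast_bit1]
  rw [trNat, trNat, this, Num.of_to_nat]
  cases p <;> rfl

theorem trNat_bit0 (n : ℕ) (hn : n ≠ 0) : trNat (2 * n) = Γ'.bit0 :: trNat n := by
  obtain ⟨p, rfl⟩ : ∃ p : Num, (p : ℕ) = n := ⟨n, Num.to_of_nat n⟩
  have : ((2 * (p : ℕ) : ℕ) : Num) = p.bit0 := by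
    rw [← Num.of_to_nat p.bit0, Num.cast_bit0]
  rw [trNat, trNat, this, Num.of_to_nat]
  cases p with
  | zero => simp at hn
  | pos p => rfl

/-- The numerical code of a word. -/
def codeN (u : List (Fin k)) : ℕ := u.foldl (fun N a => (2 * N + 1) * 2 ^ a.val) 1

theorem codeN_append (u : List (Fin k)) (a : Fin k) :
    codeN (u ++ [a]) = (2 * codeN u + 1) * 2 ^ a.val := by
  simp [codeN]

theorem codeN_nil : codeN ([] : List (Fin k)) = 1 := rfl

theorem codeN_pos (u : List (Fin k)) : 0 < codeN u := by
  induction u using List.reverseRecOn with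
  | nil => simp [codeN]
  | append_singleton u a ih => rw [codeN_append]; positivity

theorem odd_mul_two_pow_inj {a b n m : ℕ} (h : (2 * n + 1) * 2 ^ a = (2 * m + 1) * 2 ^ b) :
    a = b ∧ n = m := by
  induction a generalizing b with
  | zero =>
    rcases b with _ | b
    · simp at h; simp [h]
    · rw [pow_succ, ← mul_assoc] at h; simp only [pow_zero, mul_one] at h; omega
  | succ a ih =>
    rcases b with _ | b
    · rw [pow_succ, ← mul_assoc] at h; simp only [pow_zero, mul_one] at h; omega
    · rw [pow_succ, pow_succ, ← mul_assoc, ← mul_assoc] at h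
      have := ih (Nat.eq_of_mul_eq_mul_right (by norm_num) h)
      exact ⟨by rw [this.1], this.2⟩

theorem codeN_injective : Function.Injective (codeN (k := k)) := by
  intro u
  induction u using List.reverseRecOn with
  | nil =>
    intro v h
    rcases List.eq_nil_or_concat v with rfl | ⟨v, a, rfl⟩
    · rfl
    · rw [List.concat_eq_append, codeN_append, codeN_nil] at h
      have := codeN_pos v
      have h3 : 1 ≤ 2 ^ a.val := Nat.one_le_two_pow
      nlinarith
  | append_singleton u a ih =>
    intro v h
    rcases List.eq_nil_or_concat v with rfl | ⟨v, a', rfl⟩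
    · rw [codeN_append, codeN_nil] at h
      have := codeN_pos u
      have h3 : 1 ≤ 2 ^ a.val := Nat.one_le_two_pow
      nlinarith
    · rw [List.concat_eq_append, codeN_append, codeN_append] at h
      rw [List.concat_eq_append]
      obtain ⟨h1, h2⟩ := odd_mul_two_pow_inj h
      rw [ih h2, Fin.ext h1]

theorem primrec_codeN : Primrec (codeN (k := k)) := by
  have hpow : Primrec₂ ((· ^ ·) : ℕ → ℕ → ℕ) := Primrec₂.unpaired'.1 Nat.Primrec.pow
  have hval : Primrec (fun a : Fin k => a.val) := Primrec.fin_val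
  refine Primrec.list_foldl (h := fun _ (p : ℕ × Fin k) => (2 * p.1 + 1) * 2 ^ p.2.val)
    Primrec.id (Primrec.const 1) ?_
  have hp : Primrec (fun q : List (Fin k) × (ℕ × Fin k) => q.2.1) :=
    Primrec.fst.comp Primrec.snd
  have ha : Primrec (fun q : List (Fin k) × (ℕ × Fin k) => q.2.2.val) :=
    hval.comp (Primrec.snd.comp Primrec.snd)
  exact Primrec.nat_mul.comp
    (Primrec.nat_add.comp (Primrec.nat_mul.comp (Primrec.const 2) hp) (Primrec.const 1))
    (hpow.comp (Primrec.const 2) ha)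

/-- A program deciding a computable property of words from their codes. -/
theorem exists_code_decide (g : List (Fin k) → Bool) (hg : Computable g) :
    ∃ c : ToPartrec.Code, ∀ u, [cond (g u) 1 0] ∈ c.eval [codeN u] := by
  let f : ℕ → ℕ → Option ℕ := fun N n => (Encodable.decode (α := List (Fin k)) n).bind fun u =>
    bif decide (codeN u = N) then some (cond (g u) 1 0) else none
  have hf : Computable₂ f := by
    have hdec : Computable (fun p : ℕ × ℕ => Encodable.decode (α := List (Fin k)) p.2) :=
      Computable.decode.comp Computable.snd
    refine Computable.option_bind hdec ?_
    have hu : Computable (fun q : (ℕ × ℕ) × List (Fin k) => q.2) := Computable.snd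
    have hN : Computable (fun q : (ℕ × ℕ) × List (Fin k) => q.1.1) :=
      Computable.fst.comp Computable.fst
    have hdeq : Computable₂ (fun m n : ℕ => decide (m = n)) := Primrec.eq.decide.to_comp
    have heq : Computable (fun q : (ℕ × ℕ) × List (Fin k) => decide (codeN q.2 = q.1.1)) :=
      hdeq.comp (primrec_codeN.to_comp.comp hu) hN
    refine Computable.cond heq ?_ (Computable.const none)
    exact Computable.option_some.comp
      (Computable.cond (hg.comp hu) (Computable.const 1) (Computable.const 0))
  have hpart : Partrec (fun N => Nat.rfindOpt (f N)) := Partrec.rfindOpt hf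
  obtain ⟨c, hc⟩ := ToPartrec.Code.exists_code (Nat.Partrec'.part_iff₁.2 hpart)
  refine ⟨c, fun u => ?_⟩
  have h1 := hc ⟨[codeN u], rfl⟩
  have hval : cond (g u) 1 0 ∈ Nat.rfindOpt (f (codeN u)) := by
    have hdom : (Nat.rfindOpt (f (codeN u))).Dom :=
      Nat.rfindOpt_dom.2 ⟨Encodable.encode u, cond (g u) 1 0, by simp [f]⟩
    obtain ⟨v, hv⟩ := Part.dom_iff_mem.1 hdom
    obtain ⟨n, hn⟩ := Nat.rfindOpt_spec hv
    simp only [f, Option.mem_def, Option.bind_eq_some_iff] at hn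
    obtain ⟨u', hu', h2⟩ := hn
    by_cases h3 : codeN u' = codeN u
    · obtain rfl := codeN_injective h3
      simp only [decide_true, cond_true, Option.some.injEq] at h2
      rw [h2]; exact hv
    · simp [h3] at h2
  change c.eval [codeN u] = _ at h1
  rw [h1]
  exact Part.mem_map_iff _ |>.2 ⟨_, hval, rfl⟩

def St.ofCfg (U : List (Fin k)) (m : ℕ) (x : Cfg') : St k where
  q := match x.l with
    | none => .ans
    | some l => .run (tr l) x.var
  U := U
  m := m
  S := x.stk

theorem reach_stepAux (U : List (Fin k)) (m : ℕ) (q : Stmt') (v : Option Γ')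
    (S : K' → List Γ') :
    (⟨.run q v, U, m, S⟩ : St k).Reach c b (St.ofCfg U m (TM2.stepAux q v S)) := by
  induction q generalizing v S with
  | push s f q ih =>
    refine St.Reach.head ?_
    change St.Reach c b ⟨.run q v, U, m, fun t => (only s (.push (f v)) t).app (S t)⟩ _
    rw [app_only]
    exact ih v _
  | peek s f q ih => exact St.Reach.head (ih (f v (S s).head?) S)
  | pop s f q ih =>
    refine St.Reach.head ?_
    change St.Reach c b ⟨.run q (f v (S s).head?), U, m,
      fun t => (only s .pop t).app (S t)⟩ _
    rw [app_only]
    exact ih (f v (S s).head?) _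
  | load f q ih => exact St.Reach.head (ih (f v) S)
  | branch f q₁ q₂ ih₁ ih₂ =>
    refine St.Reach.head ?_
    change St.Reach c b ⟨.run (cond (f v) q₁ q₂) v, U, m, S⟩
      (St.ofCfg U m (cond (f v) (TM2.stepAux q₁ v S) (TM2.stepAux q₂ v S)))
    cases f v
    exacts [ih₂ v S, ih₁ v S]
  | goto f => exact St.Reach.single
  | halt => exact St.Reach.single

theorem reach_of_reaches (U : List (Fin k)) (m : ℕ) {x y : Cfg'}
    (h : StateTransition.Reaches (TM2.step tr) x y) :
    (St.ofCfg U m x).Reach c b (St.ofCfg U m y) := by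
  induction h with
  | refl => exact St.Reach.refl
  | tail h1 h2 ih =>
    refine ih.trans ?_
    rename_i y z
    obtain ⟨l, v, S⟩ := y
    rcases l with _ | l
    · cases h2
    · obtain rfl := Option.some.inj h2
      exact reach_stepAux U m (tr l) v S

theorem reach_zeros (U : List (Fin k)) (m n N : ℕ) (hN : N ≠ 0) :
    (⟨.lz n, U, m, K'.elim (trNat N ++ [.cons]) [] [] []⟩ : St k).Reach c b
      ⟨.ld, U, m, K'.elim (trNat (N * 2 ^ n) ++ [.cons]) [] [] []⟩ := by
  induction n generalizing N with
  | zero =>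
    simp only [pow_zero, mul_one]
    exact St.Reach.single
  | succ n ih =>
    refine St.Reach.head ?_
    have := ih (2 * N) (by omega)
    rw [trNat_bit0 N hN] at this
    rw [pow_succ, mul_comm (2 ^ n) 2, ← mul_assoc, mul_comm N 2]
    change St.Reach c b ⟨.lz n, U, m, fun t => (only .main (.push .bit0) t).app _⟩ _
    rw [app_only]
    simpa [SAct.app] using this

theorem reach_load (U : List (Fin k)) (m N : ℕ) (hN : N ≠ 0) :
    (⟨.ld, U, m, K'.elim (trNat N ++ [.cons]) [] [] []⟩ : St k).Reach c b
      ⟨.ld, [], m, K'.elim (trNat (U.foldl (fun N a => (2 * N + 1) * 2 ^ a.val) N) ++ [.cons])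
        [] [] []⟩ := by
  induction U generalizing N with
  | nil => exact St.Reach.refl
  | cons a U ih =>
    refine St.Reach.trans ?_ (ih ((2 * N + 1) * 2 ^ a.val) (by positivity))
    refine St.Reach.head ?_
    have := reach_zeros (c := c) (b := b) U m a (2 * N + 1) (by omega)
    rw [trNat_bit1 N] at this
    change St.Reach c b ⟨.lz a, U, m, fun t => (only .main (.push .bit1) t).app _⟩ _
    rw [app_only]
    simpa [SAct.app] using this

theorem reach_phase (u : List (Fin k) → Bool)
    (hc : ∀ w, [cond (u w) 1 0] ∈ c.eval [codeN w]) (x : St k) (hx : x.q = .start) :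
    ∃ y : St k, (x.step c b).Reach c b y ∧
      if u (pre b x.m) then y.q = .start ∧ y.m = x.m + 1 else y.q = .rej := by
  have h1 : x.step c b = ⟨.ld0, pre b x.m, x.m, fun _ => []⟩ := by
    obtain ⟨q, U, m, S⟩ := x
    subst hx
    rfl
  have h2 : (⟨.ld0, pre b x.m, x.m, fun _ => []⟩ : St k).Reach c b
      ⟨.ld, pre b x.m, x.m, K'.elim (trNat 1 ++ [.cons]) [] [] []⟩ := by
    refine St.Reach.head (St.Reach.head ?_)
    change St.Reach c b ⟨.ld, pre b x.m, x.m, fun t => (only .main (.push .bit1) t).app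
      ((fun t => (only .main (.push .cons) t).app ((fun _ => []) t)) t)⟩ _
    have : trNat 1 = [Γ'.bit1] := by simpa using trNat_bit1 0
    rw [app_only, app_only, this]
    convert St.Reach.refl using 2
    funext s
    cases s <;> rfl
  have h3 := reach_load (c := c) (b := b) (pre b x.m) x.m 1 one_ne_zero
  have h4 : (⟨.ld, [], x.m, K'.elim (trNat (codeN (pre b x.m)) ++ [.cons]) [] [] []⟩ :
      St k).Reach c b (St.ofCfg [] x.m (init c [codeN (pre b x.m)])) := by
    refine St.Reach.head ?_
    convert St.Reach.refl using 1
    simp [St.step, St.act, act, UAct.app, SAct.app, St.ofCfg, init, trList, -K'.elim]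
  have h5 : halt [cond (u (pre b x.m)) 1 0] ∈
      StateTransition.eval (TM2.step tr) (init c [codeN (pre b x.m)]) := by
    rw [tr_eval]
    exact Part.mem_map _ (hc _)
  have h6 := reach_of_reaches (c := c) (b := b) [] x.m (StateTransition.mem_eval.1 h5).1
  have h7 := ((h1 ▸ h2).trans (h3.trans h4)).trans h6
  refine ⟨_, h7.trans St.Reach.single, ?_⟩
  have hb1 : trNat 1 = [Γ'.bit1] := by simpa using trNat_bit1 0
  cases hu : u (pre b x.m)
  · simp [St.ofCfg, halt, St.step, St.act, act, trList]
  · simp [St.ofCfg, halt, St.step, St.act, act, trList, hb1]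

theorem reject_iff (u : List (Fin k) → Bool)
    (hc : ∀ w, [cond (u w) 1 0] ∈ c.eval [codeN w]) :
    (∃ t, ((St.step c b)^[t] St.init).q = .rej) ↔ ∃ m, u (pre b m) = false := by
  have key : ∀ m, (∀ i < m, u (pre b i) = true) →
      ∃ t, ((St.step c b)^[t] St.init).q = .start ∧ ((St.step c b)^[t] St.init).m = m := by
    intro m
    induction m with
    | zero => exact fun _ => ⟨0, rfl, rfl⟩
    | succ m ih =>
      intro h
      obtain ⟨t, h1, h2⟩ := ih fun i hi => h i (by omega)
      obtain ⟨y, ⟨n, hn⟩, hy⟩ := reach_phase (c := c) (b := b) u hc _ h1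
      rw [h2, h m (by omega), if_pos rfl] at hy
      refine ⟨n + (t + 1), ?_⟩
      rw [Function.iterate_add_apply, Function.iterate_succ_apply', hn]
      exact hy
  constructor
  · rintro ⟨t, ht⟩
    by_contra! hcon
    obtain ⟨t', h1, h2⟩ := key t fun i _ => by simpa using hcon i
    have hle : t ≤ t' := by
      have := (St.size c b t').2.1
      omega
    have hrej : ∀ n, ((St.step c b)^[n + t] St.init).q = .rej := by
      intro n
      induction n with
      | zero => simpa using ht
      | succ n ih =>
        rw [show n + 1 + t = n + t + 1 by omega, Function.iterate_succ_apply']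
        simp [St.step, St.act, ih, act]
    have := hrej (t' - t)
    rw [Nat.sub_add_cancel hle, h1] at this
    cases this
  · intro h
    classical
    obtain ⟨t, h1, h2⟩ := key (Nat.find h) fun i hi => by simpa using Nat.find_min h hi
    obtain ⟨y, ⟨n, hn⟩, hy⟩ := reach_phase (c := c) (b := b) u hc _ h1
    rw [h2, Nat.find_spec h] at hy
    refine ⟨n + (t + 1), ?_⟩
    rw [Function.iterate_add_apply, Function.iterate_succ_apply', hn]
    simpa using hy

end TMRun

/-- Computable properties of all prefixes of a sequence can be checked by triangles. -/
theorem exists_triSys {k : ℕ} (g : List (Fin k) → Bool) (hg : Computable g) :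
    ∃ X : TriSys (Fin k), ∀ b : ℕ → Fin k,
      ((∀ m, g (pre b m) = true) → ∃ T, ∀ N, X.Tri N T b) ∧
      ((∃ m, g (pre b m) = false) → ∃ N, ∀ T, ¬ X.Tri N T b) := by
  obtain ⟨c, hc⟩ := exists_code_decide g hg
  have hfin := ctrlSet_finite k c
  refine ⟨(checkCA k c).triSys hfin (fun q => q = .rej), fun b => ?_⟩
  have hrun : ∀ (b : ℕ → Fin k) t, ((checkCA k c).run b t).1 ∈ ctrlSet k c := by
    intro b t
    induction t with
    | zero => trivial
    | succ t ih => exact act_ctrlSet c _ _ _ ih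
  have h := (checkCA k c).triSys_spec hfin (fun q => q = .rej) hrun (checkCA_blank c) b
  simp only [checkCA_run] at h
  have hr := reject_iff (c := c) (b := b) g hc
  refine ⟨fun hm => h.1 ?_, fun hm => h.2 (hr.2 hm)⟩
  intro t ht
  obtain ⟨m, hm'⟩ := hr.1 ⟨t, ht⟩
  rw [hm m] at hm'
  cases hm'

section Graph

variable {V : Type} (E : V → V → Prop)

/-- Paths with `n` vertices inside `U`. -/
def gpaths (U : Set V) (n : ℕ) : Set (List V) :=
  {l | l.length = n ∧ l.IsChain E ∧ ∀ x ∈ l, x ∈ U}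

/-- Loops of length `t` at `v`, without their final vertex. -/
def gloops (v : V) (t : ℕ) : Set (List V) :=
  {l | l.length = t ∧ (l ++ [v]).IsChain E ∧ (l ++ [v]).head? = some v}

theorem exists_last_split {α : Type*} {v : α} {l : List α} (h : v ∈ l) :
    ∃ a r, l = a ++ v :: r ∧ v ∉ r := by
  induction l with
  | nil => cases h
  | cons x l ih =>
    by_cases hv : v ∈ l
    · obtain ⟨a, r, rfl, hr⟩ := ih hv
      exact ⟨x :: a, r, rfl, hr⟩
    · rcases List.mem_cons.1 h with rfl | h
      · exact ⟨[], l, rfl, hv⟩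
      · exact absurd h hv

theorem gpaths_succ_subset (U : Set V) (n : ℕ) :
    gpaths E U (n + 1) ⊆ ⋃ q : {v // v ∈ U} × Fin (n + 1),
      Set.image2 (fun l r => l ++ q.1.1 :: r) (gloops E q.1 q.2)
        (gpaths E (U \ {q.1.1}) (n - q.2)) := by
  rintro l ⟨hl, hc, hU⟩
  rcases l with _ | ⟨v, l'⟩
  · simp at hl
  obtain ⟨a, r, har, hr⟩ := exists_last_split (v := v) (l := v :: l') (by simp)
  rw [har] at hl hc hU
  simp only [List.length_append, List.length_cons] at hl
  refine Set.mem_iUnion.2 ⟨(⟨v, hU v (by simp)⟩, ⟨a.length, by omega⟩), a, ⟨rfl, ?_, ?_⟩, r,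
    ⟨by simp only; omega, ?_, ?_⟩, har.symm⟩
  · exact List.IsChain.left_of_append (l₂ := r) (by simpa using hc)
  · rcases a with _ | ⟨x, a⟩
    · rfl
    · simp only [List.cons_append, List.cons.injEq] at har
      simp [har.1]
  · exact hc.suffix ⟨a ++ [v], by simp⟩
  · intro x hx
    refine ⟨hU x (by simp [hx]), ?_⟩
    rintro rfl
    exact hr hx

variable [Finite V]

theorem gpaths_finite (U : Set V) (n : ℕ) : (gpaths E U n).Finite :=
  (List.finite_length_eq V n).subset fun _ h => h.1

theorem gloops_finite (v : V) (n : ℕ) : (gloops E v n).Finite :=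
  (List.finite_length_eq V n).subset fun _ h => h.1

theorem ncard_iUnion_le_sum {ι α : Type*} [Fintype ι] (f : ι → Set α) (hf : ∀ i, (f i).Finite) :
    (⋃ i, f i).ncard ≤ ∑ i, (f i).ncard := by
  classical
  choose t ht using fun i => (hf i).exists_finset_coe
  have h : (⋃ i, f i) = ((Finset.univ.biUnion t : Finset α) : Set α) := by
    ext x
    simp [← ht]
  rw [h, Set.ncard_coe_finset]
  refine Finset.card_biUnion_le.trans (Finset.sum_le_sum fun i _ => ?_)
  rw [← ht i, Set.ncard_coe_finset]

theorem gpaths_card_le (B lam : ℝ) (hB : 1 ≤ B) (hlam : 1 ≤ lam)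
    (h : ∀ v t, ((gloops E v t).ncard : ℝ) ≤ B * lam ^ t) (U : Set V) (n : ℕ) :
    ((gpaths E U n).ncard : ℝ) ≤ (Nat.card V * B * (n + 1)) ^ U.ncard * lam ^ n := by
  classical
  have := Fintype.ofFinite V
  induction hm : U.ncard generalizing U n with
  | zero =>
    rw [Set.ncard_eq_zero] at hm
    subst hm
    have h1 : gpaths E (∅ : Set V) n ⊆ {[]} := by
      rintro l ⟨-, -, h⟩
      rcases l with _ | ⟨x, l⟩
      · rfl
      · exact absurd (h x (by simp)) (by simp)
    have h2 := Set.ncard_le_ncard h1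
    rw [Set.ncard_singleton] at h2
    calc ((gpaths E (∅ : Set V) n).ncard : ℝ) ≤ 1 := by exact_mod_cast h2
      _ ≤ _ := by rw [pow_zero, one_mul]; exact one_le_pow₀ hlam
  | succ m ih =>
    have hVpos : 1 ≤ Nat.card V := by
      have : 0 < U.ncard := by omega
      obtain ⟨v, -⟩ := (Set.ncard_pos (s := U)).1 this
      have : Nonempty V := ⟨v⟩
      exact Nat.card_pos
    have hV1 : (1 : ℝ) ≤ Nat.card V := by exact_mod_cast hVpos
    set c : ℝ := Nat.card V * B with hc
    have hc1 : 1 ≤ c := by nlinarith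
    rcases n with _ | n
    · have h1 : gpaths E U 0 ⊆ {[]} := by
        rintro l ⟨h, -⟩
        exact List.length_eq_zero_iff.1 h
      have h2 := Set.ncard_le_ncard h1
      rw [Set.ncard_singleton] at h2
      calc ((gpaths E U 0).ncard : ℝ) ≤ 1 := by exact_mod_cast h2
        _ ≤ _ := by
          rw [pow_zero, mul_one]
          exact one_le_pow₀ (by simpa using hc1)
    · have hsub := gpaths_succ_subset E U n
      have h1 : (gpaths E U (n + 1)).ncard ≤ ∑ q : {v // v ∈ U} × Fin (n + 1),
          (gloops E q.1.1 q.2).ncard * (gpaths E (U \ {q.1.1}) (n - q.2)).ncard := by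
        refine (Set.ncard_le_ncard hsub ?_).trans ?_
        · exact Set.finite_iUnion fun q =>
            (gloops_finite E _ _).image2 _ (gpaths_finite E _ _)
        · have hfin : ∀ q : {v // v ∈ U} × Fin (n + 1), (Set.image2 (fun l r => l ++ q.1.1 :: r)
              (gloops E q.1 q.2) (gpaths E (U \ {q.1.1}) (n - q.2))).Finite := fun q =>
            (gloops_finite E _ _).image2 _ (gpaths_finite E _ _)
          have h3 := ncard_iUnion_le_sum _ hfin
          refine h3.trans (Finset.sum_le_sum fun q _ => ?_)
          rw [← Set.image_prod]
          refine (Set.ncard_image_le ((gloops_finite E _ _).prod (gpaths_finite E _ _))).trans ?_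
          rw [Set.ncard_prod]
      have h2 : ∀ q : {v // v ∈ U} × Fin (n + 1),
          ((gloops E q.1.1 q.2).ncard * (gpaths E (U \ {q.1.1}) (n - q.2)).ncard : ℝ) ≤
            B * (c * (n + 2)) ^ m * lam ^ (n + 1) := by
        rintro ⟨⟨v, hv⟩, t, ht⟩
        have hcard : (U \ {v}).ncard = m := by
          rw [Set.ncard_sdiff_singleton_of_mem hv]; omega
        have h4 := ih (U \ {v}) (n - t) hcard
        have h5 := h v t
        have h6 : (gloops E v t).ncard * (gpaths E (U \ {v}) (n - t)).ncard ≤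
            (B * lam ^ t) * ((c * ((n - t : ℕ) + 1)) ^ m * lam ^ (n - t)) := by gcongr
        refine h6.trans ?_
        have h7 : lam ^ t * lam ^ (n - t) = lam ^ n := by
          rw [← pow_add]; congr 1; omega
        have h8 : ((n - t : ℕ) : ℝ) ≤ n := by exact_mod_cast Nat.sub_le n t
        calc (B * lam ^ t) * ((c * ((n - t : ℕ) + 1)) ^ m * lam ^ (n - t))
            = B * (c * ((n - t : ℕ) + 1)) ^ m * (lam ^ t * lam ^ (n - t)) := by ring
          _ ≤ B * (c * (n + 2)) ^ m * lam ^ (n + 1) := by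
            rw [h7]
            have : (0 : ℝ) ≤ (n - t : ℕ) := Nat.cast_nonneg _
            gcongr
            · linarith
            · omega
      have h3 : ((gpaths E U (n + 1)).ncard : ℝ) ≤ ∑ q : {v // v ∈ U} × Fin (n + 1),
          (B * (c * (n + 2)) ^ m * lam ^ (n + 1)) := by
        have h4 := (Nat.cast_le (α := ℝ)).2 h1
        push_cast at h4
        exact h4.trans (Finset.sum_le_sum fun q _ => h2 q)
      refine h3.trans ?_
      rw [Finset.sum_const, nsmul_eq_mul, Finset.card_univ, Fintype.card_prod, Fintype.card_fin]
      have h9 : (Fintype.card {v // v ∈ U} : ℝ) ≤ Nat.card V := by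
        rw [Nat.card_eq_fintype_card]
        exact_mod_cast Fintype.card_subtype_le _
      push_cast
      calc (Fintype.card {v // v ∈ U} * (n + 1) * (B * (c * (n + 2)) ^ m * lam ^ (n + 1)) : ℝ)
          ≤ Nat.card V * (n + 1 + 1) * (B * (c * (n + 2)) ^ m * lam ^ (n + 1)) := by
            gcongr
            linarith
        _ = _ := by rw [pow_succ, hc]; ring

end Graph

section Words

variable {k : ℕ} (F : Finset (List (Fin k)))

/-- Blocks occurring in the subshift. -/
def okBlock (M : ℕ) (u : Fin (M + 1) → Fin k) : Prop :=
  ∃ x ∈ SFT1 F, ∀ j : Fin (M + 1), x (j : ℕ) = u j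

def blockE (M : ℕ) (u w : Fin (M + 1) → Fin k) : Prop :=
  (∀ j : Fin M, u j.succ = w j.castSucc) ∧ okBlock F M u

theorem shift_mem_SFT1 {x : ℤ → Fin k} (hx : x ∈ SFT1 F) (n : ℤ) :
    (fun i => x (i + n)) ∈ SFT1 F := by
  rintro w hw ⟨i, hi⟩
  refine hx w hw ⟨i + n, fun m hm => ?_⟩
  rw [← hi m hm]
  ring_nf

theorem mem_SFT1_of_blocks {M : ℕ} (hM : ∀ w ∈ F, w.length ≤ M + 1) (z : ℤ → Fin (M + 1) → Fin k)
    (hz : ∀ i, blockE F M (z i) (z (i + 1))) : (fun i => z i 0) ∈ SFT1 F := by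
  have key : ∀ (j : ℕ) (hj : j < M + 1) i, z i ⟨j, hj⟩ = z (i + j) 0 := by
    intro j
    induction j with
    | zero => intro hj i; simp
    | succ j ih =>
      intro hj i
      have := (hz i).1 ⟨j, by omega⟩
      refine (this.trans (ih (by omega) (i + 1))).trans ?_
      push_cast
      ring_nf
  rintro w hw ⟨i, hi⟩
  obtain ⟨x, hx, hxz⟩ := (hz i).2
  refine hx w hw ⟨0, fun m hm => ?_⟩
  rw [← hi m hm, zero_add]
  have hm' : m < M + 1 := hm.trans_le (hM w hw)
  exact (hxz ⟨m, hm'⟩).trans (key m hm' i)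

theorem loop_injective (M : ℕ) (v : Fin (M + 1) → Fin k) (l l' : List (Fin (M + 1) → Fin k))
    (h : (l ++ [v]).IsChain (blockE F M)) (h' : (l' ++ [v]).IsChain (blockE F M))
    (he : l.map (· 0) = l'.map (· 0)) : l = l' := by
  induction l generalizing l' with
  | nil => simpa using he.symm
  | cons a l ih =>
    rcases l' with _ | ⟨a', l'⟩
    · simp at he
    simp only [List.map_cons, List.cons.injEq] at he
    have h1 : l = l' := ih l' h.tail h'.tail he.2
    subst h1
    congr 1
    obtain ⟨b, r, hb⟩ : ∃ b r, l ++ [v] = b :: r := by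
      rcases l with _ | ⟨b, r⟩
      · exact ⟨_, _, rfl⟩
      · exact ⟨_, _, rfl⟩
    rw [List.cons_append, hb] at h h'
    have e1 := (List.isChain_cons_cons.1 h).1.1
    have e2 := (List.isChain_cons_cons.1 h').1.1
    funext j
    refine Fin.cases he.1 (fun j => ?_) j
    rw [e1, e2]

theorem logb_natCast_nonneg (n : ℕ) : 0 ≤ Real.logb 2 (n : ℝ) := by
  rcases n with _ | n
  · simp
  · exact Real.logb_nonneg (by norm_num) (by push_cast; linarith [Nat.cast_nonneg (α := ℝ) n])

theorem finite_words (H : Set (ℤ → Fin k)) (n : ℕ) :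
    {w : List (Fin k) | w.length = n ∧ wordIn H w}.Finite :=
  (List.finite_length_eq (Fin k) n).subset fun _ h => h.1

theorem wordCount_pos {H : Set (ℤ → Fin k)} (hne : H.Nonempty) (n : ℕ) : 0 < wordCount H n := by
  obtain ⟨x, hx⟩ := hne
  refine (Set.ncard_pos (finite_words H n)).2 ⟨List.ofFn fun i : Fin n => x i, by simp,
    x, hx, 0, fun m hm => ?_⟩
  simp

theorem entropy1_le {H : Set (ℤ → Fin k)} (n : ℕ) (hn : n ≠ 0) :
    entropy1 H * n ≤ Real.logb 2 (wordCount H n) := by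
  obtain ⟨n, rfl⟩ := Nat.exists_eq_succ_of_ne_zero hn
  have : entropy1 H ≤ Real.logb 2 (wordCount H (n + 1)) / ((n : ℝ) + 1) :=
    ciInf_le ⟨0, by
      rintro _ ⟨m, rfl⟩
      exact div_nonneg (logb_natCast_nonneg _) (by positivity)⟩ n
  rw [le_div_iff₀ (by positivity)] at this
  simpa using this

theorem wordCount_le_gpaths (M n : ℕ) :
    wordCount (SFT1 F) n ≤ (gpaths (blockE F M) Set.univ n).ncard := by
  classical
  have h1 : {w : List (Fin k) | w.length = n ∧ wordIn (SFT1 F) w} ⊆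
      (fun l : List (Fin (M + 1) → Fin k) => l.map (· 0)) ''
        (gpaths (blockE F M) Set.univ n) := by
    rintro w ⟨hw, x, hx, i, hi⟩
    refine ⟨List.ofFn (fun (m : Fin n) (j : Fin (M + 1)) => x (i + m + j)),
      ⟨by simp, ?_, fun _ _ => trivial⟩, ?_⟩
    · rw [List.isChain_iff_getElem]
      intro m hm
      simp only [List.getElem_ofFn]
      refine ⟨fun j => ?_, _, shift_mem_SFT1 F hx (i + m), fun j => ?_⟩
      · simp only [Fin.val_succ, Fin.val_castSucc]
        push_cast
        ring_nf
      · congr 1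
        ring
    · refine List.ext_getElem (by simp [hw]) fun m h1 h2 => ?_
      simp only [List.getElem_map, List.getElem_ofFn]
      have := hi m h2
      simpa using this
  exact (Set.ncard_le_ncard h1 ((gpaths_finite _ _ _).image _)).trans
    (Set.ncard_image_le (gpaths_finite _ _ _))

/-- Below the entropy there are many freely concatenable words of a common length. -/
theorem exists_words (h : ℝ) (h0 : 0 ≤ h) (hlt : h < entropy1 (SFT1 F))
    (hne : (SFT1 F).Nonempty) :
    ∃ ℓ s : ℕ, 0 < ℓ ∧ 0 < s ∧ h * ℓ ≤ s ∧ ∃ W : Fin (2 ^ s) → ℕ → Fin k,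
      (∀ a b, (∀ p < ℓ, W a p = W b p) → a = b) ∧
      ∀ (w : ℤ → Fin (2 ^ s)) (p : ℤ → ℕ), (∀ i, p i < ℓ) →
        (∀ i, (p (i + 1) = p i + 1 ∧ w (i + 1) = w i) ∨ (p i + 1 = ℓ ∧ p (i + 1) = 0)) →
        (fun i => W (w i) (p i)) ∈ SFT1 F := by
  classical
  set M := F.sup List.length with hMdef
  have hM : ∀ w ∈ F, w.length ≤ M + 1 := fun w hw =>
    (Finset.le_sup (f := List.length) hw).trans (Nat.le_succ _)
  obtain ⟨v, t, hvt⟩ : ∃ v t, 2 * (2 ^ h : ℝ) ^ t < (gloops (blockE F M) v t).ncard := by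
    by_contra! hcon
    have hlam : (1 : ℝ) ≤ 2 ^ h := Real.one_le_rpow (by norm_num) h0
    have h1 := gpaths_card_le (blockE F M) 2 (2 ^ h) (by norm_num) hlam hcon Set.univ
    set D := (Set.univ : Set (Fin (M + 1) → Fin k)).ncard
    set c : ℝ := Nat.card (Fin (M + 1) → Fin k) * 2 with hc
    have hk : 0 < c := by
      obtain ⟨x, -⟩ := hne
      have : Nonempty (Fin (M + 1) → Fin k) := ⟨fun _ => x 0⟩
      have : 0 < Nat.card (Fin (M + 1) → Fin k) := Nat.card_pos
      positivity
    have h2 : ∀ n : ℕ, n ≠ 0 →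
        ((2 : ℝ) ^ (entropy1 (SFT1 F) - h)) ^ n ≤ (c * (n + 1)) ^ D := by
      intro n hn
      have h3 := entropy1_le (H := SFT1 F) n hn
      have hpos : (0 : ℝ) < wordCount (SFT1 F) n := by exact_mod_cast wordCount_pos hne n
      rw [Real.le_logb_iff_rpow_le (by norm_num) hpos] at h3
      have h4 : (wordCount (SFT1 F) n : ℝ) ≤ (c * (n + 1)) ^ D * (2 ^ h) ^ n :=
        (by exact_mod_cast wordCount_le_gpaths F M n :
          (wordCount (SFT1 F) n : ℝ) ≤ (gpaths (blockE F M) Set.univ n).ncard).trans (h1 n)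
      have h5 := h3.trans h4
      rw [Real.rpow_mul (by norm_num), Real.rpow_natCast] at h5
      rw [Real.rpow_sub (by norm_num), div_pow, div_le_iff₀ (by positivity)]
      exact h5
    set r : ℝ := 2 ^ (entropy1 (SFT1 F) - h) with hr
    have hr1 : 1 < r := Real.one_lt_rpow (by norm_num) (by linarith)
    have ht : Tendsto (fun n : ℕ => (n : ℝ) ^ D / r ^ n) atTop (nhds 0) :=
      tendsto_pow_const_div_const_pow_of_one_lt D hr1
    have hev := ht.eventually (gt_mem_nhds (show (0 : ℝ) < 1 / (c * 2) ^ D by positivity))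
    obtain ⟨n, hn, hn1⟩ := (hev.and (eventually_ge_atTop 1)).exists
    have h6 := h2 n (by omega)
    have hnr : (1 : ℝ) ≤ n := by exact_mod_cast hn1
    have h7 : (c * (n + 1)) ^ D ≤ (c * 2) ^ D * (n : ℝ) ^ D := by
      rw [← mul_pow]
      refine pow_le_pow_left₀ (by positivity) ?_ _
      nlinarith
    rw [div_lt_div_iff₀ (by positivity) (by positivity)] at hn
    nlinarith
  have ht : 0 < t := by
    rcases Nat.eq_zero_or_pos t with rfl | ht
    · have h1 : gloops (blockE F M) v 0 ⊆ {[]} := fun l hl => List.length_eq_zero_iff.1 hl.1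
      have h2 := Set.ncard_le_ncard h1
      rw [Set.ncard_singleton] at h2
      have h3 : ((gloops (blockE F M) v 0).ncard : ℝ) ≤ 1 := by exact_mod_cast h2
      norm_num at hvt
      linarith
    · exact ht
  set N := (gloops (blockE F M) v t).ncard with hN
  have hNpos : N ≠ 0 := by
    intro h3
    rw [h3] at hvt
    have : (0 : ℝ) < 2 * (2 ^ h) ^ t := by positivity
    simp only [Nat.cast_zero] at hvt
    linarith
  set s := Nat.log 2 N with hs
  have hs1 : 2 ^ s ≤ N := Nat.pow_log_le_self 2 hNpos
  have hs2 : N < 2 ^ (s + 1) := Nat.lt_pow_succ_log_self (by norm_num) N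
  have hht : h * t < s := by
    have h1 : 2 * (2 ^ h : ℝ) ^ t < 2 ^ (s + 1) := hvt.trans (by exact_mod_cast hs2)
    rw [pow_succ, mul_comm, ← Real.rpow_natCast, ← Real.rpow_mul (by norm_num),
      mul_lt_mul_iff_left₀ (by norm_num), ← Real.rpow_natCast,
      Real.rpow_lt_rpow_left_iff (by norm_num)] at h1
    exact h1
  have hspos : 0 < s := by
    have : (0 : ℝ) ≤ h * t := by positivity
    exact_mod_cast this.trans_lt hht
  obtain ⟨f, hf⟩ : ∃ f : Fin (2 ^ s) → gloops (blockE F M) v t, Function.Injective f := by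
    have := (gloops_finite (blockE F M) v t).fintype
    have : Fintype.card (Fin (2 ^ s)) ≤ Fintype.card (gloops (blockE F M) v t) := by
      rw [Fintype.card_fin, ← Nat.card_eq_fintype_card, Nat.card_coe_set_eq]
      exact hs1
    obtain ⟨e⟩ := Function.Embedding.nonempty_of_card_le this
    exact ⟨e, e.injective⟩
  have hlen : ∀ a, (f a).1.length = t := fun a => (f a).2.1
  refine ⟨t, s, ht, hspos, hht.le, fun a p => ((f a).1.getD p v) 0, ?_, ?_⟩
  · intro a b hab
    refine hf (Subtype.ext (loop_injective F M v _ _ (f a).2.2.1 (f b).2.2.1 ?_))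
    refine List.ext_getElem (by simp [hlen]) fun m h1 h2 => ?_
    simp only [List.length_map] at h1 h2
    have := hab m (by rw [← hlen a]; exact h1)
    simpa [h1, h2] using this
  · intro w p hp hstep
    refine mem_SFT1_of_blocks F hM (fun i => (f (w i)).1.getD (p i) v) fun i => ?_
    have hE := List.isChain_iff_getElem.1 (f (w i)).2.2.1 (p i) (by
      simp only [List.length_append, List.length_singleton, hlen]
      have := hp i
      omega)
    have hpi : p i < (f (w i)).1.length := by rw [hlen]; exact hp i
    rw [List.getElem_append_left hpi] at hE
    rcases hstep i with ⟨h1, h2⟩ | ⟨h1, h2⟩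
    · have h3 : p i + 1 < (f (w i)).1.length := by rw [hlen, ← h1]; exact hp _
      rw [List.getElem_append_left h3] at hE
      simpa [h1, h2, hpi, h3] using hE
    · have h3 : (f (w (i + 1))).1.getD (p (i + 1)) v = v := by
        have h4 := (f (w (i + 1))).2.2.2
        have h5 := hlen (w (i + 1))
        rw [h2]
        rcases hl : (f (w (i + 1))).1 with _ | ⟨x, l⟩
        · rw [hl] at h5; simp at h5; omega
        · rw [hl] at h4
          simpa using h4
      rw [List.getElem_append_right (by rw [hlen]; omega)] at hE
      simp only [h3]
      simpa [hpi] using hE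

end Words

theorem int_const {α : Type*} {f : ℤ → α} (h : ∀ i, f (i + 1) = f i) (i j : ℤ) : f i = f j := by
  have key : ∀ i, f i = f 0 := by
    intro i
    induction i using Int.induction_on with
    | zero => rfl
    | succ i ih => rw [h, ih]
    | pred i ih => rw [← ih, ← h (-(i : ℤ) - 1), sub_add_cancel]
  rw [key i, key j]

theorem emod_add_one {N : ℕ} (hN : 0 < N) (x : ℤ) :
    (x + 1) % N = if (N : ℤ) ∣ x + 1 then 0 else x % N + 1 := by
  split_ifs with h
  · exact Int.emod_eq_zero_of_dvd h
  · have h0 : (0 : ℤ) < N := by exact_mod_cast hN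
    have h1 := Int.emod_lt_of_pos x h0
    have h2 := Int.emod_nonneg x h0.ne'
    rw [← Int.emod_add_emod]
    refine Int.emod_eq_of_lt (by omega) ?_
    by_contra h3
    have h4 : x % N + 1 = N := by omega
    apply h
    rw [Int.dvd_iff_emod_eq_zero, ← Int.emod_add_emod, h4,
      Int.emod_self]

theorem consecutive_multiples {N : ℕ} (hN : 0 < N) {c i i' : ℤ} (h : i < i')
    (hi : (N : ℤ) ∣ i - c) (hi' : (N : ℤ) ∣ i' - c)
    (hb : ∀ m, i < m → m < i' → ¬ (N : ℤ) ∣ m - c) : i' = i + N := by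
  have h1 : (N : ℤ) ∣ i' - i := by
    have := dvd_sub hi' hi
    rwa [sub_sub_sub_cancel_right] at this
  have h2 := Int.le_of_dvd (by omega) h1
  by_contra h3
  refine hb (i + N) (by omega) (by omega) ?_
  rw [add_sub_right_comm]
  exact dvd_add hi (dvd_refl _)

section HalfPlane

variable {k : ℕ} (X : TriSys (Fin k))

/-- Cells of the system verifying, above a special row, that the columns spell a good sequence. -/
structure ACell where
  ty : Option Bool
  a : Fin k
  s : Bool
  o : Bool
  ins : Bool
  sl : Bool
  insl : Bool
  po : Bool
  last : Bool
  epn : Bool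
  est : Bool
  d : X.S

instance : Finite (ACell X) := by
  have := X.fin
  refine Finite.of_injective (fun c : ACell X => (c.ty, c.a, c.s, c.o, c.ins, c.sl, c.insl, c.po,
    c.last, c.epn, c.est, c.d)) ?_
  rintro ⟨⟩ ⟨⟩ h
  simpa using h

structure AH (x y : ACell X) : Prop where
  ty : y.ty = x.ty
  last : y.last = x.last
  epn : y.epn = x.epn
  est : y.est = x.est
  sl : y.sl = x.s
  insl : y.insl = x.ins
  full : y.s = true → x.ins = x.last
  turn : x.last = true → y.o = true → x.s = x.epn
  H : x.ins = true → y.ins = true → y.s = false → X.H x.d y.d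
  L : x.s = true → X.L x.d
  special : x.ty = some false →
    x.s = true ∧ x.o = true ∧ x.ins = true ∧ X.Dg x.d ∧ X.inp x.d = x.a

structure AStep (x y : ACell X) : Prop where
  grow : x.last = false → y.s = x.s ∧ y.o = x.o ∧ y.ins = (x.ins || x.insl) ∧
    (x.ins = true → X.V x.d y.d) ∧
    (x.ins = false → y.ins = true → X.Dg y.d ∧ X.inp y.d = y.a)
  reset : x.last = true → y.ins = y.s ∧ (y.s = true → X.Dg y.d ∧ X.inp y.d = y.a)
  shift : x.last = true → x.epn = false → y.o = x.o ∧ y.s = x.sl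
  double : x.last = true → x.epn = true → y.o = y.s ∧ (y.s = true → x.o = true) ∧
    y.po = x.o ∧ y.est = true

structure AV (x y : ACell X) : Prop where
  a : y.a = x.a
  below : x.ty = none → y.ty ≠ some true
  above : x.ty ≠ none → y.ty = some true ∧ AStep X x y

structure AValid (C : ℤ → ℤ → ACell X) : Prop where
  H : ∀ i j, AH X (C i j) (C (i + 1) j)
  V : ∀ i j, AV X (C i j) (C i (j + 1))
  skip : ∀ j, Skip (fun x : ACell X => x.est = true ∧ x.po = true)
    (fun x y => y.s = !x.s) (fun i => C i j)

theorem sofic_AValid : Sofic {C | AValid X C} := by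
  have := (sofic_adj (AH X) (AV X)).inter
    (sofic_hskip (fun x : ACell X => x.est = true ∧ x.po = true) (fun x y => y.s = !x.s))
  convert this using 1
  ext C
  exact ⟨fun h => ⟨fun i j => ⟨h.H i j, h.V i j⟩, h.skip⟩,
    fun h => ⟨fun i j => (h.1 i j).1, fun i j => (h.1 i j).2, h.2⟩⟩

variable {X} {C : ℤ → ℤ → ACell X}

/-- Rows at which new triangles of width `N` start at the positions congruent to `c`. -/
structure AStart (C : ℤ → ℤ → ACell X) (N : ℕ) (c₀ c j : ℤ) : Prop where
  ty : ∀ i, (C i j).ty ≠ none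
  s : ∀ i, (C i j).s = true ↔ (N : ℤ) ∣ i - c
  o : ∀ i, (C i j).o = true ↔ (N : ℤ) ∣ i - c₀
  ins : ∀ i, (C i j).ins = (C i j).s
  diag : ∀ i, (C i j).s = true → X.Dg (C i j).d ∧ X.inp (C i j).d = (C i j).a

theorem AValid.last_const (hC : AValid X C) (i i' j : ℤ) : (C i j).last = (C i' j).last :=
  int_const (f := fun i => (C i j).last) (fun i => (hC.H i j).last) i i'

theorem AValid.epn_const (hC : AValid X C) (i i' j : ℤ) : (C i j).epn = (C i' j).epn :=
  int_const (f := fun i => (C i j).epn) (fun i => (hC.H i j).epn) i i'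

theorem AValid.a_const (hC : AValid X C) (i j j' : ℤ) : (C i j).a = (C i j').a :=
  int_const (f := fun j => (C i j).a) (fun j => (hC.V i j).a) j j'

theorem AStart.last (hC : AValid X C) {N : ℕ} (hN : 0 < N) {c j : ℤ} {m : ℕ}
    (hs : ∀ i, (C i j).s = true ↔ (N : ℤ) ∣ i - c)
    (hins : ∀ i, (C i j).ins = true ↔ (i - c) % N ≤ m) (i : ℤ) :
    (C i j).last = true ↔ N ≤ m + 1 := by
  have h1 := (hC.H (c - 1) j).full (by rw [hs]; simp)
  rw [hC.last_const i (c - 1) j, ← h1, hins]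
  have h2 := emod_add_one hN (c - 1 - c)
  have h0 : (0 : ℤ) < N := by exact_mod_cast hN
  have h3 : (c - 1 - c) % (N : ℤ) = N - 1 := by
    rw [show c - 1 - c = (N - 1) + N * (-1) by ring, Int.add_mul_emod_self_left]
    exact Int.emod_eq_of_lt (by omega) (by omega)
  rw [h3]
  omega

theorem AStart.rows (hC : AValid X C) {N : ℕ} (hN : 0 < N) {c₀ c j : ℤ}
    (h : AStart C N c₀ c j) (m : ℕ)
    (hm : m < N) : (∀ i, (C i (j + m)).ty ≠ none) ∧
      (∀ i, (C i (j + m)).s = true ↔ (N : ℤ) ∣ i - c) ∧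
      (∀ i, (C i (j + m)).o = true ↔ (N : ℤ) ∣ i - c₀) ∧
      (∀ i, (C i (j + m)).ins = true ↔ (i - c) % N ≤ m) := by
  have h0 : (0 : ℤ) < N := by exact_mod_cast hN
  induction m with
  | zero =>
    simp only [Nat.cast_zero, add_zero]
    refine ⟨h.ty, h.s, h.o, fun i => ?_⟩
    rw [h.ins, h.s, Int.dvd_iff_emod_eq_zero]
    have := Int.emod_nonneg (i - c) h0.ne'
    omega
  | succ m ih =>
    obtain ⟨h1, h2, h3, h4⟩ := ih (by omega)
    have hlast : ∀ i, (C i (j + m)).last = false := fun i => by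
      have := AStart.last hC hN h2 h4 i
      rw [← Bool.not_eq_true, this]
      omega
    push_cast
    rw [← add_assoc]
    have hg := fun i => ((hC.V i (j + m)).above (h1 i)).2.grow (hlast i)
    refine ⟨fun i => ?_, fun i => ?_, fun i => ?_, fun i => ?_⟩
    · rw [((hC.V i (j + m)).above (h1 i)).1]
      simp
    · rw [(hg i).1, h2]
    · rw [(hg i).2.1, h3]
    · rw [(hg i).2.2.1, Bool.or_eq_true]
      have h5 := (hC.H (i - 1) (j + m)).insl
      rw [sub_add_cancel] at h5
      rw [h5, h4, h4]
      have h6 := emod_add_one hN (i - 1 - c)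
      rw [show i - 1 - c + 1 = i - c by ring] at h6
      have h7 := Int.emod_nonneg (i - 1 - c) h0.ne'
      have h8 := Int.emod_lt_of_pos (i - 1 - c) h0
      have h9 : (N : ℤ) ∣ i - c → (i - 1 - c) % N = N - 1 := by
        intro hd
        have h10 := AStart.last hC hN h2 h4 (i - 1)
        obtain ⟨q, hq⟩ := hd
        rw [show i - 1 - c = (N - 1) + N * (q - 1) by rw [mul_sub, ← hq]; ring,
          Int.add_mul_emod_self_left]
        exact Int.emod_eq_of_lt (by omega) (by omega)
      split_ifs at h6 with hd
      · have := h9 hd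
        omega
      · omega

theorem AStart.tri (hC : AValid X C) {N : ℕ} (hN : 0 < N) {c₀ c j : ℤ}
    (h : AStart C N c₀ c j) {p : ℤ}
    (hp : (N : ℤ) ∣ p - c) :
    X.Tri N (fun m n => (C (p + m) (j + n)).d) (fun n => (C (p + n) j).a) := by
  have hR := h.rows hC hN
  have h0 : (0 : ℤ) < N := by exact_mod_cast hN
  have hmod : ∀ m : ℕ, m < N → (p + m - c) % N = m := by
    intro m hm
    obtain ⟨q, hq⟩ := hp
    rw [show p + m - c = m + N * q by rw [← hq]; ring, Int.add_mul_emod_self_left]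
    exact Int.emod_eq_of_lt (by omega) (by omega)
  have hdg : ∀ n < N, X.Dg (C (p + n) (j + n)).d ∧
      X.inp (C (p + n) (j + n)).d = (C (p + n) (j + n)).a := by
    intro n hn
    rcases n with _ | n
    · simp only [Nat.cast_zero, add_zero]
      exact h.diag p ((h.s p).2 hp)
    · obtain ⟨h1, h2, h3, h4⟩ := hR n (by omega)
      obtain ⟨-, -, -, h5⟩ := hR (n + 1) hn
      have hlast : (C (p + (n + 1 : ℕ)) (j + n)).last = false := by
        have := AStart.last hC hN h2 h4 (p + (n + 1 : ℕ))
        rw [← Bool.not_eq_true, this]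
        omega
      have := (((hC.V (p + (n + 1 : ℕ)) (j + n)).above (h1 _)).2.grow hlast).2.2.2.2
      rw [add_assoc j] at this
      have h6 := h4 (p + (n + 1 : ℕ))
      have h7 := h5 (p + (n + 1 : ℕ))
      rw [hmod _ hn] at h6 h7
      push_cast at *
      refine this ?_ (h7.2 (by omega))
      rw [← Bool.not_eq_true, h6]
      omega
  constructor
  · intro n hn
    have := (hR n hn).2.1 p
    simpa using (hC.H p (j + n)).L (this.2 hp)
  · intro m n hm hn
    obtain ⟨h1, h2, h3, h4⟩ := hR n hn
    have h5 := (hC.H (p + m) (j + n)).H ((h4 _).2 (by rw [hmod m (by omega)]; omega))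
    have h6 := hmod (m + 1) (by omega)
    push_cast at h6 ⊢
    rw [← add_assoc] at h6 ⊢
    refine h5 ((h4 _).2 (by rw [h6]; omega)) ?_
    rw [← Bool.not_eq_true, h2, Int.dvd_iff_emod_eq_zero, h6]
    omega
  · intro m n hm hn
    obtain ⟨h1, h2, h3, h4⟩ := hR n (by omega)
    have hlast : (C (p + m) (j + n)).last = false := by
      have := AStart.last hC hN h2 h4 (p + m)
      rw [← Bool.not_eq_true, this]
      omega
    have := (((hC.V (p + m) (j + n)).above (h1 _)).2.grow hlast).2.2.2.1
      ((h4 _).2 (by rw [hmod m (by omega)]; omega))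
    push_cast
    rwa [← add_assoc]
  · exact fun n hn => (hdg n hn).1
  · exact fun n hn => (hdg n hn).2.trans (hC.a_const _ _ _)

theorem AStart.shift (hC : AValid X C) {N : ℕ} (hN : 0 < N) {c₀ c j : ℤ} (h : AStart C N c₀ c j)
    (hc : ¬ (N : ℤ) ∣ c + 1 - c₀) : AStart C N c₀ (c + 1) (j + N) := by
  obtain ⟨h1, h2, h3, h4⟩ := h.rows hC hN (N - 1) (by omega)
  have hj : j + ((N - 1 : ℕ) : ℤ) + 1 = j + N := by omega
  have hlast : ∀ i, (C i (j + (N - 1 : ℕ))).last = true := fun i =>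
    (AStart.last hC hN h2 h4 i).2 (by omega)
  have hepn : ∀ i, (C i (j + (N - 1 : ℕ))).epn = false := by
    intro i
    rw [hC.epn_const i (c₀ - 1), ← (hC.H (c₀ - 1) _).turn (hlast _) (by rw [h3]; simp),
      ← Bool.not_eq_true, h2]
    intro hd
    rw [show c₀ - 1 - c = -(c + 1 - c₀) by ring, dvd_neg] at hd
    exact hc hd
  have hst := fun i => (hC.V i (j + (N - 1 : ℕ))).above (h1 i)
  rw [hj] at hst
  have hs : ∀ i, (C i (j + N)).s = true ↔ (N : ℤ) ∣ i - (c + 1) := by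
    intro i
    have := (hC.H (i - 1) (j + (N - 1 : ℕ))).sl
    rw [sub_add_cancel] at this
    rw [((hst i).2.shift (hlast i) (hepn i)).2, this, h2]
    ring_nf
  refine ⟨fun i => by simp [(hst i).1], hs, fun i => ?_, fun i => ((hst i).2.reset (hlast i)).1,
    fun i => ((hst i).2.reset (hlast i)).2⟩
  rw [((hst i).2.shift (hlast i) (hepn i)).1, h3]

theorem AStart.double (hC : AValid X C) {N : ℕ} (hN : 0 < N) {c₀ c j : ℤ} (h : AStart C N c₀ c j)
    (hc : (N : ℤ) ∣ c + 1 - c₀) : ∃ c₁, AStart C (2 * N) c₁ c₁ (j + N) := by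
  obtain ⟨h1, h2, h3, h4⟩ := h.rows hC hN (N - 1) (by omega)
  have hj : j + ((N - 1 : ℕ) : ℤ) + 1 = j + N := by omega
  have hlast : ∀ i, (C i (j + (N - 1 : ℕ))).last = true := fun i =>
    (AStart.last hC hN h2 h4 i).2 (by omega)
  have hepn : ∀ i, (C i (j + (N - 1 : ℕ))).epn = true := by
    intro i
    rw [hC.epn_const i (c₀ - 1), ← (hC.H (c₀ - 1) _).turn (hlast _) (by rw [h3]; simp), h2,
      show c₀ - 1 - c = -(c + 1 - c₀) by ring, dvd_neg]
    exact hc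
  have hst := fun i => (hC.V i (j + (N - 1 : ℕ))).above (h1 i)
  rw [hj] at hst
  have hd := fun i => (hst i).2.double (hlast i) (hepn i)
  have hP : ∀ i, ((C i (j + N)).est = true ∧ (C i (j + N)).po = true) ↔ (N : ℤ) ∣ i - c₀ := by
    intro i
    rw [(hd i).2.2.1, h3]
    simp [(hd i).2.2.2]
  have h0 : (0 : ℤ) < N := by exact_mod_cast hN
  have halt : ∀ i, (N : ℤ) ∣ i - c₀ → (C (i + N) (j + N)).s = !(C i (j + N)).s := by
    intro i hi
    have hi' : (N : ℤ) ∣ i + N - c₀ := by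
      rw [add_sub_right_comm]; exact dvd_add hi (dvd_refl _)
    refine hC.skip (j + N) i (i + N) (by omega) ((hP i).2 hi) ((hP _).2 hi') fun m hm hm' hPm => ?_
    have := dvd_sub ((hP m).1 hPm) hi
    rw [sub_sub_sub_cancel_right] at this
    have := Int.le_of_dvd (by omega) this
    omega
  have halt' : ∀ q : ℤ, (C (c₀ + N * q) (j + N)).s = true ↔
      ((C c₀ (j + N)).s = true ↔ (2 : ℤ) ∣ q) := by
    intro q
    have hstep : ∀ q : ℤ, (C (c₀ + N * (q + 1)) (j + N)).s = !(C (c₀ + N * q) (j + N)).s := by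
      intro q
      rw [← halt _ ⟨q, by ring⟩]
      ring_nf
    induction q using Int.induction_on with
    | zero => simp
    | succ q ih =>
      rw [hstep, Bool.not_eq_true', ← Bool.not_eq_true]
      have : (2 : ℤ) ∣ q + 1 ↔ ¬ (2 : ℤ) ∣ q := by omega
      tauto
    | pred q ih =>
      have h5 := hstep (-q - 1)
      rw [sub_add_cancel] at h5
      rw [h5, Bool.not_eq_true', ← Bool.not_eq_true] at ih
      have : (2 : ℤ) ∣ -q - 1 ↔ ¬ (2 : ℤ) ∣ -q := by omega
      tauto
  refine ⟨if (C c₀ (j + N)).s = true then c₀ else c₀ + N, ?_⟩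
  have hs : ∀ i, (C i (j + N)).s = true ↔
      ((2 * N : ℕ) : ℤ) ∣ i - if (C c₀ (j + N)).s = true then c₀ else c₀ + N := by
    intro i
    push_cast
    by_cases hi : (N : ℤ) ∣ i - c₀
    · obtain ⟨q, hq⟩ := hi
      obtain rfl : i = c₀ + N * q := by omega
      rw [halt' q]
      split_ifs with h6
      · rw [add_sub_cancel_left, mul_comm (2 : ℤ), Int.mul_dvd_mul_iff_left h0.ne']
        simp [h6]
      · rw [show c₀ + N * q - (c₀ + N) = N * (q - 1) by ring, mul_comm (2 : ℤ),
          Int.mul_dvd_mul_iff_left h0.ne']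
        rw [iff_false_left h6]
        omega
    · constructor
      · intro hsi
        exact absurd ((h3 i).1 ((hd i).2.1 hsi)) hi
      · rintro ⟨q, hq⟩
        exfalso
        split_ifs at hq with h6
        · exact hi ⟨2 * q, by rw [hq]; ring⟩
        · exact hi ⟨2 * q + 1, by linarith⟩
  refine ⟨fun i => by simp [(hst i).1], hs, fun i => ?_, fun i => ((hst i).2.reset (hlast i)).1,
    fun i => ((hst i).2.reset (hlast i)).2⟩
  rw [(hd i).1, hs]

theorem AStart.stages (hC : AValid X C) {N : ℕ} (hN : 0 < N) {c₀ j : ℤ}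
    (h : AStart C N c₀ c₀ j) (m : ℕ)
    (hm : m < N) : AStart C N c₀ (c₀ + m) (j + N * m) := by
  induction m with
  | zero => simpa using h
  | succ m ih =>
    have := (ih (by omega)).shift hC hN (by
      rw [show c₀ + m + 1 - c₀ = ((m + 1 : ℕ) : ℤ) by push_cast; ring]
      intro hd
      have := Int.le_of_dvd (by omega) hd
      omega)
    convert this using 1
    · push_cast; ring
    · push_cast; ring

theorem AValid.exists_start (hC : AValid X C) {i₀ j : ℤ} (h : (C i₀ j).ty = some false) (n : ℕ) :
    ∃ c j', AStart C (2 ^ n) c c j' := by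
  induction n with
  | zero =>
    have hty : ∀ i, (C i j).ty = some false := fun i =>
      (int_const (f := fun i => (C i j).ty) (fun i => (hC.H i j).ty) i i₀).trans h
    have hsp := fun i => (hC.H i j).special (hty i)
    refine ⟨0, j, fun i => by simp [hty i], fun i => ?_, fun i => ?_, fun i => ?_, fun i _ => ?_⟩
    · simp [(hsp i).1]
    · simp [(hsp i).2.1]
    · rw [(hsp i).1, (hsp i).2.2.1]
    · exact (hsp i).2.2.2
  | succ n ih =>
    obtain ⟨c, j', h'⟩ := ih
    have hN : 0 < 2 ^ n := by positivity
    obtain ⟨c₁, h1⟩ := (h'.stages hC hN (2 ^ n - 1) (by omega)).double hC hN ⟨1, by omega⟩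
    rw [pow_succ, mul_comm]
    exact ⟨c₁, _, h1⟩

/-- The columns through a special row carry arbitrarily large triangles everywhere. -/
theorem AValid.exists_tri (hC : AValid X C) {i₀ j : ℤ} (h : (C i₀ j).ty = some false)
    (p : ℤ) (N : ℕ) :
    ∃ T, X.Tri N T (fun n => (C (p + n) j).a) := by
  obtain ⟨c, j', h'⟩ := hC.exists_start h N
  have hN : 0 < 2 ^ N := by positivity
  have hNN : N < 2 ^ N := Nat.lt_two_pow_self
  generalize 2 ^ N = K at *
  have h0 : (0 : ℤ) < K := by exact_mod_cast hN
  have h1 := Int.emod_nonneg (p - c) h0.ne'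
  have h2 := Int.emod_lt_of_pos (p - c) h0
  have h3 := (h'.stages hC hN ((p - c) % K).toNat (by omega)).tri hC hN (p := p) (by
    rw [Int.toNat_of_nonneg h1, ← sub_sub]
    exact Int.dvd_self_sub_emod)
  refine ⟨_, fun n hn => h3.L n (by omega), fun m n hm hn => h3.H m n hm (by omega),
    fun m n hm hn => h3.V m n hm (by omega), fun n hn => h3.Dg n (by omega), fun n hn => ?_⟩
  exact (h3.inp n (by omega)).trans (hC.a_const _ _ _)

end HalfPlane

section HalfPlaneExists

variable {k : ℕ} (X : TriSys (Fin k))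

def deadA (a : Fin k) (d : X.S) : ACell X :=
  ⟨none, a, false, false, false, false, false, false, false, false, false, d⟩

theorem deadA_H (a b : Fin k) (d : X.S) : AH X (deadA X a d) (deadA X b d) := by
  constructor <;> simp [deadA]

theorem deadA_V (a : Fin k) (d : X.S) : AV X (deadA X a d) (deadA X a d) := by
  constructor <;> simp [deadA]

theorem exists_AValid_dead (a : Fin k) (d : X.S) :
    ∃ C, AValid X C ∧ ∀ i j, (C i j).ty = none :=
  ⟨fun _ _ => deadA X a d, ⟨fun _ _ => deadA_H X a a d, fun _ _ => deadA_V X a d,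
    fun _ _ _ _ h => by simp [deadA] at h⟩, fun _ _ => rfl⟩

/-- Epoch, stage and row inside the stage. -/
def epoch : ℕ → ℕ × ℕ × ℕ
  | 0 => (0, 0, 0)
  | t + 1 => if (epoch t).2.2 + 1 < 2 ^ (epoch t).1 then
      ((epoch t).1, (epoch t).2.1, (epoch t).2.2 + 1)
    else if (epoch t).2.1 + 1 < 2 ^ (epoch t).1 then ((epoch t).1, (epoch t).2.1 + 1, 0)
    else ((epoch t).1 + 1, 0, 0)

theorem epoch_lt (t : ℕ) :
    (epoch t).2.1 < 2 ^ (epoch t).1 ∧ (epoch t).2.2 < 2 ^ (epoch t).1 := by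
  induction t with
  | zero => simp [epoch]
  | succ t ih =>
    rw [epoch]
    split_ifs with h1 h2
    · exact ⟨ih.1, h1⟩
    · exact ⟨h2, by positivity⟩
    · simp

variable (w : ℤ → Fin k) (T : ℤ → ℕ → ℕ → X.S)

/-- The cell of the standard configuration in column `i`, for given epoch, stage and row. -/
def stdA (e : ℕ × ℕ × ℕ) (i : ℤ) : ACell X where
  ty := some (decide (e.1 ≠ 0))
  a := w i
  s := decide (((2 ^ e.1 : ℕ) : ℤ) ∣ i - e.2.1)
  o := decide (((2 ^ e.1 : ℕ) : ℤ) ∣ i)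
  ins := decide ((i - e.2.1) % ((2 ^ e.1 : ℕ) : ℤ) ≤ e.2.2)
  sl := decide (((2 ^ e.1 : ℕ) : ℤ) ∣ i - 1 - e.2.1)
  insl := decide ((i - 1 - e.2.1) % ((2 ^ e.1 : ℕ) : ℤ) ≤ e.2.2)
  po := decide (((2 ^ (e.1 - 1) : ℕ) : ℤ) ∣ i)
  last := decide (e.2.2 + 1 = 2 ^ e.1)
  epn := decide (e.2.1 + 1 = 2 ^ e.1)
  est := decide (e.1 ≠ 0 ∧ e.2.1 = 0 ∧ e.2.2 = 0)
  d := T (i - (i - e.2.1) % ((2 ^ e.1 : ℕ) : ℤ))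
    ((i - e.2.1) % ((2 ^ e.1 : ℕ) : ℤ)).toNat e.2.2

variable {X w T}

theorem stdA_diag (hT : ∀ p N, X.Tri N (T p) (fun n => w (p + n))) (e : ℕ × ℕ × ℕ) (i : ℤ)
    (h : (i - e.2.1) % ((2 ^ e.1 : ℕ) : ℤ) = e.2.2) :
    X.Dg (stdA X w T e i).d ∧ X.inp (stdA X w T e i).d = w i := by
  simp only [stdA, h, Int.toNat_natCast]
  have h1 := (hT (i - e.2.2) (e.2.2 + 1)).Dg e.2.2 (by omega)
  have h2 := (hT (i - e.2.2) (e.2.2 + 1)).inp e.2.2 (by omega)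
  rw [sub_add_cancel] at h2
  exact ⟨h1, h2⟩

theorem stdA_H (hT : ∀ p N, X.Tri N (T p) (fun n => w (p + n)))
    (e : ℕ × ℕ × ℕ) (h1 : e.2.1 < 2 ^ e.1) (h2 : e.2.2 < 2 ^ e.1) (i : ℤ) :
    AH X (stdA X w T e i) (stdA X w T e (i + 1)) := by
  have hN : 0 < 2 ^ e.1 := by positivity
  have hspec : e.1 = 0 → e.2.1 = 0 ∧ e.2.2 = 0 := by
    intro h
    rw [h] at h1 h2
    omega
  have hdiag := stdA_diag hT e i
  obtain ⟨n, c, m⟩ := e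
  simp only at h1 h2 hN hspec hdiag
  have hmod := emod_add_one hN (i - c)
  rw [show i - c + 1 = i + 1 - c by ring] at hmod
  have hz : (0 : ℤ) < ((2 ^ n : ℕ) : ℤ) := by exact_mod_cast hN
  have h3 := Int.emod_nonneg (i - c) hz.ne'
  have h4 := Int.emod_lt_of_pos (i - c) hz
  constructor
  · rfl
  · rfl
  · rfl
  · rfl
  · simp only [stdA]; congr 1; ring_nf
  · simp only [stdA]; congr 1; ring_nf
  · simp only [stdA, decide_eq_true_eq, decide_eq_decide]
    intro h
    have h5 : (i - c) % ((2 ^ n : ℕ) : ℤ) = ((2 ^ n : ℕ) : ℤ) - 1 := by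
      obtain ⟨q, hq⟩ := h
      rw [show i - c = (((2 ^ n : ℕ) : ℤ) - 1) + ((2 ^ n : ℕ) : ℤ) * (q - 1) by
        rw [mul_sub, ← hq]; ring, Int.add_mul_emod_self_left]
      exact Int.emod_eq_of_lt (by omega) (by omega)
    rw [h5]
    generalize 2 ^ n = N at *
    omega
  · simp only [stdA, decide_eq_true_eq, decide_eq_decide]
    intro _ h
    rw [show i - c = (i + 1) - ((c + 1 : ℕ) : ℤ) by push_cast; ring, dvd_sub_right h,
      Int.natCast_dvd_natCast]
    constructor
    · intro h5
      have := Nat.le_of_dvd (by omega) h5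
      omega
    · intro h5
      rw [h5]
  · simp only [stdA, decide_eq_true_eq, decide_eq_false_iff_not]
    intro h5 h6 h7
    rw [if_neg h7] at hmod
    rw [hmod] at h6 ⊢
    have h8 := (hT (i - (i - c) % ((2 ^ n : ℕ) : ℤ)) (m + 1)).H
      ((i - c) % ((2 ^ n : ℕ) : ℤ)).toNat m (by omega) (by omega)
    convert h8 using 2
    · ring
    · omega
  · simp only [stdA, decide_eq_true_eq]
    intro h5
    rw [Int.emod_eq_zero_of_dvd h5]
    exact (hT _ (m + 1)).L m (by omega)
  · intro h
    have hn : n = 0 := by simpa [stdA] using h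
    obtain ⟨rfl, rfl⟩ := hspec hn
    subst hn
    refine ⟨by simp [stdA], by simp [stdA], by simp [stdA], hdiag (by simp)⟩

theorem stdA_V (hT : ∀ p N, X.Tri N (T p) (fun n => w (p + n))) (t : ℕ) (i : ℤ) :
    AV X (stdA X w T (epoch t) i) (stdA X w T (epoch (t + 1)) i) := by
  obtain ⟨h1, h2⟩ := epoch_lt t
  have hn1 : (epoch (t + 1)).1 ≠ 0 := by
    rw [epoch]
    split_ifs with h3 h4
    · intro h
      simp only at h
      rw [h] at h3
      simp at h3
    · intro h
      simp only at h
      rw [h] at h4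
      simp at h4
    · simp
  refine ⟨rfl, fun h => by simp [stdA] at h, fun _ => ⟨by simp [stdA, hn1], ?_⟩⟩
  have hdiag := stdA_diag hT (epoch (t + 1)) i
  rw [epoch] at hdiag ⊢
  revert h1 h2 hdiag
  generalize epoch t = e
  obtain ⟨n, c, m⟩ := e
  intro h1 h2
  simp only at h1 h2 ⊢
  have hN : 0 < 2 ^ n := by positivity
  have hz : (0 : ℤ) < ((2 ^ n : ℕ) : ℤ) := by exact_mod_cast hN
  have hmod := emod_add_one hN (i - 1 - c)
  rw [show i - 1 - c + 1 = i - c by ring] at hmod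
  have h3 := Int.emod_nonneg (i - 1 - c) hz.ne'
  have h4 := Int.emod_lt_of_pos (i - 1 - c) hz
  have h3' := Int.emod_nonneg (i - c) hz.ne'
  have h4' := Int.emod_lt_of_pos (i - c) hz
  split_ifs with h5 h6
  · intro hdiag
    have hl : ¬ (m + 1 = 2 ^ n) := by omega
    constructor
    · intro _
      refine ⟨rfl, rfl, ?_, ?_, ?_⟩
      · simp only [stdA]
        rw [← Bool.decide_or, decide_eq_decide]
        split_ifs at hmod with hd
        · obtain ⟨q, hq⟩ := hd
          have h7 : (i - 1 - c) % ((2 ^ n : ℕ) : ℤ) = ((2 ^ n : ℕ) : ℤ) - 1 := by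
            rw [show i - 1 - c = (((2 ^ n : ℕ) : ℤ) - 1) + ((2 ^ n : ℕ) : ℤ) * (q - 1) by
              rw [mul_sub, ← hq]; ring, Int.add_mul_emod_self_left]
            exact Int.emod_eq_of_lt (by omega) (by omega)
          generalize 2 ^ n = N at *
          push_cast
          omega
        · generalize 2 ^ n = N at *
          push_cast
          omega
      · simp only [stdA, decide_eq_true_eq]
        intro h7
        exact (hT _ (m + 2)).V _ m (by omega) (by omega)
      · simp only [stdA, decide_eq_true_eq, decide_eq_false_iff_not] at hdiag ⊢
        intro h7 h8
        refine hdiag ?_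
        clear hdiag
        generalize 2 ^ n = N at *
        push_cast at h8 ⊢
        split_ifs at hmod with hd
        · rw [hmod] at h7
          omega
        · omega
    all_goals simp [stdA, hl]
  · intro hdiag
    have hc : ¬ (c + 1 = 2 ^ n) := by omega
    refine ⟨fun h => ?_, fun _ => ⟨?_, fun h => ?_⟩, fun _ _ => ⟨rfl, ?_⟩, fun _ h => ?_⟩
    · simp only [stdA, decide_eq_false_iff_not] at h
      omega
    · simp only [stdA, decide_eq_decide]
      rw [Int.dvd_iff_emod_eq_zero]
      have := Int.emod_nonneg (i - ((c + 1 : ℕ) : ℤ)) hz.ne'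
      push_cast at *
      omega
    · simp only [stdA, decide_eq_true_eq] at h hdiag ⊢
      exact hdiag (by rw [Int.emod_eq_zero_of_dvd h]; rfl)
    · simp only [stdA, decide_eq_decide]
      push_cast
      ring_nf
    · simp only [stdA, decide_eq_true_eq] at h
      omega
  · intro hdiag
    have hc : c + 1 = 2 ^ n := by omega
    have hz' : (0 : ℤ) < ((2 ^ (n + 1) : ℕ) : ℤ) := by positivity
    refine ⟨fun h => ?_, fun _ => ⟨?_, fun h => ?_⟩, fun _ h => ?_, fun _ _ => ⟨?_, ?_, ?_, ?_⟩⟩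
    · simp only [stdA, decide_eq_false_iff_not] at h
      omega
    · simp only [stdA, decide_eq_decide]
      rw [Int.dvd_iff_emod_eq_zero]
      have := Int.emod_nonneg (i - ((0 : ℕ) : ℤ)) hz'.ne'
      push_cast at *
      omega
    · simp only [stdA, decide_eq_true_eq] at h hdiag ⊢
      exact hdiag (by rw [Int.emod_eq_zero_of_dvd h]; rfl)
    · simp only [stdA, decide_eq_false_iff_not] at h
      omega
    · simp [stdA]
    · simp only [stdA, decide_eq_true_eq]
      intro h
      refine dvd_trans ?_ (by simpa using h)
      exact_mod_cast pow_dvd_pow 2 (Nat.le_succ n)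
    · simp [stdA]
    · simp [stdA]

/-- Every sequence all of whose suffixes carry triangles is realised along a special row. -/
theorem exists_AValid (hT : ∀ p N, X.Tri N (T p) (fun n => w (p + n)))
    : ∃ C, AValid X C ∧ (∀ i j, (C i j).a = w i) ∧
    ∀ i j, (C i j).ty = some false ↔ j = 0 := by
  have hep : ∀ t, (epoch t).1 = 0 ↔ t = 0 := by
    intro t
    rcases t with _ | t
    · simp [epoch]
    · have := ((stdA_V hT t 0).above (by simp [stdA])).1
      simpa [stdA] using this
  have hty : ∀ i (j : ℤ), 0 ≤ j → ((stdA X w T (epoch j.toNat) i).ty = some false ↔ j = 0) := by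
    intro i j hj
    have := hep j.toNat
    simp only [stdA, Option.some.injEq, decide_eq_false_iff_not, not_not, this]
    omega
  refine ⟨fun i j => if 0 ≤ j then stdA X w T (epoch j.toNat) i else deadA X (w i) (T 0 0 0),
    ⟨fun i j => ?_, fun i j => ?_, fun j i i' hii hP hP' hb => ?_⟩, fun i j => ?_, fun i j => ?_⟩
  · split_ifs
    · exact stdA_H hT _ (epoch_lt _).1 (epoch_lt _).2 i
    · exact deadA_H X _ _ _
  · rcases lt_trichotomy (j + 1) 0 with hj | hj | hj
    · simp only [show ¬ 0 ≤ j by omega, show ¬ 0 ≤ j + 1 by omega, if_false]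
      exact deadA_V X _ _
    · simp only [show ¬ 0 ≤ j by omega, if_false, hj, le_refl, if_true]
      refine ⟨rfl, fun _ => ?_, fun h => absurd rfl h⟩
      simp [stdA, epoch]
    · simp only [show 0 ≤ j by omega, show 0 ≤ j + 1 by omega, if_true]
      rw [show (j + 1).toNat = j.toNat + 1 by omega]
      exact stdA_V hT _ i
  · by_cases hj : 0 ≤ j
    · simp only [hj, if_true] at hP hP' hb ⊢
      generalize epoch j.toNat = e at *
      obtain ⟨n, c, m⟩ := e
      simp only [stdA, decide_eq_true_eq] at hP hP' hb ⊢
      obtain ⟨⟨hn, rfl, rfl⟩, h1⟩ := hP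
      obtain ⟨n, rfl⟩ := Nat.exists_eq_succ_of_ne_zero hn
      have h2 := consecutive_multiples (N := 2 ^ n) (c := 0) (by positivity) hii
        (by simpa using h1) (by simpa using hP'.2)
        (fun q hq hq' hd => hb q hq hq' ⟨⟨hn, rfl, rfl⟩, by simpa using hd⟩)
      obtain ⟨q, rfl⟩ := h1
      subst h2
      simp only [Nat.succ_eq_add_one, Nat.add_sub_cancel]
      have h3 : ∀ q : ℤ, ((2 ^ (n + 1) : ℕ) : ℤ) ∣ ((2 ^ n : ℕ) : ℤ) * q - ((0 : ℕ) : ℤ) ↔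
          (2 : ℤ) ∣ q := by
        intro q
        rw [pow_succ, Nat.cast_mul, Nat.cast_zero, sub_zero, Int.mul_dvd_mul_iff_left
          (by positivity)]
        rfl
      have h4 := h3 q
      have h5 := h3 (q + 1)
      rw [mul_add, mul_one] at h5
      rw [Bool.eq_iff_iff]
      simp only [decide_eq_true_eq, Bool.not_eq_true', decide_eq_false_iff_not, h4, h5]
      omega
    · simp [hj, deadA] at hP
  · dsimp only
    split_ifs <;> rfl
  · dsimp only
    split_ifs with hj
    · exact hty i j hj
    · simp only [deadA]
      constructor
      · intro h; cases h
      · intro h; omega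

end HalfPlaneExists

section Effective

variable {k : ℕ}

theorem computable_avoids {f : ℕ → Option (List (Fin k))} (hf : Computable f) :
    ∃ g : List (Fin k) → Bool, Computable g ∧ ∀ u, g u = true ↔
      ∀ n < u.length, ∀ w, f n = some w → u.take w.length ≠ w := by
  have hdeq : Computable₂ (fun u v : List (Fin k) => decide (u = v)) :=
    Primrec.eq.decide.to_comp
  have htake : Computable₂ (List.take : ℕ → List (Fin k) → List (Fin k)) :=
    Primrec.list_take.to_comp
  let chk : List (Fin k) → ℕ → Bool := fun u n =>
    Option.casesOn (f n) true fun w => !decide (u.take w.length = w)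
  have hchk : Computable₂ chk := by
    refine Computable.option_casesOn (hf.comp Computable.snd) (Computable.const true) ?_
    refine Primrec.not.to_comp.comp (hdeq.comp ?_ Computable.snd)
    exact htake.comp (Computable.list_length.comp Computable.snd)
      (Computable.fst.comp Computable.fst)
  let run : List (Fin k) → ℕ → Bool := fun u n =>
    Nat.rec true (fun m acc => acc && chk u m) n
  refine ⟨fun u => run u u.length, ?_, ?_⟩
  · refine Computable.nat_rec (f := fun u : List (Fin k) => u.length)
      (h := fun u (x : ℕ × Bool) => x.2 && chk u x.1) Computable.list_length
      (Computable.const true) ?_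
    refine Primrec.and.to_comp.comp (Computable.snd.comp Computable.snd) ?_
    exact hchk.comp Computable.fst (Computable.fst.comp Computable.snd)
  · intro u
    have key : ∀ n, run u n = true ↔ ∀ m < n, chk u m = true := by
      intro n
      induction n with
      | zero => simp [run]
      | succ n ih =>
        have : run u (n + 1) = (run u n && chk u n) := rfl
        rw [this, Bool.and_eq_true, ih]
        constructor
        · rintro ⟨h1, h2⟩ m hm
          rcases Nat.lt_succ_iff_lt_or_eq.1 hm with h | rfl
          exacts [h1 m h, h2]
        · exact fun h => ⟨fun m hm => h m (by omega), h n (by omega)⟩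
    rw [key]
    refine forall₂_congr fun n _ => ?_
    simp only [chk]
    cases f n <;> simp

theorem take_pre (b : ℕ → Fin k) (m : ℕ) (w : List (Fin k)) :
    (pre b m).take w.length = w ↔
      w.length ≤ m ∧ ∀ (n : ℕ) (h : n < w.length), b n = w.get ⟨n, h⟩ := by
  constructor
  · intro h
    have h1 : w.length ≤ m := by
      have := congrArg List.length h
      simp only [List.length_take, pre, List.length_map, List.length_range] at this
      omega
    refine ⟨h1, fun n hn => ?_⟩
    have h2 : ((pre b m).take w.length)[n]? = w[n]? := by rw [h]
    rw [List.getElem?_take_of_lt hn] at h2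
    simp only [pre, List.getElem?_map, List.getElem?_range (show n < m by omega),
      List.getElem?_eq_getElem hn, Option.map_some, Option.some.injEq] at h2
    exact h2
  · rintro ⟨h1, h2⟩
    apply List.ext_getElem
    · simp [pre, h1]
    · intro n hn hn'
      have h3 := h2 n hn'
      simp [pre, h3]

/-- An effective subshift is the set of sequences on special rows of a system of cells. -/
theorem exists_triSys_effective {H : Set (ℤ → Fin k)} (hH : IsEffective1 H) :
    ∃ X : TriSys (Fin k),
      (∀ C, AValid X C → ∀ i j, (C i j).ty = some false → (fun i => (C i j).a) ∈ H) ∧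
      ∀ w ∈ H, ∃ C, AValid X C ∧ (∀ i j, (C i j).a = w i) ∧
        ∀ i j, (C i j).ty = some false ↔ j = 0 := by
  obtain ⟨f, hf, rfl⟩ := hH
  obtain ⟨g, hg, hspec⟩ := computable_avoids hf
  obtain ⟨X, hX⟩ := exists_triSys g hg
  refine ⟨X, fun C hC i₀ j hs => ?_, fun w hw => ?_⟩
  · rintro n w hn ⟨p, hp⟩
    obtain ⟨N, hN⟩ := (hX fun n => (C (p + n) j).a).2 ⟨max w.length (n + 1), by
      rw [← Bool.not_eq_true, hspec]
      push Not
      refine ⟨n, ?_, w, hn, (take_pre _ _ _).2 ⟨le_max_left _ _, hp⟩⟩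
      simp [pre]⟩
    obtain ⟨T, hT⟩ := hC.exists_tri hs p N
    exact hN T hT
  · have hgood : ∀ p : ℤ, ∃ T, ∀ N, X.Tri N T (fun n => w (p + n)) := by
      intro p
      refine (hX _).1 fun m => ?_
      rw [hspec]
      intro n _ v hv htake
      exact hw n v hv ⟨p, ((take_pre _ m _).1 htake).2⟩
    choose T hT using hgood
    exact exists_AValid hT

end Effective

section RationalCodes

theorem computable_find {p : ℕ → ℕ → Bool} (hp : Computable₂ p) (h : ∀ x, ∃ n, p x n = true) :
    Computable fun x => Nat.find (h x) := by
  have h1 : Partrec fun x => Nat.rfind fun n => Part.some (p x n) := Partrec.rfind hp.partrec₂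
  refine h1.of_eq fun x => Part.eq_some_iff.2 (Nat.mem_rfind.2 ⟨?_, fun {m} hm => ?_⟩)
  · exact Part.mem_some_iff.2 (Nat.find_spec (h x)).symm
  · have := Nat.find_min (h x) hm
    rw [Bool.not_eq_true] at this
    exact Part.mem_some_iff.2 this.symm

theorem computable_subtype_ofNat (s : Set ℕ) [DecidablePred (· ∈ s)] [Infinite s] {b : ℕ → Bool}
    (hb : Computable b) (hbs : ∀ n, b n = true ↔ n ∈ s) :
    Computable fun n => (Nat.Subtype.ofNat s n : ℕ) := by
  have hex : ∀ x, ∃ n, b (x + n + 1) = true := by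
    intro x
    obtain ⟨y, hy, hxy⟩ := (Set.infinite_coe_iff.1 ‹Infinite s›).exists_gt x
    refine ⟨y - (x + 1), ?_⟩
    rw [hbs, show x + (y - (x + 1)) + 1 = y by omega]
    exact hy
  have hp : Computable₂ fun x n => b (x + n + 1) :=
    hb.comp (Computable.succ.comp (Primrec.nat_add.to_comp.comp Computable.fst Computable.snd))
  have hfind := computable_find hp hex
  have hrec : Computable fun n : ℕ =>
      Nat.rec (motive := fun _ => ℕ) ((⊥ : s) : ℕ) (fun _ x => x + Nat.find (hex x) + 1) n := by
    refine Computable.nat_rec (f := fun n : ℕ => n)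
      (h := fun _ (x : ℕ × ℕ) => x.2 + Nat.find (hex x.2) + 1) Computable.id
      (Computable.const _) ?_
    have hx : Computable fun y : ℕ × ℕ × ℕ => y.2.2 := Computable.snd.comp Computable.snd
    exact Computable.succ.comp (Primrec.nat_add.to_comp.comp hx (hfind.comp hx))
  refine hrec.of_eq fun n => ?_
  induction n with
  | zero => rfl
  | succ n ih =>
    change _ + Nat.find (hex _) + 1 = (Nat.Subtype.succ (Nat.Subtype.ofNat s n) : ℕ)
    have ih' : (Nat.rec (motive := fun _ => ℕ) ((⊥ : s) : ℕ)
      (fun _ x => x + Nat.find (hex x) + 1) n : ℕ) = (Nat.Subtype.ofNat s n : ℕ) := ih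
    rw [ih', Nat.Subtype.succ]
    have : Nat.find (hex (Nat.Subtype.ofNat s n)) =
        Nat.find (Nat.Subtype.exists_succ (Nat.Subtype.ofNat s n)) :=
      Nat.find_congr' (fun {m} => hbs _)
    rw [this]

theorem primrec_coprime : PrimrecRel Nat.Coprime := by
  have hdvd : PrimrecRel fun x a : ℕ => a % x = 0 :=
    Primrec.eq.comp (Primrec.nat_mod.comp Primrec.snd Primrec.fst) (Primrec.const 0)
  have hP : PrimrecRel fun (y : ℕ × ℕ) (x : ℕ) => y.1 % x = 0 ∧ y.2 % x = 0 :=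
    (hdvd.comp Primrec.snd (Primrec.fst.comp Primrec.fst)).and
      (hdvd.comp Primrec.snd (Primrec.snd.comp Primrec.fst))
  have hfg : Primrec fun y : ℕ × ℕ =>
      Nat.findGreatest (fun x => y.1 % x = 0 ∧ y.2 % x = 0) (y.1 + y.2) :=
    Primrec.nat_findGreatest (Primrec.nat_add.comp Primrec.fst Primrec.snd) hP
  have h1 : PrimrecPred fun y : ℕ × ℕ =>
      Nat.findGreatest (fun x => y.1 % x = 0 ∧ y.2 % x = 0) (y.1 + y.2) = 1 :=
    Primrec.eq.comp hfg (Primrec.const 1)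
  refine h1.of_eq fun ⟨a, d⟩ => ?_
  simp only [Nat.findGreatest_eq_iff]
  simp only [← Nat.dvd_iff_mod_eq_zero]
  constructor
  · rintro ⟨h2, -, h3⟩
    by_contra h4
    have h5 : a + d ≠ 0 := by omega
    have h6 : Nat.gcd a d ≠ 0 := fun h => h5 (by rw [Nat.gcd_eq_zero_iff] at h; omega)
    refine h3 (n := Nat.gcd a d) ?_ ?_ ⟨Nat.gcd_dvd_left a d, Nat.gcd_dvd_right a d⟩
    · have : Nat.gcd a d ≠ 1 := h4
      omega
    · exact Nat.le_of_dvd (by omega) (dvd_add (Nat.gcd_dvd_left a d) (Nat.gcd_dvd_right a d))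
  · intro h
    refine ⟨?_, fun _ => ⟨one_dvd _, one_dvd _⟩, fun n hn _ hdv => ?_⟩
    · by_contra h2
      obtain ⟨rfl, rfl⟩ : a = 0 ∧ d = 0 := by omega
      simp at h
    · have := Nat.dvd_gcd hdv.1 hdv.2
      rw [h, Nat.dvd_one] at this
      omega

theorem encode_int_natAbs (n : ℤ) : (Encodable.encode n + 1) / 2 = n.natAbs := by
  rcases n with m | m
  · have : Encodable.encode (Int.ofNat m) = 2 * m := rfl
    rw [this]
    change _ = m
    omega
  · have : Encodable.encode (Int.negSucc m) = 2 * m + 1 := rfl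
    rw [this]
    change _ = m + 1
    omega

theorem exists_encode_int (m : ℕ) : ∃ n : ℤ, Encodable.encode n = m := by
  rcases Nat.even_or_odd' m with ⟨r, rfl | rfl⟩
  · exact ⟨Int.ofNat r, rfl⟩
  · exact ⟨Int.negSucc r, rfl⟩

theorem encode_rat (q : ℚ) :
    @Encodable.encode ℚ Rat.instEncodable q = Nat.pair (Encodable.encode q.num) q.den := rfl

theorem mem_range_encode_rat (m : ℕ) :
    m ∈ Set.range (@Encodable.encode ℚ Rat.instEncodable) ↔
      m.unpair.2 ≠ 0 ∧ Nat.Coprime ((m.unpair.1 + 1) / 2) m.unpair.2 := by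
  constructor
  · rintro ⟨q, rfl⟩
    rw [encode_rat, Nat.unpair_pair]
    refine ⟨q.den_nz, ?_⟩
    simp only [encode_int_natAbs]
    exact q.reduced
  · rintro ⟨h1, h2⟩
    obtain ⟨n, hn⟩ := exists_encode_int m.unpair.1
    rw [← hn, encode_int_natAbs] at h2
    refine ⟨⟨n, m.unpair.2, h1, h2⟩, ?_⟩
    rw [encode_rat, hn, Nat.pair_unpair]

theorem computable_rat_code {f : ℕ → ℚ} (hf : Computable f) :
    Computable fun n => Nat.pair (Encodable.encode (f n).num) (f n).den := by
  have hdec : PrimrecPred fun m : ℕ =>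
      m.unpair.2 ≠ 0 ∧ Nat.Coprime ((m.unpair.1 + 1) / 2) m.unpair.2 := by
    have hu1 : Primrec fun m : ℕ => m.unpair.1 := Primrec.fst.comp Primrec.unpair
    have hu2 : Primrec fun m : ℕ => m.unpair.2 := Primrec.snd.comp Primrec.unpair
    refine ((Primrec.eq.comp hu2 (Primrec.const 0)).not).and (primrec_coprime.comp ?_ hu2)
    exact Primrec.nat_div.comp (Primrec.succ.comp hu1) (Primrec.const 2)
  obtain ⟨_, hdec⟩ := hdec
  let s := Set.range (@Encodable.encode ℚ Rat.instEncodable)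
  let hd : DecidablePred (· ∈ s) := @Encodable.decidableRangeEncode ℚ Rat.instEncodable
  have hinf : Infinite s := Infinite.of_injective _
    (Equiv.ofInjective _ (@Encodable.encode_injective ℚ Rat.instEncodable)).injective
  have hc := computable_subtype_ofNat s hdec.to_comp (fun n => by
    rw [mem_range_encode_rat, decide_eq_true_iff])
  have h2 : ∀ n : ℕ, @Encodable.encode ℚ Rat.instEncodable (Denumerable.ofNat ℚ n) =
      (Nat.Subtype.ofNat s n : ℕ) := by
    intro n
    have h3 : Denumerable.ofNat ℚ n =
      (@Encodable.equivRangeEncode ℚ Rat.instEncodable).symm (Nat.Subtype.ofNat s n) := rfl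
    rw [h3]
    exact congrArg Subtype.val
      ((@Encodable.equivRangeEncode ℚ Rat.instEncodable).apply_symm_apply (Nat.Subtype.ofNat s n))
  refine (hc.comp (Computable.encode.comp hf)).of_eq fun n => ?_
  rw [← h2, Denumerable.ofNat_encode, encode_rat]

theorem computable_rat_den {f : ℕ → ℚ} (hf : Computable f) : Computable fun n => (f n).den :=
  (Computable.snd.comp (Computable.unpair.comp (computable_rat_code hf))).of_eq fun n => by simp

theorem computable_rat_num {f : ℕ → ℚ} (hf : Computable f) :
    Computable fun n => (f n).num.natAbs := by
  have h1 : Computable fun n => (Nat.unpair (Nat.pair (Encodable.encode (f n).num) (f n).den)).1 :=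
    Computable.fst.comp (Computable.unpair.comp (computable_rat_code hf))
  refine (Primrec.nat_div.to_comp.comp (Computable.succ.comp h1) (Computable.const 2)).of_eq
    fun n => ?_
  rw [Nat.unpair_pair]
  exact encode_int_natAbs _

end RationalCodes

section Density

def binVal (u : List (Fin 2)) : ℕ := u.foldl (fun N a => 2 * N + a.val) 0

theorem primrec_binVal : Primrec binVal := by
  refine Primrec.list_foldl (f := fun u : List (Fin 2) => u) (g := fun _ => 0)
    (h := fun _ (x : ℕ × Fin 2) => 2 * x.1 + x.2.val) Primrec.id (Primrec.const 0) ?_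
  refine Primrec.nat_add.comp (Primrec.nat_mul.comp (Primrec.const 2)
    (Primrec.fst.comp Primrec.snd)) (Primrec.fin_val.comp (Primrec.snd.comp Primrec.snd))

theorem binVal_pre (b : ℕ → Fin 2) (m : ℕ) :
    (binVal (pre b m) : ℝ) = 2 ^ m * ∑ n ∈ Finset.range m, ((b n : ℕ) : ℝ) / 2 ^ (n + 1) := by
  induction m with
  | zero => simp [binVal, pre]
  | succ m ih =>
    have h1 : binVal (pre b (m + 1)) = 2 * binVal (pre b m) + (b m : ℕ) := by
      simp [binVal, pre, List.range_succ]
    rw [h1, Finset.sum_range_succ]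
    push_cast
    rw [ih]
    field_simp
    ring

/-- Binary sequences encoding reals below a given right-recursively enumerable bound are
verified by triangles. -/
theorem exists_triSys_density {h : ℝ} (hh : Pi1Computable h) (h0 : 0 ≤ h) (l s : ℕ) (hs : 0 < s) :
    ∃ X : TriSys (Fin 2), ∀ b : ℕ → Fin 2,
      ((∀ m, ∑ n ∈ Finset.range m, ((b n : ℕ) : ℝ) / 2 ^ (n + 1) ≤ h * l / s) →
        ∃ T, ∀ N, X.Tri N T b) ∧
      ((∀ N, ∃ T, X.Tri N T b) →
        ∀ m, ∑ n ∈ Finset.range m, ((b n : ℕ) : ℝ) / 2 ^ (n + 1) ≤ h * l / s) := by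
  obtain ⟨f, hf, hanti, htend⟩ := hh
  have hge : ∀ m, h ≤ f m := fun m =>
    Antitone.le_of_tendsto (f := fun n => (f n : ℝ))
      (fun a b hab => Rat.cast_le.2 (hanti hab)) htend m
  have hnum : ∀ m, (((f m).num.natAbs : ℝ)) / (f m).den = f m := by
    intro m
    have h1 : 0 ≤ (f m).num := by
      rw [Rat.num_nonneg]
      have := h0.trans (hge m)
      exact_mod_cast this
    rw [Nat.cast_natAbs, abs_of_nonneg h1]
    exact (Rat.cast_def (f m)).symm
  have hg : Computable fun u : List (Fin 2) => decide (binVal u * (f u.length).den * s ≤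
      (f u.length).num.natAbs * l * 2 ^ u.length) := by
    have hle : Computable₂ fun a b : ℕ => decide (a ≤ b) := Primrec.nat_le.decide.to_comp
    have hmul : Computable₂ fun a b : ℕ => a * b := Primrec.nat_mul.to_comp
    have hlen : Computable fun u : List (Fin 2) => u.length := Computable.list_length
    have hpow : Computable fun m : ℕ => 2 ^ m := by
      refine (Primrec.nat_rec₁ 1 (f := fun _ x => 2 * x)
        (Primrec.nat_mul.comp (Primrec.const 2) Primrec.snd)).to_comp.of_eq fun m => ?_
      induction m with
      | zero => rfl
      | succ m ih =>
        rw [pow_succ, mul_comm, ← ih]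
    refine hle.comp (hmul.comp (hmul.comp primrec_binVal.to_comp
      ((computable_rat_den hf).comp hlen)) (Computable.const s)) ?_
    exact hmul.comp (hmul.comp ((computable_rat_num hf).comp hlen) (Computable.const l))
      (hpow.comp hlen)
  obtain ⟨X, hX⟩ := exists_triSys _ hg
  have key : ∀ (b : ℕ → Fin 2) (m : ℕ), decide (binVal (pre b m) * (f (pre b m).length).den * s ≤
      (f (pre b m).length).num.natAbs * l * 2 ^ (pre b m).length) = true ↔
      ∑ n ∈ Finset.range m, ((b n : ℕ) : ℝ) / 2 ^ (n + 1) ≤ f m * l / s := by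
    intro b m
    have hlen : (pre b m).length = m := by simp [pre]
    rw [decide_eq_true_iff, hlen, ← Nat.cast_le (α := ℝ)]
    push_cast
    rw [binVal_pre, ← hnum m]
    have hd : (0 : ℝ) < (f m).den := by exact_mod_cast (f m).den_pos
    have hs' : (0 : ℝ) < s := by exact_mod_cast hs
    have hp : (0 : ℝ) < 2 ^ m := by positivity
    rw [le_div_iff₀ hs', div_mul_eq_mul_div, le_div_iff₀ hd]
    generalize ∑ n ∈ Finset.range m, ((b n : ℕ) : ℝ) / 2 ^ (n + 1) = S
    generalize ((f m).num.natAbs : ℝ) = M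
    rw [show (2 : ℝ) ^ m * S * (f m).den * s = 2 ^ m * (S * s * (f m).den) by ring,
      mul_comm (M * l)]
    exact mul_le_mul_iff_right₀ hp
  refine ⟨X, fun b => ⟨fun hb => (hX b).1 fun m => ?_, fun hb m => ?_⟩⟩
  · refine (key b m).2 ((hb m).trans ?_)
    have := hge m
    gcongr
  · have hall : ∀ m, ∑ n ∈ Finset.range m, ((b n : ℕ) : ℝ) / 2 ^ (n + 1) ≤ f m * l / s := by
      intro m
      rw [← key]
      by_contra hc
      rw [Bool.not_eq_true] at hc
      obtain ⟨N, hN⟩ := (hX b).2 ⟨m, hc⟩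
      obtain ⟨T, hT⟩ := hb N
      exact hN T hT
    have ht : Tendsto (fun m => (f m : ℝ) * l / s) atTop (nhds (h * l / s)) :=
      (htend.mul_const _).div_const _
    refine ge_of_tendsto ht (Filter.eventually_atTop.2 ⟨m, fun m' hm' => ?_⟩)
    refine le_trans (Finset.sum_le_sum_of_subset_of_nonneg
      (Finset.range_subset_range.2 hm') fun _ _ _ => by positivity) (hall m')

end Density

section Control

/-- Data attached to a row or a column. -/
structure BLine (X : TriSys (Fin 2)) where
  z : Bool
  g : Bool
  first : Bool
  last : Bool
  e : Fin 2
  d : X.S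

/-- Cells of the hierarchical system: `u` belongs to the column, `v` to the row, `σ` and `far`
compare the level of the column with that of the row. -/
structure BCell (X : TriSys (Fin 2)) where
  u : BLine X
  v : BLine X
  σ : SignType
  far : Bool
  δ : SignType

variable {X : TriSys (Fin 2)}

instance : Finite (BLine X) := by
  have := X.fin
  refine Finite.of_injective (fun c : BLine X => (c.z, c.g, c.first, c.last, c.e, c.d)) ?_
  rintro ⟨⟩ ⟨⟩ h
  simpa using h

instance : Finite (BCell X) := by
  refine Finite.of_injective (fun c : BCell X => (c.u, c.v, c.σ, c.far, c.δ)) ?_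
  rintro ⟨⟩ ⟨⟩ h
  simpa using h

def BCell.swap (x : BCell X) : BCell X := ⟨x.v, x.u, -x.σ, x.far, x.δ⟩

theorem BCell.swap_swap (x : BCell X) : x.swap.swap = x := by
  simp [BCell.swap]

def flipB (c : ℤ → ℤ → BCell X) : ℤ → ℤ → BCell X := fun i j => (c j i).swap

theorem flipB_flipB (c : ℤ → ℤ → BCell X) : flipB (flipB c) = c := by
  funext i j
  exact (c i j).swap_swap

def BCell.cls (x : BCell X) : ZMod 4 :=
  if x.σ = 0 then (if x.u.g then 2 else 0) else (if x.far then 3 else 1)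

structure BLoc (x : BCell X) : Prop where
  L : x.v.first = true → X.L x.v.d
  Dg : x.v.last = true → X.Dg x.v.d ∧ X.inp x.v.d = x.v.e
  e : x.σ = 0 → x.u.e = x.v.e
  last : x.σ = 1 → x.far = false → x.u.last = true → x.δ = -1
  bot : x.σ = 1 → x.far = false → x.v.first = true → x.δ ≠ 1
  top : x.σ = 1 → x.far = false → x.v.last = true → x.δ = -1 → x.u.last = true
  first : x.σ = 1 → x.far = false → x.u.first = true →
    (x.v.first = true → x.δ = 0) ∧ (x.v.first = false → x.δ = 1)
  V : x.σ = 1 → x.far = false → x.δ = 0 → X.V x.v.d x.u.d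

structure BH (x y : BCell X) : Prop where
  first : y.u.first = true ↔ x.u.last = true
  up : y.u.first = false → x.δ = 1 → y.δ ≠ -1
  down : y.u.first = false → x.δ ≠ 1 → y.δ = -1
  H : y.u.first = false → X.H x.u.d y.u.d

structure BV (x y : BCell X) : Prop where
  down : y.v.first = false → x.δ = -1 → y.δ ≠ 1
  up : y.v.first = false → x.δ ≠ -1 → y.δ = 1

structure BHalf (c : ℤ → ℤ → BCell X) : Prop where
  v : ∀ i j, (c (i + 1) j).v = (c i j).v
  loc : ∀ i j, BLoc (c i j)
  order : ∀ j, Skip (fun x : BCell X => x.σ ≠ -1) (fun x y => y.cls = x.cls + 1) (fun i => c i j)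
  near : ∀ j, Skip (fun x : BCell X => ¬ (x.σ = -1 ∧ x.far = true))
    (fun x y => ¬ (x.σ = -1 ∧ y.σ = -1)) (fun i => c i j)
  fH : ∀ j, Skip (fun x : BCell X => x.σ = 1 ∧ x.far = false) BH (fun i => c i j)
  fV : ∀ i, Skip (fun x : BCell X => x.σ = 1 ∧ x.far = false) BV (c i)

structure BRow (c : ℤ → ℤ → BCell X) : Prop extends BHalf c where
  z : ∀ i j, (c (i + 1) j).u.z = !(c i j).u.z
  single : ∀ i j, (c i j).v.z = true → (c i j).v.first = true ∧ (c i j).v.last = true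
  zz : ∀ i j, (c i j).u.z = true → (c i j).v.z = true → (c i j).σ = 0
  zn : ∀ i j, (c i j).u.z = true → (c i j).v.z = false → (c i j).σ = -1

def BValid (c : ℤ → ℤ → BCell X) : Prop := BRow c ∧ BRow (flipB c)

theorem sofic_BRow : Sofic {c : ℤ → ℤ → BCell X | BRow c} := by
  have := (((((sofic_adj (fun x y : BCell X => y.v = x.v ∧ BLoc x ∧ (y.u.z = !x.u.z) ∧
      (x.v.z = true → x.v.first = true ∧ x.v.last = true) ∧
      (x.u.z = true → x.v.z = true → x.σ = 0) ∧ (x.u.z = true → x.v.z = false → x.σ = -1))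
      (fun _ _ => True)).inter
    (sofic_hskip (fun x : BCell X => x.σ ≠ -1) (fun x y => y.cls = x.cls + 1))).inter
    (sofic_hskip (fun x : BCell X => ¬ (x.σ = -1 ∧ x.far = true))
      (fun x y => ¬ (x.σ = -1 ∧ y.σ = -1)))).inter
    (sofic_hskip (fun x : BCell X => x.σ = 1 ∧ x.far = false) BH)).inter
    (sofic_vskip (fun x : BCell X => x.σ = 1 ∧ x.far = false) BV))
  convert this using 1
  ext c
  constructor
  · intro h
    exact ⟨⟨⟨⟨fun i j => ⟨⟨h.v i j, h.loc i j, h.z i j, h.single i j, h.zz i j, h.zn i j⟩,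
      trivial⟩, h.order⟩, h.near⟩, h.fH⟩, h.fV⟩
  · rintro ⟨⟨⟨⟨h1, h2⟩, h3⟩, h4⟩, h5⟩
    exact ⟨⟨fun i j => (h1 i j).1.1, fun i j => (h1 i j).1.2.1, h2, h3, h4, h5⟩,
      fun i j => (h1 i j).1.2.2.1, fun i j => (h1 i j).1.2.2.2.1,
      fun i j => (h1 i j).1.2.2.2.2.1, fun i j => (h1 i j).1.2.2.2.2.2⟩

theorem sofic_BValid : Sofic {c : ℤ → ℤ → BCell X | BValid c} := by
  have h : Sofic {c : ℤ → ℤ → BCell X | BRow (flipB c)} :=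
    (sofic_BRow.preimage BCell.swap).transpose
  exact sofic_BRow.inter h

/-- Odd rows and columns have the lowest level. -/
structure BGoodHalf (c : ℤ → ℤ → BCell X) : Prop extends BHalf c where
  oo : ∀ i j, (c (2 * i + 1) (2 * j + 1)).σ = 0
  oe : ∀ i j, (c (2 * i + 1) (2 * j)).σ = -1

def BGood (c : ℤ → ℤ → BCell X) : Prop := BGoodHalf c ∧ BGoodHalf (flipB c)

theorem BGood.flip {c : ℤ → ℤ → BCell X} (h : BGood c) : BGood (flipB c) :=
  ⟨h.2, by rw [flipB_flipB]; exact h.1⟩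

theorem Skip.shift {C : Type} {P : C → Prop} {E : C → C → Prop} {r : ℤ → C} (h : Skip P E r)
    (a : ℤ) : Skip P E (fun i => r (i + a)) := by
  intro i i' hi h1 h2 h3
  refine h (i + a) (i' + a) (by omega) h1 h2 fun m hm hm' => ?_
  have := h3 (m - a) (by omega) (by omega)
  dsimp only at this
  rwa [sub_add_cancel] at this

theorem Skip.even {C : Type} {P : C → Prop} {E : C → C → Prop} {r : ℤ → C} (h : Skip P E r)
    (s : ℤ) (ho : ∀ i, ¬ P (r (2 * i + 1))) : Skip P E (fun i => r (2 * (i + s))) := by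
  intro i i' hi h1 h2 h3
  refine h (2 * (i + s)) (2 * (i' + s)) (by omega) h1 h2 fun m hm hm' => ?_
  rcases Int.even_or_odd' m with ⟨l, rfl | rfl⟩
  · have := h3 (l - s) (by omega) (by omega)
    dsimp only at this
    rwa [sub_add_cancel] at this
  · exact ho l

theorem BHalf.v_const {c : ℤ → ℤ → BCell X} (h : BHalf c) (i i' j : ℤ) :
    (c i j).v = (c i' j).v :=
  int_const (f := fun i => (c i j).v) (fun i => h.v i j) i i'

theorem BHalf.shift {c : ℤ → ℤ → BCell X} (h : BHalf c) (a b : ℤ) :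
    BHalf (fun i j => c (i + a) (j + b)) where
  v i j := by
    rw [add_right_comm]
    exact h.v _ _
  loc i j := h.loc _ _
  order j := (h.order _).shift a
  near j := (h.near _).shift a
  fH j := (h.fH _).shift a
  fV i := (h.fV _).shift b

theorem exists_parity {f : ℤ → Bool} (h : ∀ i, f (i + 1) = !f i) :
    ∃ a, ∀ i, f (2 * i + 1 + a) = true ∧ f (2 * i + a) = false := by
  have h2 : ∀ i, f (2 * i) = f 0 := fun i => by
    refine int_const (f := fun i => f (2 * i)) (fun i => ?_) i 0
    rw [mul_add, mul_one, ← one_add_one_eq_two, ← add_assoc, h, h, Bool.not_not]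
  cases h0 : f 0 with
  | false => exact ⟨0, fun i => by simp [h, h2, h0]⟩
  | true =>
    refine ⟨1, fun i => ⟨?_, by simp [h, h2, h0]⟩⟩
    rw [add_assoc, one_add_one_eq_two, ← mul_add_one, h2, h0]

theorem BValid.exists_good {c : ℤ → ℤ → BCell X} (h : BValid c) :
    ∃ a b, BGood (fun i j => c (i + a) (j + b)) ∧
      ∀ i j, (c i (2 * j + 1 + b)).v.first = true ∧ (c i (2 * j + 1 + b)).v.last = true := by
  have hu : ∀ i j j', (c i j).u = (c i j').u := fun i j j' => h.2.v_const j j' i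
  obtain ⟨a, ha⟩ := exists_parity (f := fun i => (c i 0).u.z) fun i => h.1.z i 0
  obtain ⟨b, hb⟩ := exists_parity (f := fun j => (c 0 j).v.z) fun j => h.2.z j 0
  have ha' : ∀ i j, (c (2 * i + 1 + a) j).u.z = true ∧ (c (2 * i + a) j).u.z = false := by
    intro i j
    rw [hu _ j 0, hu _ j 0]
    exact ha i
  have hb' : ∀ i j, (c i (2 * j + 1 + b)).v.z = true ∧ (c i (2 * j + b)).v.z = false := by
    intro i j
    rw [h.1.v_const i 0, h.1.v_const i 0]
    exact hb j
  refine ⟨a, b, ⟨⟨h.1.toBHalf.shift a b, fun i j => h.1.zz _ _ (ha' i _).1 (hb' _ j).1,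
    fun i j => h.1.zn _ _ (ha' i _).1 (hb' _ j).2⟩, ⟨h.2.toBHalf.shift b a,
    fun i j => h.2.zz _ _ (hb' _ i).1 (ha' j _).1, fun i j => h.2.zn _ _ (hb' _ i).1 (ha' j _).2⟩⟩,
    fun i j => h.1.single _ _ (hb' i j).1⟩

theorem BGood.odd_eq {c : ℤ → ℤ → BCell X} (h : BGood c) (i j : ℤ) :
    (c (2 * i) (2 * j + 1)).σ = 1 := by
  have := h.2.oe j i
  simpa [flipB, BCell.swap, neg_eq_iff_eq_neg] using this

/-- Every other even column is of the second level. -/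
theorem BGood.exists_far {c : ℤ → ℤ → BCell X} (h : BGood c) :
    ∃ s, ∀ i j, ((c (2 * (2 * i + 1 + s)) (2 * j + 1)).far = false) ∧
      (c (2 * (2 * i + s)) (2 * j + 1)).far = true := by
  have hu : ∀ i j j', (c i j).u = (c i j').u := fun i j j' => h.2.v_const j j' i
  have hodd : ∀ i j, (c (2 * i + 1) (2 * j + 1)).cls = if (c (2 * i + 1) 1).u.g then 2 else 0 := by
    intro i j
    rw [BCell.cls, h.1.oo, hu _ _ 1, if_pos rfl]
  have heven : ∀ i j, (c (2 * i) (2 * j + 1)).cls =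
      if (c (2 * i) (2 * j + 1)).far then 3 else 1 := by
    intro i j
    rw [BCell.cls, h.odd_eq, if_neg (by decide)]
  have hP : ∀ i j, (c i (2 * j + 1)).σ ≠ -1 := by
    intro i j
    rcases Int.even_or_odd' i with ⟨l, rfl | rfl⟩
    · rw [h.odd_eq]; decide
    · rw [h.1.oo]; decide
  have hstep : ∀ i j, (c (i + 1) (2 * j + 1)).cls = (c i (2 * j + 1)).cls + 1 := fun i j =>
    h.1.order (2 * j + 1) i (i + 1) (by omega) (hP _ _) (hP _ _) fun m _ _ => by omega
  have hcls : ∀ i j, (c i (2 * j + 1)).cls = (c 1 1).cls + ((i - 1 : ℤ) : ZMod 4) := by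
    intro i j
    have h1 := int_const (f := fun i => (c i (2 * j + 1)).cls - ((i - 1 : ℤ) : ZMod 4))
      (fun i => by rw [hstep]; push_cast; ring) i 1
    have h2 : (c 1 (2 * j + 1)).cls = (c 1 1).cls := by
      have h3 := hodd 0 j
      have h4 := hodd 0 0
      simp only [mul_zero, zero_add] at h3 h4
      rw [h3, h4]
    rw [← h2]
    simp only [sub_self, Int.cast_zero, sub_zero] at h1
    rw [← h1]
    ring
  have h4 : (4 : ZMod 4) = 0 := rfl
  have h0 : (c 1 1).cls = 2 ∨ (c 1 1).cls = 0 := by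
    have := hodd 0 0
    simp only [mul_zero, zero_add] at this
    rw [this]
    split_ifs <;> simp
  have hfar : ∀ i j, (c (2 * i) (2 * j + 1)).far = true ↔ (c (2 * i) (2 * j + 1)).cls = 3 := by
    intro i j
    rw [heven]
    split_ifs with hf <;> simp [hf]
    decide
  have hfar' : ∀ i j, (c (2 * i) (2 * j + 1)).far = false ↔ (c (2 * i) (2 * j + 1)).cls = 1 := by
    intro i j
    rw [heven]
    split_ifs with hf <;> simp [hf]
    decide
  have e1 : ∀ i s : ℤ, (((2 * (2 * i + 1 + s) - 1 : ℤ)) : ZMod 4) = 1 + 2 * s := by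
    intro i s
    push_cast
    linear_combination (i : ZMod 4) * h4
  have e2 : ∀ i s : ℤ, (((2 * (2 * i + s) - 1 : ℤ)) : ZMod 4) = 2 * s - 1 := by
    intro i s
    push_cast
    linear_combination (i : ZMod 4) * h4
  rcases h0 with h0 | h0
  · refine ⟨1, fun i j => ⟨?_, ?_⟩⟩
    · rw [hfar', hcls, h0, e1]
      decide
    · rw [hfar, hcls, h0, e2]
      decide
  · refine ⟨0, fun i j => ⟨?_, ?_⟩⟩
    · rw [hfar', hcls, h0, e1]
      decide
    · rw [hfar, hcls, h0, e2]
      decide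

end Control

section Control

variable {X : TriSys (Fin 2)}

def FarSpec (c : ℤ → ℤ → BCell X) (s : ℤ) : Prop :=
  ∀ i j, ((c (2 * (2 * i + 1 + s)) (2 * j + 1)).far = false) ∧
    (c (2 * (2 * i + s)) (2 * j + 1)).far = true

def coarsen (c : ℤ → ℤ → BCell X) (s t : ℤ) : ℤ → ℤ → BCell X :=
  fun i j => c (2 * (i + s)) (2 * (j + t))

/-- On a row of the second level, no even column has a smaller level. -/
theorem BGood.second_ne {c : ℤ → ℤ → BCell X} (h : BGood c) {t : ℤ} (ht : FarSpec (flipB c) t)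
    (i j : ℤ) : (c (2 * i) (2 * (2 * j + 1 + t))).σ ≠ -1 := by
  intro h1
  have hP : ∀ i, ¬ ((c (2 * i + 1) (2 * (2 * j + 1 + t))).σ = -1 ∧
      (c (2 * i + 1) (2 * (2 * j + 1 + t))).far = true) := by
    intro i hi
    have := (ht j i).1
    have h2 := hi.2
    simp only [flipB, BCell.swap] at this
    rw [this] at h2
    exact Bool.false_ne_true h2
  have e1 : 2 * i - 1 = 2 * (i - 1) + 1 := by ring
  by_cases hfar : (c (2 * i) (2 * (2 * j + 1 + t))).far = true
  · refine h.1.near _ (2 * i - 1) (2 * i + 1) (by omega) ?_ (hP i) ?_ ⟨?_, h.1.oe _ _⟩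
    · dsimp only
      rw [e1]
      exact hP _
    · intro m hm hm'
      obtain rfl : m = 2 * i := by omega
      exact not_not.2 ⟨h1, hfar⟩
    · dsimp only
      rw [e1]
      exact h.1.oe _ _
  · refine h.1.near _ (2 * i) (2 * i + 1) (by omega) (fun h2 => hfar h2.2) (hP i)
      (fun m _ _ => by omega) ⟨h1, h.1.oe _ _⟩

theorem BGood.second_ne' {c : ℤ → ℤ → BCell X} (h : BGood c) {s : ℤ} (hs : FarSpec c s)
    (i j : ℤ) : (c (2 * (2 * i + 1 + s)) (2 * j)).σ ≠ 1 := by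
  have := h.flip.second_ne (t := s) (by rwa [flipB_flipB]) j i
  simpa [flipB, BCell.swap, neg_eq_iff_eq_neg] using this

theorem BGood.second_eq {c : ℤ → ℤ → BCell X} (h : BGood c) {s t : ℤ} (hs : FarSpec c s)
    (ht : FarSpec (flipB c) t) (i j : ℤ) :
    (c (2 * (2 * i + 1 + s)) (2 * (2 * j + 1 + t))).σ = 0 := by
  have h1 := h.second_ne ht (2 * i + 1 + s) j
  have h2 := h.second_ne' hs i (2 * j + 1 + t)
  revert h1 h2
  generalize (c (2 * (2 * i + 1 + s)) (2 * (2 * j + 1 + t))).σ = x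
  revert x
  decide

theorem BGood.far_gt {c : ℤ → ℤ → BCell X} (h : BGood c) {s t : ℤ} (hs : FarSpec c s)
    (ht : FarSpec (flipB c) t) (i j : ℤ) :
    (c (2 * (2 * i + s)) (2 * (2 * j + 1 + t))).σ = 1 := by
  have h1 := h.1.order (2 * (2 * j + 1 + t)) (2 * (2 * i + s)) (2 * (2 * i + 1 + s)) (by omega)
    (h.second_ne ht _ _) (h.second_ne ht _ _) (fun m hm hm' => by
      obtain rfl : m = 2 * (2 * i + s) + 1 := by omega
      rw [not_not]
      exact h.1.oe _ _)
  dsimp only at h1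
  have h2 := h.second_eq hs ht i j
  have h3 := h.second_ne ht (2 * i + s) j
  rw [BCell.cls, h2, if_pos rfl] at h1
  have h0 : (c (2 * (2 * i + s)) (2 * (2 * j + 1 + t))).σ ≠ 0 := by
    intro h0
    rw [BCell.cls, h0, if_pos rfl] at h1
    revert h1
    split_ifs <;> decide
  revert h0 h3
  generalize (c (2 * (2 * i + s)) (2 * (2 * j + 1 + t))).σ = x
  revert x
  decide

theorem BGood.coarse_half {c : ℤ → ℤ → BCell X} (h : BGood c) {s t : ℤ} (hs : FarSpec c s)
    (ht : FarSpec (flipB c) t) : BGoodHalf (coarsen c s t) where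
  v i j := h.1.v_const _ _ _
  loc i j := h.1.loc _ _
  order j := (h.1.order _).even s fun i => by
    rw [not_not]
    exact h.1.oe _ _
  near j := by
    rcases Int.even_or_odd' j with ⟨l, rfl | rfl⟩
    · refine (h.1.near _).even s fun i => ?_
      rw [not_not]
      have := (ht l i).2
      exact ⟨h.1.oe _ _, this⟩
    · intro i i' _ _ _ _ hh
      exact h.second_ne ht _ _ hh.1
  fH j := (h.1.fH _).even s fun i hh => by
    rw [h.1.oe] at hh
    exact absurd hh.1 (by decide)
  fV i := by
    rcases Int.even_or_odd' i with ⟨l, rfl | rfl⟩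
    · refine (h.1.fV _).even t fun j hh => ?_
      rw [(hs l j).2] at hh
      exact absurd hh.2 (by decide)
    · intro j j' _ hh
      exact absurd hh.1 (h.second_ne' hs _ _)
  oo i j := h.second_eq hs ht i j
  oe i j := by
    have := h.flip.far_gt ht (by rwa [flipB_flipB]) j i
    change (c (2 * (2 * i + 1 + s)) (2 * (2 * j + t))).σ = -1
    simpa [flipB, BCell.swap, neg_eq_iff_eq_neg] using this

theorem BGood.coarsening {c : ℤ → ℤ → BCell X} (h : BGood c) {s t : ℤ} (hs : FarSpec c s)
    (ht : FarSpec (flipB c) t) : BGood (coarsen c s t) :=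
  ⟨h.coarse_half hs ht, h.flip.coarse_half ht (by rwa [flipB_flipB])⟩

/-- A bi-infinite sequence of lines is cut into groups of length `m` starting at `a`. -/
def Grouped (m : ℕ) (a : ℤ) (V : ℤ → BLine X) : Prop :=
  ∀ j, ((V j).first = true ↔ (m : ℤ) ∣ j - a) ∧ ((V j).last = true ↔ (m : ℤ) ∣ j + 1 - a)

theorem sign_profile (m : ℕ) (δ : ℕ → SignType)
    (down : ∀ k, k + 1 < m → δ k = -1 → δ (k + 1) ≠ 1)
    (up : ∀ k, k + 1 < m → δ k ≠ -1 → δ (k + 1) = 1) (bot : 0 < m → δ 0 ≠ 1) :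
    ∃ q ≤ m, ∀ k < m, δ k = SignType.sign ((k : ℤ) - q) := by
  induction m with
  | zero => exact ⟨0, le_rfl, fun k hk => by omega⟩
  | succ m ih =>
    obtain ⟨q, hq, h⟩ := ih (fun k hk => down k (by omega)) (fun k hk => up k (by omega))
      (fun _ => bot (by omega))
    rcases hq.lt_or_eq with hq | rfl
    · refine ⟨q, by omega, fun k hk => ?_⟩
      rcases Nat.lt_succ_iff_lt_or_eq.1 hk with hk' | rfl
      · exact h k hk'
      · obtain ⟨r, rfl⟩ : ∃ r, k = r + 1 := ⟨k - 1, by omega⟩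
        rw [up r hk, sign_pos (by push_cast; omega)]
        rw [h r (by omega)]
        intro h2
        rw [sign_eq_neg_one_iff] at h2
        omega
    · have h1 : δ q ≠ 1 := by
        rcases Nat.eq_zero_or_pos q with rfl | hpos
        · exact bot (by omega)
        · obtain ⟨r, rfl⟩ : ∃ r, q = r + 1 := ⟨q - 1, by omega⟩
          refine down r (by omega) ?_
          rw [h r (by omega), sign_neg (by push_cast; omega)]
      have h2 : δ q = -1 ∨ δ q = 0 := by
        revert h1
        generalize δ q = x
        revert x
        decide
      rcases h2 with h2 | h2
      · refine ⟨q + 1, le_rfl, fun k hk => ?_⟩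
        rw [sign_neg (by push_cast; omega)]
        rcases Nat.lt_succ_iff_lt_or_eq.1 hk with hk' | rfl
        · rw [h k hk', sign_neg (by omega)]
        · exact h2
      · refine ⟨q, by omega, fun k hk => ?_⟩
        rcases Nat.lt_succ_iff_lt_or_eq.1 hk with hk' | rfl
        · exact h k hk'
        · rw [h2, sub_self, sign_zero]

end Control

section Control

variable {X : TriSys (Fin 2)}

theorem sub_sign_lemmas {a b : ℤ} : (SignType.sign (a - b) = 1 ↔ b < a) ∧
    (SignType.sign (a - b) = -1 ↔ a < b) ∧ (SignType.sign (a - b) = 0 ↔ a = b) := by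
  rw [sign_eq_one_iff, sign_eq_neg_one_iff, sign_eq_zero_iff]
  exact ⟨sub_pos, sub_neg, sub_eq_zero⟩

theorem not_dvd_of_lt {m : ℕ} {k : ℤ} (h0 : 0 < k) (h : k < m) : ¬ (m : ℤ) ∣ k :=
  fun hd => absurd (Int.le_of_dvd h0 hd) (not_le.2 h)

theorem group_step {m : ℕ} (hm : 0 < m) {β : ℤ} {U V : ℤ → BLine X} (hV : Grouped m β V)
    (c : ℤ → ℤ → BCell X) (hσ : ∀ i j, (c i j).σ = 1 ∧ (c i j).far = false)
    (hu : ∀ i j, (c i j).u = U i) (hv : ∀ i j, (c i j).v = V j) (loc : ∀ i j, BLoc (c i j))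
    (hH : ∀ i j, BH (c i j) (c (i + 1) j)) (hBV : ∀ i j, BV (c i j) (c i (j + 1))) :
    ∃ α, Grouped (m + 1) α U ∧ ∀ k : ℕ, k < m → X.V (V (β + k)).d (U (α + k)).d ∧
      X.H (U (α + k)).d (U (α + k + 1)).d := by
  have hfirst : (V β).first = true := (hV β).1.2 (by simp)
  have hlast : (V (β + ((m - 1 : ℕ) : ℤ))).last = true := (hV _).2.2 (by
    rw [Nat.cast_sub hm]
    exact ⟨1, by push_cast; ring⟩)
  have hnf : ∀ k : ℕ, k + 1 < m → (V (β + k + 1)).first = false := fun k hk => by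
    rw [Bool.eq_false_iff]
    intro h
    exact not_dvd_of_lt (m := m) (k := (k : ℤ) + 1) (by omega) (by omega)
      (by simpa [add_assoc] using (hV _).1.1 h)
  have hex : ∀ i, ∃ q ≤ m, ∀ k < m, (c i (β + (k : ℕ))).δ = SignType.sign ((k : ℤ) - q) := by
    intro i
    refine sign_profile m (fun k : ℕ => (c i (β + k)).δ) (fun k hk => ?_) (fun k hk => ?_)
      fun _ => ?_
    · have := (hBV i (β + k)).down (by rw [hv]; exact hnf k hk)
      rw [add_assoc] at this
      exact_mod_cast this
    · have := (hBV i (β + k)).up (by rw [hv]; exact hnf k hk)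
      rw [add_assoc] at this
      exact_mod_cast this
    · refine (loc i _).bot (hσ i _).1 (hσ i _).2 ?_
      rw [hv]
      simpa using hfirst
  choose q hqm hq using hex
  have hulast : ∀ i, (U i).last = true ↔ q i = m := by
    intro i
    have h1 := hq i (m - 1) (by omega)
    constructor
    · intro h
      rw [(loc i _).last (hσ i _).1 (hσ i _).2 (by rwa [hu]), eq_comm, sub_sign_lemmas.2.1] at h1
      have := hqm i
      omega
    · intro h
      rw [sub_sign_lemmas.2.1.2 (by omega)] at h1
      have := (loc i _).top (hσ i _).1 (hσ i _).2 (by rwa [hv]) h1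
      rwa [hu] at this
  have hufirst : ∀ i, (U (i + 1)).first = true ↔ q i = m := by
    intro i
    have := (hH i 0).first
    rw [hu, hu] at this
    rw [this, hulast]
  have hufirst0 : ∀ i, (U i).first = true → q i = 0 := by
    intro i h
    have h1 := hq i 0 hm
    have h2 := ((loc i (β + ((0 : ℕ) : ℤ))).first (hσ i _).1 (hσ i _).2 (by rwa [hu])).1
      (by rw [hv]; simpa using hfirst)
    rw [h2, eq_comm, sub_sign_lemmas.2.2] at h1
    omega
  have hstep : ∀ i, (q i = m ∧ q (i + 1) = 0) ∨ (q i < m ∧ q (i + 1) = q i + 1) := by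
    intro i
    rcases (hqm i).lt_or_eq with hlt | heq
    · right
      have hn : (U (i + 1)).first = false := by
        rw [Bool.eq_false_iff]
        intro h
        exact hlt.ne ((hufirst i).1 h)
      refine ⟨hlt, le_antisymm ?_ ?_⟩
      · rcases (Nat.succ_le_of_lt hlt).lt_or_eq with hlt' | heq'
        · have h1 := (hH i (β + ((q i + 1 : ℕ) : ℤ))).up (by rwa [hu])
          rw [hq i _ hlt', hq (i + 1) _ hlt', sub_sign_lemmas.1, Ne, sub_sign_lemmas.2.1] at h1
          have := h1 (by omega)
          omega
        · have := hqm (i + 1)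
          omega
      · have h1 := (hH i (β + (q i : ℤ))).down (by rwa [hu])
        rw [hq i _ hlt, hq (i + 1) _ hlt, Ne, sub_sign_lemmas.1, sub_sign_lemmas.2.1] at h1
        have := h1 (by omega)
        omega
    · exact Or.inl ⟨heq, hufirst0 _ ((hufirst i).2 heq)⟩
  have hres : ∀ i, ((m + 1 : ℕ) : ℤ) ∣ (i - -(q 0 : ℤ)) - q i := by
    intro i
    have h0 : ((m + 1 : ℕ) : ZMod (m + 1)) = 0 := ZMod.natCast_self _
    push_cast at h0
    have h1 := int_const (f := fun i : ℤ => ((q i : ZMod (m + 1))) - (i : ZMod (m + 1)))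
      (fun i => by
        rcases hstep i with ⟨h1, h2⟩ | ⟨h1, h2⟩
        · rw [h1, h2]
          push_cast
          linear_combination -h0
        · rw [h2]
          push_cast
          ring) i 0
    rw [← ZMod.intCast_zmod_eq_zero_iff_dvd]
    push_cast at h1 ⊢
    linear_combination -h1
  have hqk : ∀ i : ℤ, ∀ k : ℕ, k ≤ m → ((m + 1 : ℕ) : ℤ) ∣ (i - -(q 0 : ℤ)) - k → q i = k := by
    intro i k hk hd
    have h1 := dvd_sub (hres i) hd
    have h2 := Int.eq_zero_of_abs_lt_dvd h1 (by
      have := hqm i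
      rw [abs_lt]
      omega)
    omega
  have hlast' : ∀ i : ℤ, q i = m ↔ ((m + 1 : ℕ) : ℤ) ∣ i + 1 - -(q 0 : ℤ) := by
    intro i
    have e : i + 1 - -(q 0 : ℤ) = (i - -(q 0 : ℤ)) - m + ((m + 1 : ℕ) : ℤ) := by push_cast; ring
    rw [e, dvd_add_self_right]
    constructor
    · intro h
      have := hres i
      rwa [h] at this
    · exact hqk i m le_rfl
  refine ⟨-(q 0 : ℤ), fun i => ⟨?_, ?_⟩, fun k hk => ⟨?_, ?_⟩⟩
  · have := hufirst (i - 1)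
    rw [sub_add_cancel] at this
    rw [this, hlast', sub_add_cancel]
  · rw [hulast, hlast']
  · have h1 := hqk (-(q 0 : ℤ) + k) k hk.le (by simp)
    have h2 := (loc (-(q 0 : ℤ) + k) (β + k)).V (hσ _ _).1 (hσ _ _).2
      (by rw [hq _ _ hk, h1, sub_self, sign_zero])
    rwa [hu, hv] at h2
  · have h1 := hqk (-(q 0 : ℤ) + k) k hk.le (by simp)
    have h2 := (hH (-(q 0 : ℤ) + k) 0).H (by
      rw [hu, Bool.eq_false_iff, Ne, hufirst, h1]
      exact hk.ne)
    rwa [hu, hu] at h2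

/-- The second level of columns inherits its groups from the lowest level of rows. -/
theorem BGood.group_step {c : ℤ → ℤ → BCell X} (h : BGood c) {s : ℤ} (hs : FarSpec c s) {m : ℕ}
    (hm : 0 < m) {β : ℤ} (hV : Grouped m β (fun j => (c 0 (2 * j + 1)).v)) :
    ∃ α, Grouped (m + 1) α (fun i => (c (2 * (2 * i + 1 + s)) 0).u) ∧ ∀ k : ℕ, k < m →
      X.V (c 0 (2 * (β + k) + 1)).v.d (c (2 * (2 * (α + k) + 1 + s)) 0).u.d ∧
      X.H (c (2 * (2 * (α + k) + 1 + s)) 0).u.d (c (2 * (2 * (α + k + 1) + 1 + s)) 0).u.d := by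
  refine Sim.group_step hm hV (fun i j => c (2 * (2 * i + 1 + s)) (2 * j + 1))
    (fun i j => ⟨h.odd_eq _ _, (hs i j).1⟩) (fun i j => h.2.v_const _ _ _)
    (fun i j => h.1.v_const _ _ _) (fun i j => h.1.loc _ _) (fun i j => ?_) (fun i j => ?_)
  · refine h.1.fH (2 * j + 1) (2 * (2 * i + 1 + s)) (2 * (2 * (i + 1) + 1 + s)) (by omega)
      ⟨h.odd_eq _ _, (hs i j).1⟩ ⟨h.odd_eq _ _, (hs _ j).1⟩ fun l hl hl' hh => ?_
    rcases Int.even_or_odd' l with ⟨l, rfl | rfl⟩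
    · obtain rfl : l = 2 * (i + 1) + s := by omega
      have := (hs (i + 1) j).2
      rw [hh.2] at this
      exact Bool.false_ne_true this
    · have := hh.1
      rw [h.1.oo] at this
      exact absurd this (by decide)
  · refine h.1.fV (2 * (2 * i + 1 + s)) (2 * j + 1) (2 * (j + 1) + 1) (by omega)
      ⟨h.odd_eq _ _, (hs i j).1⟩ ⟨h.odd_eq _ _, (hs i _).1⟩ fun l hl hl' hh => ?_
    obtain rfl : l = 2 * (j + 1) := by omega
    exact h.second_ne' hs _ _ hh.1

end Control

section Control

variable {X : TriSys (Fin 2)}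

/-- Rows are indexed from the odd ones, which form the lowest level. -/
def oddRow (c : ℤ → ℤ → BCell X) (j : ℤ) : BLine X := (c 0 (2 * j + 1)).v

theorem BGood.exists_next {c : ℤ → ℤ → BCell X} (h : BGood c) {m : ℕ} (hm : 0 < m) {β : ℤ}
    (hV : Grouped m β (oddRow c)) :
    ∃ (s t : ℤ) (α : ℤ), BGood (flipB (coarsen c s t)) ∧
      Grouped (m + 1) α (oddRow (flipB (coarsen c s t))) ∧
      ∀ k : ℕ, k < m → X.V (oddRow c (β + k)).d (oddRow (flipB (coarsen c s t)) (α + k)).d ∧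
        X.H (oddRow (flipB (coarsen c s t)) (α + k)).d
          (oddRow (flipB (coarsen c s t)) (α + (k + 1 : ℕ))).d := by
  obtain ⟨s, hs⟩ := h.exists_far
  obtain ⟨t, ht⟩ := h.flip.exists_far
  obtain ⟨α, h1, h2⟩ := h.group_step hs hm hV
  have hrow : ∀ j, oddRow (flipB (coarsen c s t)) j = (c (2 * (2 * j + 1 + s)) 0).u := by
    intro j
    exact h.2.v_const _ _ _
  refine ⟨s, t, α, (h.coarsening hs ht).flip, ?_, fun k hk => ?_⟩
  · intro j
    rw [hrow]
    exact h1 j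
  · rw [hrow, hrow]
    have := h2 k hk
    rw [add_assoc α] at this
    exact_mod_cast this

theorem BGood.odd_e {c : ℤ → ℤ → BCell X} (h : BGood c) (i j : ℤ) :
    (c i (2 * j + 1)).v.e = (c 1 1).v.e ∧ (c (2 * i + 1) j).u.e = (c 1 1).v.e := by
  have h1 : ∀ i j, (c (2 * i + 1) 0).u.e = (c 0 (2 * j + 1)).v.e := fun i j => by
    have := (h.1.loc _ _).e (h.1.oo i j)
    rwa [h.1.v_const _ 0, show (c (2 * i + 1) (2 * j + 1)).u = (c (2 * i + 1) 0).u from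
      h.2.v_const _ _ _] at this
  have h2 : (c 1 1).v.e = (c 0 (2 * 0 + 1)).v.e := by
    rw [h.1.v_const _ 0]
    rfl
  rw [h2]
  constructor
  · rw [h.1.v_const _ 0, ← h1 0 j, h1 0 0]
  · rw [← h1 i 0, show (c (2 * i + 1) j).u = (c (2 * i + 1) 0).u from h.2.v_const _ _ _]

/-- The label of a line is a function of its level. -/
theorem exists_levels (c : ℕ → ℤ → ℤ → BCell X) (e : ℕ → Fin 2) (s t : ℕ → ℤ)
    (hg : ∀ n, BGood (c n)) (hc : ∀ n, c (n + 1) = flipB (coarsen (c n) (s n) (t n)))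
    (he : ∀ n, (c n 1 1).v.e = e n) (K n : ℕ) :
    ∃ a b : ℤ, ∀ m < K,
      (∀ i j, (2 : ℤ) ^ m ∣ j - a → ¬ (2 : ℤ) ^ (m + 1) ∣ j - a →
        (c n i j).v.e = e (n + m)) ∧
      ∀ i j, (2 : ℤ) ^ m ∣ i - b → ¬ (2 : ℤ) ^ (m + 1) ∣ i - b →
        (c n i j).u.e = e (n + m) := by
  induction K generalizing n with
  | zero => exact ⟨0, 0, fun m hm => absurd hm (Nat.not_lt_zero _)⟩
  | succ K ih =>
    obtain ⟨a, b, hab⟩ := ih (n + 1)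
    have hpow : ∀ (m : ℕ) (x y : ℤ), (2 : ℤ) ^ (m + 1) ∣ 2 * x - 2 * y ↔ (2 : ℤ) ^ m ∣ x - y := by
      intro m x y
      rw [pow_succ', ← mul_sub, mul_dvd_mul_iff_left two_ne_zero]
    refine ⟨2 * (b + t n), 2 * (a + s n), fun m hm => ?_⟩
    rcases m with _ | m
    · refine ⟨fun i j _ h2 => ?_, fun i j _ h2 => ?_⟩
      · rcases Int.even_or_odd' j with ⟨l, rfl | rfl⟩
        · refine absurd ?_ h2
          rw [hpow, pow_zero]
          exact one_dvd _
        · rw [add_zero, ← he]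
          exact ((hg n).odd_e i l).1
      · rcases Int.even_or_odd' i with ⟨l, rfl | rfl⟩
        · refine absurd ?_ h2
          rw [hpow, pow_zero]
          exact one_dvd _
        · rw [add_zero, ← he]
          exact ((hg n).odd_e l j).2
    · obtain ⟨h1, h2⟩ := hab m (Nat.lt_of_succ_lt_succ hm)
      rw [add_assoc, add_comm 1 m] at h1 h2
      rw [hc] at h1 h2
      refine ⟨fun i j h3 h4 => ?_, fun i j h3 h4 => ?_⟩
      · obtain ⟨l, rfl⟩ : ∃ l, j = 2 * l := by
          have h5 := (dvd_pow_self (2 : ℤ) m.succ_ne_zero).trans h3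
          exact ⟨j / 2, by omega⟩
        rw [hpow] at h3 h4
        have := h2 (l - t n) 0 (by rwa [sub_sub, add_comm (t n)]) (by rwa [sub_sub, add_comm (t n)])
        change (c n _ (2 * (l - t n + t n))).v.e = _ at this
        rw [sub_add_cancel] at this
        rw [← this, (hg n).1.v_const]
      · obtain ⟨l, rfl⟩ : ∃ l, i = 2 * l := by
          have h5 := (dvd_pow_self (2 : ℤ) m.succ_ne_zero).trans h3
          exact ⟨i / 2, by omega⟩
        rw [hpow] at h3 h4
        have := h1 0 (l - s n) (by rwa [sub_sub, add_comm (s n)]) (by rwa [sub_sub, add_comm (s n)])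
        change (c n (2 * (l - s n + s n)) _).u.e = _ at this
        rw [sub_add_cancel] at this
        rw [← this]
        exact congrArg BLine.e ((hg n).2.v_const _ _ _)

theorem BValid.exists_seq {c : ℤ → ℤ → BCell X} (h : BValid c) :
    ∃ e : ℕ → Fin 2, (∀ N, ∃ T, X.Tri N T e) ∧
      ∀ K : ℕ, ∃ a : ℤ, ∀ m < K, ∀ i j, (2 : ℤ) ^ m ∣ j - a → ¬ (2 : ℤ) ^ (m + 1) ∣ j - a →
        (c i j).v.e = e m := by
  obtain ⟨a, b, hg, hfl⟩ := h.exists_good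
  let S : ℕ → Type := fun n =>
    {p : (ℤ → ℤ → BCell X) × ℤ // BGood p.1 ∧ Grouped (n + 1) p.2 (oddRow p.1)}
  have hnext : ∀ n (p : S n), ∃ (p' : S (n + 1)) (s t : ℤ),
      p'.1.1 = flipB (coarsen p.1.1 s t) ∧ ∀ k : ℕ, k < n + 1 →
        X.V (oddRow p.1.1 (p.1.2 + k)).d (oddRow p'.1.1 (p'.1.2 + k)).d ∧
        X.H (oddRow p'.1.1 (p'.1.2 + k)).d (oddRow p'.1.1 (p'.1.2 + (k + 1 : ℕ))).d := by
    intro n p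
    obtain ⟨s, t, α, h1, h2, h3⟩ := p.2.1.exists_next (Nat.succ_pos n) p.2.2
    exact ⟨⟨(_, α), h1, h2⟩, s, t, rfl, h3⟩
  choose next s t hc hVH using hnext
  let p0 : S 0 := ⟨(fun i j => c (i + a) (j + b), 0), hg, fun j => by
    simpa [oddRow] using hfl _ j⟩
  let q : ∀ n, S n := fun n => Nat.rec p0 next n
  have hq : ∀ n, q (n + 1) = next n (q n) := fun n => rfl
  refine ⟨fun n => ((q n).1.1 1 1).v.e, fun N =>
    ⟨fun k n => (oddRow (q n).1.1 ((q n).1.2 + k)).d, ?_, ?_, ?_, ?_, ?_⟩, fun K => ?_⟩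
  · intro n _
    refine ((q n).2.1.1.loc _ _).L (((q n).2.2 _).1.2 ?_)
    simp
  · intro k n hk _
    obtain ⟨n, rfl⟩ : ∃ m, n = m + 1 := ⟨n - 1, by omega⟩
    exact (hVH n (q n) k hk).2
  · intro k n hk _
    exact (hVH n (q n) k (by omega)).1
  · intro n _
    refine (((q n).2.1.1.loc _ _).Dg (((q n).2.2 _).2.2 ?_)).1
    exact ⟨1, by push_cast; ring⟩
  · intro n _
    rw [← ((q n).2.1.odd_e 0 ((q n).1.2 + n)).1]
    refine (((q n).2.1.1.loc _ _).Dg (((q n).2.2 _).2.2 ?_)).2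
    exact ⟨1, by push_cast; ring⟩
  · obtain ⟨a', _, h1⟩ := exists_levels (fun n => (q n).1.1) (fun n => ((q n).1.1 1 1).v.e)
      (fun n => s n (q n)) (fun n => t n (q n)) (fun n => (q n).2.1) (fun n => hc n (q n))
      (fun n => rfl) K 0
    refine ⟨a' + b, fun m hm i j h2 h3 => ?_⟩
    have e1 : j - (a' + b) = j - b - a' := by ring
    rw [e1] at h2 h3
    have := (h1 m hm).1 (i - a) (j - b) h2 h3
    change (c (i - a + a) (j - b + b)).v.e = _ at this
    rwa [sub_add_cancel, sub_add_cancel, zero_add] at this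

theorem card_filter_residue_le (x : ℤ) (L N : ℕ) (hN : 0 < N) (a : ℤ) :
    ((((Finset.Ico x (x + L)).filter (fun j => (N : ℤ) ∣ j - a)).card : ℕ) : ℝ) ≤ L / N + 1 := by
  have h1 := Int.Ico_filter_modEq_card x (x + L) (r := N) (by exact_mod_cast hN) a
  have h2 : (Finset.Ico x (x + L)).filter (fun j => (N : ℤ) ∣ j - a) =
      (Finset.Ico x (x + L)).filter (fun j => j ≡ a [ZMOD N]) := by
    refine Finset.filter_congr fun j _ => ?_
    rw [Int.modEq_comm, Int.modEq_iff_dvd]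
  rw [← h2] at h1
  have h3 := Int.ceil_lt_add_one (((x + L : ℤ) - a) / (N : ℚ) : ℚ)
  have h4 := Int.le_ceil (((x : ℤ) - a) / (N : ℚ) : ℚ)
  have h5 : (((x + L : ℤ) - a) / (N : ℚ) : ℚ) = (((x : ℤ) - a) / (N : ℚ) : ℚ) + L / N := by
    push_cast
    ring
  have h6 : ((((Finset.Ico x (x + L)).filter (fun j => (N : ℤ) ∣ j - a)).card : ℕ) : ℚ)
      ≤ L / N + 1 := by
    have h7 : ((((Finset.Ico x (x + L)).filter (fun j => (N : ℤ) ∣ j - a)).card : ℤ) : ℚ) ≤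
        L / N + 1 := by
      rw [h1, Int.cast_max, max_le_iff]
      constructor
      · rw [Int.cast_sub]
        simp only [Int.cast_natCast] at *
        linarith
      · rw [Int.cast_zero]
        positivity
    exact_mod_cast h7
  have h8 := (Rat.cast_le (K := ℝ)).2 h6
  push_cast at h8
  exact h8

theorem le_card_filter_residue (x : ℤ) (L N : ℕ) (hN : 0 < N) (a : ℤ) :
    (L : ℝ) / N - 1 ≤ (((Finset.Ico x (x + L)).filter (fun j => (N : ℤ) ∣ j - a)).card : ℕ) := by
  have h1 := Int.Ico_filter_modEq_card x (x + L) (r := N) (by exact_mod_cast hN) a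
  have h2 : (Finset.Ico x (x + L)).filter (fun j => (N : ℤ) ∣ j - a) =
      (Finset.Ico x (x + L)).filter (fun j => j ≡ a [ZMOD N]) := by
    refine Finset.filter_congr fun j _ => ?_
    rw [Int.modEq_comm, Int.modEq_iff_dvd]
  rw [← h2] at h1
  have h3 := Int.ceil_lt_add_one (((x : ℤ) - a) / (N : ℚ) : ℚ)
  have h4 := Int.le_ceil (((x + L : ℤ) - a) / (N : ℚ) : ℚ)
  have h5 : (((x + L : ℤ) - a) / (N : ℚ) : ℚ) = (((x : ℤ) - a) / (N : ℚ) : ℚ) + L / N := by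
    push_cast
    ring
  have h6 : (L : ℚ) / N - 1 ≤
      ((((Finset.Ico x (x + L)).filter (fun j => (N : ℤ) ∣ j - a)).card : ℕ) : ℚ) := by
    have h7 : (L : ℚ) / N - 1 ≤
        ((((Finset.Ico x (x + L)).filter (fun j => (N : ℤ) ∣ j - a)).card : ℤ) : ℚ) := by
      rw [h1, Int.cast_max, le_max_iff, Int.cast_sub]
      left
      simp only [Int.cast_natCast] at *
      linarith
    exact_mod_cast h7
  have h8 := (Rat.cast_le (K := ℝ)).2 h6
  push_cast at h8
  exact h8

theorem pow_level_iff (m : ℕ) (x : ℤ) :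
    ((2 : ℤ) ^ m ∣ x ∧ ¬ (2 : ℤ) ^ (m + 1) ∣ x) ↔ (2 : ℤ) ^ (m + 1) ∣ x - 2 ^ m := by
  constructor
  · rintro ⟨⟨y, rfl⟩, h2⟩
    rcases Int.even_or_odd' y with ⟨l, rfl | rfl⟩
    · exact absurd ⟨l, by ring⟩ h2
    · exact ⟨l, by ring⟩
  · rintro ⟨y, hy⟩
    obtain rfl : x = 2 ^ m * (2 * y + 1) := by linear_combination hy
    refine ⟨dvd_mul_right _ _, fun h => ?_⟩
    rw [pow_succ, mul_dvd_mul_iff_left (by positivity)] at h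
    omega

theorem exists_level_or (K : ℕ) (x : ℤ) :
    (2 : ℤ) ^ K ∣ x ∨ ∃ m < K, (2 : ℤ) ^ m ∣ x ∧ ¬ (2 : ℤ) ^ (m + 1) ∣ x := by
  induction K with
  | zero => exact Or.inl (by simp)
  | succ K ih =>
    rcases ih with h | ⟨m, hm, h⟩
    · by_cases h' : (2 : ℤ) ^ (K + 1) ∣ x
      · exact Or.inl h'
      · exact Or.inr ⟨K, K.lt_succ_self, h, h'⟩
    · exact Or.inr ⟨m, by omega, h⟩

open Classical in
/-- Rows labelled `1` have density at most `d`. -/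
theorem BValid.card_le {d : ℝ} (hX : ∀ b : ℕ → Fin 2, (∀ N, ∃ T, X.Tri N T b) →
      ∀ m, ∑ n ∈ Finset.range m, ((b n : ℕ) : ℝ) / 2 ^ (n + 1) ≤ d)
    {c : ℤ → ℤ → BCell X} (h : BValid c) (K L : ℕ) (x : ℤ) :
    ((((Finset.Ico x (x + L)).filter (fun j => (c 0 j).v.e = 1)).card : ℕ) : ℝ) ≤
      d * L + L / 2 ^ K + K + 1 := by
  obtain ⟨e, h1, h2⟩ := h.exists_seq
  obtain ⟨a, ha⟩ := h2 K
  have hd := hX e h1 K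
  let W := Finset.Ico x (x + L)
  have hsub : W.filter (fun j => (c 0 j).v.e = 1) ⊆
      W.filter (fun j => ((2 ^ K : ℕ) : ℤ) ∣ j - a) ∪
        (Finset.range K).biUnion (fun m => if e m = 1 then
          W.filter (fun j => ((2 ^ (m + 1) : ℕ) : ℤ) ∣ j - (a + 2 ^ m)) else ∅) := by
    intro j hj
    rw [Finset.mem_filter] at hj
    rw [Finset.mem_union, Finset.mem_filter, Finset.mem_biUnion]
    push_cast
    rcases exists_level_or K (j - a) with h3 | ⟨m, hm, h3⟩
    · exact Or.inl ⟨hj.1, h3⟩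
    · refine Or.inr ⟨m, Finset.mem_range.2 hm, ?_⟩
      have h4 := ha m hm 0 j h3.1 h3.2
      rw [if_pos (h4 ▸ hj.2), Finset.mem_filter, ← sub_sub]
      exact ⟨hj.1, (pow_level_iff m _).1 h3⟩
  have hcard := (Finset.card_le_card hsub).trans ((Finset.card_union_le _ _).trans
    (Nat.add_le_add_left Finset.card_biUnion_le _))
  have hcard' : (((W.filter (fun j => (c 0 j).v.e = 1)).card : ℕ) : ℝ) ≤
      (L / ((2 ^ K : ℕ) : ℝ) + 1) + ∑ m ∈ Finset.range K,
        (((e m : ℕ) : ℝ) / 2 ^ (m + 1) * L + 1) := by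
    refine (Nat.cast_le.2 hcard).trans ?_
    push_cast
    gcongr with m hm
    · simpa using card_filter_residue_le x L (2 ^ K) (by positivity) a
    · by_cases he : e m = 1
      · rw [if_pos he, he]
        refine (card_filter_residue_le x L (2 ^ (m + 1)) (by positivity) _).trans (le_of_eq ?_)
        rw [Fin.val_one]
        push_cast
        ring
      · rw [if_neg he]
        simp only [Finset.card_empty, Nat.cast_zero]
        positivity
  refine hcard'.trans ?_
  rw [Finset.sum_add_distrib, ← Finset.sum_mul]
  have hL : (0 : ℝ) ≤ L := L.cast_nonneg
  have := mul_le_mul_of_nonneg_right hd hL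
  simp only [Finset.sum_const, Finset.card_range, nsmul_eq_mul, mul_one]
  push_cast
  linarith

end Control

section Control

variable {X : TriSys (Fin 2)}

theorem exists_odd_part (x : ℤ) (hx : x ≠ 0) :
    ∃ p : ℕ × ℤ, x = 2 ^ p.1 * (2 * p.2 + 1) := by
  obtain ⟨n, y, hy, h⟩ := (Int.finiteMultiplicity_iff (a := 2) (b := x)).2
    ⟨by decide, hx⟩ |>.exists_eq_pow_mul_and_not_dvd |> fun ⟨y, h1, h2⟩ =>
      (⟨_, y, h2, h1⟩ : ∃ (n : ℕ) (y : ℤ), ¬ (2 : ℤ) ∣ y ∧ x = 2 ^ n * y)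
  refine ⟨(n, (y - 1) / 2), ?_⟩
  rw [h, show 2 * ((y - 1) / 2) + 1 = y by omega]

theorem pow_dvd_odd_part {m n : ℕ} {y : ℤ} :
    (2 : ℤ) ^ m ∣ 2 ^ n * (2 * y + 1) ↔ m ≤ n := by
  constructor
  · intro h
    by_contra hlt
    obtain ⟨r, rfl⟩ : ∃ r, m = n + 1 + r := ⟨m - (n + 1), by omega⟩
    have h1 := (pow_dvd_pow (2 : ℤ) (Nat.le_add_right (n + 1) r)).trans h
    rw [pow_succ, mul_dvd_mul_iff_left (by positivity)] at h1
    omega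
  · intro h
    exact (pow_dvd_pow _ h).mul_right _

/-- The pair `(n, y)` such that `x = 2 ^ n * (2 * y + 1)`, if any. -/
noncomputable def oddPart (x : ℤ) : Option (ℕ × ℤ) :=
  open Classical in if hx : x = 0 then none else some (exists_odd_part x hx).choose

theorem oddPart_zero : oddPart 0 = none := dif_pos rfl

theorem oddPart_mul (n : ℕ) (y : ℤ) : oddPart (2 ^ n * (2 * y + 1)) = some (n, y) := by
  have h0 : (2 : ℤ) ^ n * (2 * y + 1) ≠ 0 := mul_ne_zero (by positivity) (by omega)
  rw [oddPart, dif_neg h0]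
  obtain ⟨⟨n', y'⟩, h⟩ : ∃ p, p = (exists_odd_part _ h0).choose := ⟨_, rfl⟩
  have h1 := (exists_odd_part _ h0).choose_spec
  rw [← h] at h1 ⊢
  dsimp only at h1
  have h2 : n ≤ n' := pow_dvd_odd_part.1 (Dvd.intro _ h1)
  have h3 : n' ≤ n := pow_dvd_odd_part.1 (Dvd.intro _ h1.symm)
  obtain rfl := le_antisymm h2 h3
  have h4 := mul_left_cancel₀ (by positivity : (2 : ℤ) ^ n ≠ 0) h1
  obtain rfl : y = y' := by omega
  rfl

theorem oddPart_cases (x : ℤ) : x = 0 ∨ ∃ n y, x = 2 ^ n * (2 * y + 1) := by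
  by_cases hx : x = 0
  · exact Or.inl hx
  · obtain ⟨p, hp⟩ := exists_odd_part x hx
    exact Or.inr ⟨p.1, p.2, hp⟩

/-- Position of the `y`-th line of level `n` in its group. -/
def pos (n : ℕ) (y : ℤ) : ℕ := (y % ((n + 1 : ℕ) : ℤ)).toNat

theorem pos_le (n : ℕ) (y : ℤ) : pos n y ≤ n := by
  have h1 := Int.emod_lt_of_pos y (b := ((n + 1 : ℕ) : ℤ)) (by positivity)
  rw [pos]
  omega

theorem pos_succ (n : ℕ) (y : ℤ) :
    (pos n y = n ∧ pos n (y + 1) = 0) ∨ (pos n y < n ∧ pos n (y + 1) = pos n y + 1) := by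
  have h1 := Int.emod_lt_of_pos y (b := ((n + 1 : ℕ) : ℤ)) (by positivity)
  have h2 := Int.emod_nonneg y (b := ((n + 1 : ℕ) : ℤ)) (by positivity)
  have h3 := emod_add_one (Nat.succ_pos n) y
  have h4 := Int.emod_lt_of_pos (y + 1) (b := ((n + 1 : ℕ) : ℤ)) (by positivity)
  rw [pos, pos]
  rw [Nat.succ_eq_add_one] at h3
  split_ifs at h3 with h
  · left
    rw [h3]
    have h5 := dvd_sub h (Int.dvd_self_sub_emod (x := y) (m := ((n + 1 : ℕ) : ℤ)))
    have h6 : y + 1 - (y - y % ((n + 1 : ℕ) : ℤ)) = y % ((n + 1 : ℕ) : ℤ) + 1 := by ring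
    rw [h6] at h5
    have := Int.le_of_dvd (by omega) h5
    omega
  · right
    rw [h3] at h4 ⊢
    omega

variable (e : ℕ → Fin 2) (T : ℕ → ℕ → X.S)

def stdLine : Option (ℕ × ℤ) → BLine X
  | none => ⟨false, false, false, false, 0, T 0 0⟩
  | some (n, y) => ⟨decide (n = 0), decide (y % 2 = 1), decide (pos n y = 0),
      decide (pos n y = n), e n, T (pos n y) n⟩

noncomputable def stdSign : Option (ℕ × ℤ) → Option (ℕ × ℤ) → SignType
  | none, none => 0
  | none, some _ => 1
  | some _, none => -1
  | some (n, _), some (m, _) => SignType.sign ((n : ℤ) - m)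

def stdFar : Option (ℕ × ℤ) → Option (ℕ × ℤ) → Bool
  | none, none => false
  | none, some _ => true
  | some _, none => true
  | some (n, _), some (m, _) => decide (n + 2 ≤ m ∨ m + 2 ≤ n)

noncomputable def stdSlope : Option (ℕ × ℤ) → Option (ℕ × ℤ) → SignType
  | some (n, y), some (m, z) =>
    if m < n then SignType.sign ((pos m z : ℤ) - pos n y)
    else if n < m then SignType.sign ((pos n y : ℤ) - pos m z) else 0
  | _, _ => 0

noncomputable def stdCell (i j : ℤ) : BCell X :=
  ⟨stdLine e T (oddPart i), stdLine e T (oddPart j), stdSign (oddPart i) (oddPart j),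
    stdFar (oddPart i) (oddPart j), stdSlope (oddPart i) (oddPart j)⟩

theorem flipB_stdCell : flipB (stdCell e T) = stdCell e T := by
  funext i j
  simp only [flipB, BCell.swap, stdCell, BCell.mk.injEq, true_and]
  rcases oddPart i with _ | ⟨n, y⟩ <;> rcases oddPart j with _ | ⟨m, z⟩ <;>
    simp only [stdSign, stdFar, stdSlope, neg_zero, neg_neg, and_self]
  refine ⟨?_, ?_, ?_⟩
  · rw [← Left.sign_neg, neg_sub]
  · rw [decide_eq_decide, or_comm]
  · rcases lt_trichotomy n m with h | h | h
    · simp [h, h.not_gt]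
    · simp [h]
    · simp [h, h.not_gt]

theorem stdCell_near {i j : ℤ} :
    ((stdCell e T i j).σ = 1 ∧ (stdCell e T i j).far = false) ↔
      ∃ n y z, i = 2 ^ (n + 1) * (2 * y + 1) ∧ j = 2 ^ n * (2 * z + 1) := by
  constructor
  · rintro ⟨h1, h2⟩
    rcases oddPart_cases i with rfl | ⟨n, y, rfl⟩ <;> rcases oddPart_cases j with rfl | ⟨m, z, rfl⟩
    all_goals simp only [stdCell, oddPart_zero, oddPart_mul, stdSign, stdFar] at h1 h2
    · exact absurd h1 (by decide)
    · exact absurd h2 (by decide)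
    · exact absurd h1 (by decide)
    · rw [sub_sign_lemmas.1] at h1
      rw [decide_eq_false_iff_not] at h2
      obtain rfl : n = m + 1 := by omega
      exact ⟨m, y, z, rfl, rfl⟩
  · rintro ⟨n, y, z, rfl, rfl⟩
    simp only [stdCell, oddPart_mul, stdSign, stdFar]
    rw [sub_sign_lemmas.1, decide_eq_false_iff_not]
    omega

theorem stdCell_loc (hT : ∀ N, X.Tri N T e) (i j : ℤ) : BLoc (stdCell e T i j) := by
  have hf : (stdCell e T i j).σ = 1 → (stdCell e T i j).far = false →
      ∃ n y z, i = 2 ^ (n + 1) * (2 * y + 1) ∧ j = 2 ^ n * (2 * z + 1) :=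
    fun h1 h2 => (stdCell_near e T).1 ⟨h1, h2⟩
  refine ⟨?_, ?_, ?_, ?_, ?_, ?_, ?_, ?_⟩
  · rcases oddPart_cases j with rfl | ⟨m, z, rfl⟩ <;>
      simp only [stdCell, oddPart_zero, oddPart_mul, stdLine]
    · exact fun h => absurd h Bool.false_ne_true
    · rw [decide_eq_true_iff]
      intro h
      rw [h]
      exact (hT (m + 1)).L m m.lt_succ_self
  · rcases oddPart_cases j with rfl | ⟨m, z, rfl⟩ <;>
      simp only [stdCell, oddPart_zero, oddPart_mul, stdLine]
    · exact fun h => absurd h Bool.false_ne_true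
    · rw [decide_eq_true_iff]
      intro h
      rw [h]
      exact ⟨(hT (m + 1)).Dg m m.lt_succ_self, (hT (m + 1)).inp m m.lt_succ_self⟩
  · rcases oddPart_cases i with rfl | ⟨n, y, rfl⟩ <;> rcases oddPart_cases j with rfl | ⟨m, z, rfl⟩
    all_goals simp only [stdCell, oddPart_zero, oddPart_mul, stdSign, stdLine]
    · exact fun _ => trivial
    · exact fun h => absurd h (by decide)
    · exact fun h => absurd h (by decide)
    · rw [sub_sign_lemmas.2.2, Nat.cast_inj]
      rintro rfl
      rfl
  all_goals
    intro h1 h2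
    obtain ⟨n, y, z, rfl, rfl⟩ := hf h1 h2
    simp only [stdCell, oddPart_mul, stdLine, stdSlope, lt_add_one, if_true, decide_eq_true_iff,
      decide_eq_false_iff_not, sub_sign_lemmas.1, sub_sign_lemmas.2.1, sub_sign_lemmas.2.2, Ne]
    have hy := pos_le (n + 1) y
    have hz := pos_le n z
  · omega
  · omega
  · omega
  · omega
  · intro h
    rw [Nat.cast_inj] at h
    rw [← h]
    exact (hT (n + 2)).V _ _ hz (Nat.lt_succ_self _)

theorem stdCell_cls (n : ℕ) (x y : ℤ) :
    (stdCell e T (2 ^ n * x) (2 ^ n * (2 * y + 1))).cls = ((x - 1 : ℤ) : ZMod 4) := by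
  have h4 : (4 : ZMod 4) = 0 := rfl
  rcases Int.even_or_odd' x with ⟨w, rfl | rfl⟩
  · have hσ : (stdCell e T (2 ^ n * (2 * w)) (2 ^ n * (2 * y + 1))).σ = 1 ∧
        (stdCell e T (2 ^ n * (2 * w)) (2 ^ n * (2 * y + 1))).far = decide (w % 2 = 0) := by
      rcases oddPart_cases w with rfl | ⟨m, v, rfl⟩
      · rw [mul_zero, mul_zero]
        simp [stdCell, oddPart_zero, oddPart_mul, stdSign, stdFar]
      · rw [← mul_assoc, ← mul_assoc, ← pow_succ, ← pow_add]
        simp only [stdCell, oddPart_mul, stdSign, stdFar]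
        have h1 : (2 ^ m * (2 * v + 1)) % 2 = 0 ↔ 1 ≤ m := by
          rw [← pow_dvd_odd_part (m := 1) (n := m) (y := v), pow_one, Int.dvd_iff_emod_eq_zero]
        rw [sub_sign_lemmas.1, decide_eq_decide, h1]
        omega
    rw [BCell.cls, hσ.1, hσ.2, if_neg (by decide)]
    simp only [decide_eq_true_iff]
    split_ifs with h
    · obtain ⟨v, rfl⟩ : ∃ v, w = 2 * v := ⟨w / 2, by omega⟩
      push_cast
      linear_combination (1 - (v : ZMod 4)) * h4
    · obtain ⟨v, rfl⟩ : ∃ v, w = 2 * v + 1 := ⟨w / 2, by omega⟩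
      push_cast
      linear_combination (-(v : ZMod 4)) * h4
  · simp only [BCell.cls, stdCell, oddPart_mul, stdSign, stdFar, stdLine, sub_self, sign_zero,
      if_true, decide_eq_true_iff]
    split_ifs with h
    · obtain ⟨v, rfl⟩ : ∃ v, w = 2 * v + 1 := ⟨w / 2, by omega⟩
      push_cast
      linear_combination (-(v : ZMod 4)) * h4
    · obtain ⟨v, rfl⟩ : ∃ v, w = 2 * v := ⟨w / 2, by omega⟩
      push_cast
      linear_combination (-(v : ZMod 4)) * h4

theorem stdCell_ge {i : ℤ} {n : ℕ} {y : ℤ} :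
    (stdCell e T i (2 ^ n * (2 * y + 1))).σ ≠ -1 ↔ (2 : ℤ) ^ n ∣ i := by
  rcases oddPart_cases i with rfl | ⟨m, z, rfl⟩ <;>
    simp only [stdCell, oddPart_zero, oddPart_mul, stdSign]
  · simp
  · rw [pow_dvd_odd_part, Ne, sub_sign_lemmas.2.1]
    omega

theorem stdCell_half (hT : ∀ N, X.Tri N T e) : BHalf (stdCell e T) where
  v i j := rfl
  loc := stdCell_loc e T hT
  order j := by
    rcases oddPart_cases j with rfl | ⟨n, y, rfl⟩
    · intro i i' hi h1 h2 _
      have h0 : ∀ i, (stdCell e T i 0).σ ≠ -1 → i = 0 := by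
        intro i h
        rcases oddPart_cases i with rfl | ⟨m, z, rfl⟩
        · rfl
        · exact absurd (by simp only [stdCell, oddPart_zero, oddPart_mul, stdSign]) h
      rw [h0 i h1, h0 i' h2] at hi
      exact absurd hi (lt_irrefl _)
    · intro i i' hi h1 h2 h3
      dsimp only at h1 h2 h3 ⊢
      simp only [stdCell_ge] at h1 h2 h3
      have h4 := consecutive_multiples (N := 2 ^ n) (c := 0) (by positivity) hi
        (by simpa using h1) (by simpa using h2) (by simpa using h3)
      obtain ⟨x, rfl⟩ := h1
      obtain rfl : i' = 2 ^ n * (x + 1) := by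
        rw [h4]
        push_cast
        ring
      rw [stdCell_cls, stdCell_cls]
      push_cast
      ring
  near j := by
    have h0 : ∀ n y, (stdCell e T 0 (2 ^ n * (2 * y + 1))).σ = 1 := fun n y => by
      simp only [stdCell, oddPart_zero, oddPart_mul, stdSign]
    rcases oddPart_cases j with rfl | ⟨_ | n, y, rfl⟩
    · intro i i' hi h1 h2 _
      have h0 : ∀ i, ¬ ((stdCell e T i 0).σ = -1 ∧ (stdCell e T i 0).far = true) → i = 0 := by
        intro i h
        rcases oddPart_cases i with rfl | ⟨m, z, rfl⟩
        · rfl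
        · exact absurd (by simp only [stdCell, oddPart_zero, oddPart_mul, stdSign, stdFar,
            and_self]) h
      rw [h0 i h1, h0 i' h2] at hi
      exact absurd hi (lt_irrefl _)
    · intro i i' _ _ _ _ h
      have := (stdCell_ge e T (i := i) (n := 0) (y := y)).2 (by simp)
      exact this h.1
    · have hP : ∀ i, ¬ ((stdCell e T i (2 ^ (n + 1) * (2 * y + 1))).σ = -1 ∧
          (stdCell e T i (2 ^ (n + 1) * (2 * y + 1))).far = true) ↔ (2 : ℤ) ^ n ∣ i := by
        intro i
        rcases oddPart_cases i with rfl | ⟨m, z, rfl⟩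
        · simp [h0]
        · rw [pow_dvd_odd_part]
          simp only [stdCell, oddPart_mul, stdSign, stdFar]
          rw [sub_sign_lemmas.2.1, decide_eq_true_iff]
          omega
      intro i i' hi h1 h2 h3
      dsimp only at h1 h2 h3 ⊢
      simp only [hP] at h1 h2 h3
      have h4 := consecutive_multiples (N := 2 ^ n) (c := 0) (by positivity) hi
        (by simpa using h1) (by simpa using h2) (by simpa using h3)
      obtain ⟨x, rfl⟩ := h1
      obtain rfl : i' = 2 ^ n * (x + 1) := by
        rw [h4]
        push_cast
        ring
      rintro ⟨h5, h6⟩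
      rcases Int.even_or_odd' x with ⟨w, rfl | rfl⟩
      · refine (stdCell_ge e T).2 ⟨w, ?_⟩ h5
        ring
      · refine (stdCell_ge e T).2 ⟨w + 1, ?_⟩ h6
        ring
  fH j := by
    intro i i' hi h1 h2 h3
    obtain ⟨n, y, z, rfl, rfl⟩ := (stdCell_near e T).1 h1
    obtain ⟨n', y', z', rfl, hj⟩ := (stdCell_near e T).1 h2
    have hn := congrArg oddPart hj
    rw [oddPart_mul, oddPart_mul, Option.some.injEq, Prod.mk.injEq] at hn
    obtain ⟨rfl, rfl⟩ := hn
    obtain rfl : y' = y + 1 := by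
      have h4 : y < y' := by
        have := lt_of_mul_lt_mul_left hi (by positivity)
        omega
      by_contra hne
      refine h3 (2 ^ (n + 1) * (2 * (y + 1) + 1)) ?_ ?_ ((stdCell_near e T).2 ⟨_, _, _, rfl, rfl⟩)
      · gcongr
        omega
      · gcongr
        omega
    have hy := pos_le (n + 1) y
    have hz := pos_le n z
    have hs := pos_succ (n + 1) y
    constructor <;>
      simp only [stdCell, oddPart_mul, stdLine, stdSlope, lt_add_one, if_true, decide_eq_true_iff,
      decide_eq_false_iff_not, sub_sign_lemmas.1, sub_sign_lemmas.2.1, Ne]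
    · omega
    · omega
    · omega
    · intro h
      obtain ⟨h5, h6⟩ : pos (n + 1) y < n + 1 ∧ pos (n + 1) (y + 1) = pos (n + 1) y + 1 := by
        omega
      rw [h6]
      exact (hT (n + 2)).H _ _ h5 (Nat.lt_succ_self _)
  fV i := by
    intro j j' hj h1 h2 h3
    obtain ⟨n, y, z, rfl, rfl⟩ := (stdCell_near e T).1 h1
    obtain ⟨n', y', z', hi, rfl⟩ := (stdCell_near e T).1 h2
    have hn := congrArg oddPart hi
    rw [oddPart_mul, oddPart_mul, Option.some.injEq, Prod.mk.injEq, Nat.add_right_cancel_iff] at hn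
    obtain ⟨rfl, rfl⟩ := hn
    obtain rfl : z' = z + 1 := by
      have h4 : z < z' := by
        have := lt_of_mul_lt_mul_left hj (by positivity)
        omega
      by_contra hne
      refine h3 (2 ^ n * (2 * (z + 1) + 1)) ?_ ?_ ((stdCell_near e T).2 ⟨_, _, _, rfl, rfl⟩)
      · gcongr
        omega
      · gcongr
        omega
    have hy := pos_le (n + 1) y
    have hz := pos_le n z
    have hs := pos_succ n z
    constructor <;>
      simp only [stdCell, oddPart_mul, stdLine, stdSlope, lt_add_one, if_true,
      decide_eq_false_iff_not, sub_sign_lemmas.1, sub_sign_lemmas.2.1, Ne]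
    · omega
    · omega

theorem stdCell_row (hT : ∀ N, X.Tri N T e) : BRow (stdCell e T) where
  toBHalf := stdCell_half e T hT
  z := by
    have hz : ∀ i j, (stdCell e T i j).u.z = decide (i % 2 = 1) := by
      intro i j
      rcases oddPart_cases i with rfl | ⟨m, z, rfl⟩
      · simp [stdCell, oddPart_zero, stdLine]
      · have h1 : (2 ^ m * (2 * z + 1)) % 2 = 0 ↔ 1 ≤ m := by
          rw [← pow_dvd_odd_part (m := 1) (n := m) (y := z), pow_one, Int.dvd_iff_emod_eq_zero]
        simp only [stdCell, oddPart_mul, stdLine]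
        rw [decide_eq_decide]
        omega
    intro i j
    rw [hz, hz, ← decide_not, decide_eq_decide]
    omega
  single i j := by
    rcases oddPart_cases j with rfl | ⟨m, z, rfl⟩ <;>
      simp only [stdCell, oddPart_zero, oddPart_mul, stdLine]
    · exact fun h => absurd h Bool.false_ne_true
    · have := pos_le m z
      simp only [decide_eq_true_iff]
      omega
  zz i j := by
    rcases oddPart_cases i with rfl | ⟨n, y, rfl⟩ <;> rcases oddPart_cases j with rfl | ⟨m, z, rfl⟩
    all_goals simp only [stdCell, oddPart_zero, oddPart_mul, stdSign, stdLine, decide_eq_true_iff]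
    · exact fun _ _ => trivial
    · exact fun h => absurd h Bool.false_ne_true
    · exact fun _ h => absurd h Bool.false_ne_true
    · rw [sub_sign_lemmas.2.2]
      omega
  zn i j := by
    rcases oddPart_cases i with rfl | ⟨n, y, rfl⟩ <;> rcases oddPart_cases j with rfl | ⟨m, z, rfl⟩
    all_goals simp only [stdCell, oddPart_zero, oddPart_mul, stdSign, stdLine, decide_eq_true_iff,
      decide_eq_false_iff_not]
    · exact fun h => absurd h Bool.false_ne_true
    · exact fun h => absurd h Bool.false_ne_true
    · exact fun _ _ => trivial
    · rw [sub_sign_lemmas.2.1]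
      omega

theorem stdCell_valid (hT : ∀ N, X.Tri N T e) : BValid (stdCell e T) :=
  ⟨stdCell_row e T hT, by rw [flipB_stdCell]; exact stdCell_row e T hT⟩

theorem stdCell_e {m : ℕ} (i : ℤ) {j : ℤ} (h1 : (2 : ℤ) ^ m ∣ j) (h2 : ¬ (2 : ℤ) ^ (m + 1) ∣ j) :
    (stdCell e T i j).v.e = e m := by
  rcases oddPart_cases j with rfl | ⟨n, z, rfl⟩
  · exact absurd (dvd_zero _) h2
  · rw [pow_dvd_odd_part] at h1 h2
    obtain rfl : n = m := by omega
    simp only [stdCell, oddPart_mul, stdLine]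

end Control

section Control

variable {X : TriSys (Fin 2)}

theorem exists_binary {d : ℝ} (h0 : 0 ≤ d) (h1 : d ≤ 1) :
    ∃ e : ℕ → Fin 2, ∀ m, ∑ n ∈ Finset.range m, ((e n : ℕ) : ℝ) / 2 ^ (n + 1) ≤ d ∧
      d - 1 / 2 ^ m ≤ ∑ n ∈ Finset.range m, ((e n : ℕ) : ℝ) / 2 ^ (n + 1) := by
  classical
  let r : ℕ → ℝ := fun n => Nat.rec d (fun _ x => if 1 ≤ 2 * x then 2 * x - 1 else 2 * x) n
  have hr : ∀ n, r (n + 1) = if 1 ≤ 2 * r n then 2 * r n - 1 else 2 * r n := fun n => rfl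
  have hr01 : ∀ n, 0 ≤ r n ∧ r n ≤ 1 := by
    intro n
    induction n with
    | zero => exact ⟨h0, h1⟩
    | succ n ih =>
      rw [hr]
      split_ifs with h <;> constructor <;> linarith [ih.1, ih.2]
  let e : ℕ → Fin 2 := fun n => if 1 ≤ 2 * r n then 1 else 0
  have he : ∀ n, ((e n : ℕ) : ℝ) = 2 * r n - r (n + 1) := by
    intro n
    rw [hr]
    by_cases h : 1 ≤ 2 * r n
    · rw [show e n = 1 from if_pos h, if_pos h]
      simp
    · rw [show e n = 0 from if_neg h, if_neg h]
      simp
  have hsum : ∀ m, ∑ n ∈ Finset.range m, ((e n : ℕ) : ℝ) / 2 ^ (n + 1) = d - r m / 2 ^ m := by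
    intro m
    induction m with
    | zero => simp [r]
    | succ m ih =>
      rw [Finset.sum_range_succ, ih, he, pow_succ]
      field_simp
      ring
  refine ⟨e, fun m => ?_⟩
  rw [hsum]
  have hp : (0 : ℝ) < 2 ^ m := by positivity
  constructor
  · have := div_nonneg (hr01 m).1 hp.le
    linarith
  · have := div_le_div_of_nonneg_right (hr01 m).2 hp.le
    linarith

open Classical in
theorem exists_BValid_dense {d : ℝ} (h0 : 0 ≤ d) (h1 : d ≤ 1)
    (hX : ∀ b : ℕ → Fin 2, (∀ m, ∑ n ∈ Finset.range m, ((b n : ℕ) : ℝ) / 2 ^ (n + 1) ≤ d) →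
      ∃ T, ∀ N, X.Tri N T b) :
    ∃ c : ℤ → ℤ → BCell X, BValid c ∧ ∀ (K L : ℕ) (x : ℤ), (d - 1 / 2 ^ K) * L - K ≤
      ((((Finset.Ico x (x + L)).filter (fun j => (c 0 j).v.e = 1)).card : ℕ) : ℝ) := by
  obtain ⟨e, he⟩ := exists_binary h0 h1
  obtain ⟨T, hT⟩ := hX e fun m => (he m).1
  refine ⟨stdCell e T, stdCell_valid e T hT, fun K L x => ?_⟩
  let W := Finset.Ico x (x + L)
  let A : ℕ → Finset ℤ := fun m => if e m = 1 then
    W.filter (fun j => ((2 ^ (m + 1) : ℕ) : ℤ) ∣ j - 2 ^ m) else ∅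
  have hA : ∀ m j, j ∈ A m → j ∈ W ∧ e m = 1 ∧ (2 : ℤ) ^ m ∣ j ∧ ¬ (2 : ℤ) ^ (m + 1) ∣ j := by
    intro m j hj
    simp only [A] at hj
    split_ifs at hj with h
    · rw [Finset.mem_filter] at hj
      refine ⟨hj.1, h, (pow_level_iff m j).2 ?_⟩
      exact_mod_cast hj.2
    · exact absurd hj (Finset.notMem_empty _)
  have hdisj : ∀ m m' j, j ∈ A m → j ∈ A m' → m ≤ m' := by
    intro m m' j h h'
    by_contra hlt
    exact (hA m' j h').2.2.2 ((pow_dvd_pow _ (by omega)).trans (hA m j h).2.2.1)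
  have hsub : (Finset.range K).biUnion A ⊆ W.filter (fun j => (stdCell e T 0 j).v.e = 1) := by
    intro j hj
    obtain ⟨m, _, hm⟩ := Finset.mem_biUnion.1 hj
    obtain ⟨h2, h3, h4, h5⟩ := hA m j hm
    exact Finset.mem_filter.2 ⟨h2, by rw [stdCell_e e T 0 h4 h5, h3]⟩
  have hcard := Finset.card_le_card hsub
  rw [Finset.card_biUnion (fun m _ m' _ hne => Finset.disjoint_left.2 fun j h h' =>
    hne (le_antisymm (hdisj _ _ _ h h') (hdisj _ _ _ h' h)))] at hcard
  refine le_trans ?_ (Nat.cast_le.2 hcard)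
  push_cast
  have hm : ∀ m ∈ Finset.range K, ((e m : ℕ) : ℝ) / 2 ^ (m + 1) * L - 1 ≤ ((A m).card : ℝ) := by
    intro m _
    by_cases h : e m = 1
    · simp only [A]
      rw [if_pos h, h, Fin.val_one]
      refine le_trans (le_of_eq ?_)
        (le_card_filter_residue x L (2 ^ (m + 1)) (by positivity) (2 ^ m))
      push_cast
      ring
    · have : e m = 0 := by omega
      rw [this]
      simp only [Fin.val_zero, Nat.cast_zero, zero_div, zero_mul]
      have : (0 : ℝ) ≤ ((A m).card : ℝ) := Nat.cast_nonneg _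
      linarith
  refine le_trans ?_ (Finset.sum_le_sum hm)
  rw [Finset.sum_sub_distrib, ← Finset.sum_mul]
  simp only [Finset.sum_const, Finset.card_range, nsmul_eq_mul, mul_one]
  have := mul_le_mul_of_nonneg_right (he K).2 (Nat.cast_nonneg (α := ℝ) L)
  linarith

end Control

section Assembly

variable {k : ℕ}

theorem Sofic.shift {C : Type} {V : Set (ℤ → ℤ → C)} (hV : Sofic V) {x : ℤ → ℤ → C} (hx : x ∈ V)
    (a b : ℤ) : (fun i j => x (i + a) (j + b)) ∈ V := by
  obtain ⟨D, _, π, h, v, H⟩ := hV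
  obtain ⟨c, h1, h2⟩ := (H x).1 hx
  refine (H _).2 ⟨fun i j => c (i + a) (j + b), fun i j => ?_, fun i j => h2 _ _⟩
  dsimp only
  rw [add_right_comm i, add_right_comm j]
  exact h1 _ _

theorem AValid.special_unique {X : TriSys (Fin k)} {C : ℤ → ℤ → ACell X} (hC : AValid X C)
    {i i' j j' : ℤ} (h : (C i j).ty = some false) (h' : (C i' j').ty = some false) : j = j' := by
  have hty : ∀ i i' j, (C i j).ty = (C i' j).ty := fun i i' j =>
    int_const (f := fun i => (C i j).ty) (fun i => (hC.H i j).ty) i i'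
  have key : ∀ i i' j j', (C i j).ty = some false → (C i' j').ty = some false → ¬ j < j' := by
    intro i i' j j' h h' hlt
    obtain ⟨n, rfl⟩ : ∃ n : ℕ, j' = j + 1 + n := ⟨(j' - j - 1).toNat, by omega⟩
    have hab : ∀ n : ℕ, (C i (j + 1 + n)).ty = some true := by
      intro n
      induction n with
      | zero =>
        rw [Nat.cast_zero, add_zero]
        exact ((hC.V i j).above (by rw [h]; exact Option.some_ne_none _)).1
      | succ n ih =>
        push_cast
        rw [← add_assoc]
        exact ((hC.V i _).above (by rw [ih]; exact Option.some_ne_none _)).1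
    rw [hty i' i, hab] at h'
    exact absurd h' (by simp)
  have h1 := key _ _ _ _ h h'
  have h2 := key _ _ _ _ h' h
  omega

/-- Square patterns of side `N`. -/
def pats {A : Type*} (V : Set (ℤ → ℤ → A)) (N : ℕ) : Set (Fin N → Fin N → A) :=
  {p | ∃ x ∈ V, ∀ i j : Fin N, x (i : ℤ) (j : ℤ) = p i j}

theorem pats_pos {V : Set (ℤ → ℤ → Fin k)} (hV : V.Nonempty) (N : ℕ) :
    0 < (pats V N).ncard := by
  obtain ⟨x, hx⟩ := hV
  exact (Set.ncard_pos (Set.toFinite _)).2 ⟨_, x, hx, fun _ _ => rfl⟩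

theorem ncard_pats_le {V W : Set (ℤ → ℤ → Fin k)} {N : ℕ}
    (h : ∀ x ∈ V, ∃ y ∈ W, ∃ (o : Option (Fin N)) (w : Fin N → Fin k), ∀ i j : Fin N,
      x (i : ℤ) (j : ℤ) = if o = some j then w i else y (i : ℤ) (j : ℤ)) :
    (pats V N).ncard ≤ (N + 1) * k ^ N * (pats W N).ncard := by
  classical
  let g : (Option (Fin N) × (Fin N → Fin k)) × (Fin N → Fin N → Fin k) → Fin N → Fin N → Fin k :=
    fun q i j => if q.1.1 = some j then q.1.2 i else q.2 i j
  have hsub : pats V N ⊆ g '' (Set.univ ×ˢ pats W N) := by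
    rintro p ⟨x, hx, hp⟩
    obtain ⟨y, hy, o, w, hxy⟩ := h x hx
    refine ⟨((o, w), fun i j => y i j), ⟨trivial, y, hy, fun _ _ => rfl⟩, ?_⟩
    funext i j
    rw [← hp, hxy]
  refine (Set.ncard_le_ncard hsub (Set.toFinite _)).trans
    ((Set.ncard_image_le (Set.toFinite _)).trans ?_)
  rw [Set.ncard_prod, Set.ncard_univ, Nat.card_prod, Nat.card_eq_fintype_card,
    Fintype.card_option, Fintype.card_fin, Nat.card_fun, Nat.card_fin, Nat.card_fin]

/-- Freezing one row of a system with rows in `H` to an arbitrary element of `H`. -/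
theorem exists_sofic_of_rows {H : Set (ℤ → Fin k)} (hH : IsEffective1 H)
    {Y : Set (ℤ → ℤ → Fin k)} (hY : Sofic Y) (hne : Y.Nonempty)
    (hrow : ∀ y ∈ Y, ∀ j, (fun i => y i j) ∈ H) {h : ℝ}
    (hlow : ∀ N, h * N ^ 2 ≤ Real.logb 2 (pats Y N).ncard)
    (hup : ∀ ε > 0, ∃ᶠ N in atTop, Real.logb 2 (pats Y N).ncard ≤ (h + ε) * N ^ 2) :
    ∃ X : Set (ℤ × ℤ → Fin k), IsSofic2 X ∧ X.Nonempty ∧ entropy2 X = h ∧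
      {w : ℤ → Fin k | ∃ x ∈ X, ∀ i : ℤ, x (i, 0) = w i} = H := by
  obtain ⟨S, hS1, hS2⟩ := exists_triSys_effective hH
  let f : ACell S × Fin k → Fin k := fun z => if z.1.ty = some false then z.1.a else z.2
  let Z : Set (ℤ → ℤ → ACell S × Fin k) := {z | AValid S (fun i j => (z i j).1)} ∩
    {z | (fun i j => (z i j).2) ∈ Y}
  have hZ : Sofic Z := ((sofic_AValid S).preimage Prod.fst).inter (hY.preimage Prod.snd)
  let V : Set (ℤ → ℤ → Fin k) := {x | ∃ z ∈ Z, ∀ i j, f (z i j) = x i j}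
  have hV : Sofic V := hZ.image f
  obtain ⟨y₀, hy₀⟩ := hne
  obtain ⟨C₀, hC₀, _⟩ := hS2 _ (hrow y₀ hy₀ 0)
  have hYV : Y ⊆ V := by
    intro y hy
    obtain ⟨C, hC, hdead⟩ := exists_AValid_dead S (y 0 0) (C₀ 0 0).d
    refine ⟨fun i j => (C i j, y i j), ⟨hC, hy⟩, fun i j => ?_⟩
    simp [f, hdead]
  have hproj : ∀ x ∈ V, (fun i => x i 0) ∈ H := by
    rintro x ⟨z, ⟨hz1, hz2⟩, hx⟩
    have hty : ∀ i, (z i 0).1.ty = (z 0 0).1.ty := fun i =>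
      int_const (f := fun i => (z i 0).1.ty) (fun i => (hz1.H i 0).ty) i 0
    by_cases h0 : (z 0 0).1.ty = some false
    · have : (fun i => x i 0) = fun i => (z i 0).1.a := by
        funext i
        rw [← hx]
        simp [f, hty, h0]
      rw [this]
      exact hS1 _ hz1 0 0 h0
    · have : (fun i => x i 0) = fun i => (z i 0).2 := by
        funext i
        rw [← hx]
        simp [f, hty, h0]
      rw [this]
      exact hrow _ hz2 0
  have hproj' : ∀ w ∈ H, ∃ x ∈ V, ∀ i, x i 0 = w i := by
    intro w hw
    obtain ⟨C, hC, ha, hs⟩ := hS2 w hw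
    refine ⟨_, ⟨fun i j => (C i j, y₀ i j), ⟨hC, hy₀⟩, fun _ _ => rfl⟩, fun i => ?_⟩
    have := (hs i 0).2 rfl
    simp [f, this, ha]
  have hpat : ∀ N, (pats V N).ncard ≤ (N + 1) * k ^ N * (pats Y N).ncard := by
    intro N
    refine ncard_pats_le ?_
    rintro x ⟨z, ⟨hz1, hz2⟩, hx⟩
    have hty : ∀ i j, (z i j).1.ty = (z 0 j).1.ty := fun i j =>
      int_const (f := fun i => (z i j).1.ty) (fun i => (hz1.H i j).ty) i 0
    by_cases hex : ∃ j : Fin N, (z 0 j).1.ty = some false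
    · obtain ⟨j₀, hj₀⟩ := hex
      refine ⟨_, hz2, some j₀, fun i => (z i j₀).1.a, fun i j => ?_⟩
      rw [← hx]
      by_cases hj : j₀ = j
      · subst hj
        simp [f, hty, hj₀]
      · have : (z 0 j).1.ty ≠ some false := by
          intro h1
          have := hz1.special_unique hj₀ h1
          exact hj (Fin.ext (by exact_mod_cast this))
        simp [f, hty, this, hj]
    · refine ⟨_, hz2, none, fun i => (z i 0).1.a, fun i j => ?_⟩
      have : (z 0 j).1.ty ≠ some false := fun h1 => hex ⟨j, h1⟩
      rw [← hx]
      simp [f, hty, this]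
  have hmono : ∀ N, (pats Y N).ncard ≤ (pats V N).ncard := fun N =>
    Set.ncard_le_ncard (fun p ⟨x, hx, hp⟩ => ⟨x, hYV hx, hp⟩) (Set.toFinite _)
  have hk : 0 < k := (y₀ 0 0).pos
  refine ⟨{x | (fun i j => x (i, j)) ∈ V}, hV.isSofic2, ⟨fun p => y₀ p.1 p.2, hYV hy₀⟩, ?_, ?_⟩
  · have hcount : ∀ N, patCount2 {x : ℤ × ℤ → Fin k | (fun i j => x (i, j)) ∈ V} N N =
        (pats V N).ncard := by
      intro N
      rw [patCount2, pats]
      congr 1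
      ext p
      constructor
      · rintro ⟨x, hx, hp⟩
        exact ⟨_, hx, hp⟩
      · rintro ⟨x, hx, hp⟩
        exact ⟨fun q => x q.1 q.2, hx, hp⟩
    have hlog : ∀ N, Real.logb 2 (pats Y N).ncard ≤ Real.logb 2 (pats V N).ncard := fun N =>
      Real.logb_le_logb_of_le one_lt_two (by exact_mod_cast pats_pos ⟨y₀, hy₀⟩ N)
        (by exact_mod_cast hmono N)
    simp only [entropy2, hcount]
    refine le_antisymm (le_of_forall_pos_le_add fun ε hε => ?_) (le_ciInf fun n => ?_)
    · obtain ⟨M, hM⟩ := exists_nat_gt ((1 + Real.logb 2 k) / (ε / 2))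
      obtain ⟨N, hN, hN'⟩ := ((hup (ε / 2) (by positivity)).and_eventually
        (eventually_ge_atTop (M + 1))).exists
      obtain ⟨n, rfl⟩ : ∃ n, N = n + 1 := ⟨N - 1, by omega⟩
      refine ciInf_le_of_le ⟨0, ?_⟩ n ?_
      · rintro _ ⟨n, rfl⟩
        exact div_nonneg (logb_natCast_nonneg _) (by positivity)
      rw [div_le_iff₀ (by positivity)]
      have h1 : Real.logb 2 (pats V (n + 1)).ncard ≤ Real.logb 2 (n + 1 + 1) +
          (n + 1) * Real.logb 2 k + Real.logb 2 (pats Y (n + 1)).ncard := by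
        have hpY : (0 : ℝ) < (pats Y (n + 1)).ncard := by
          exact_mod_cast pats_pos ⟨y₀, hy₀⟩ _
        have hpV : (0 : ℝ) < (pats V (n + 1)).ncard := by
          exact_mod_cast pats_pos ⟨y₀, hYV hy₀⟩ _
        have hk' : (0 : ℝ) < k := by exact_mod_cast hk
        have := Real.logb_le_logb_of_le one_lt_two hpV (Nat.cast_le (α := ℝ).2 (hpat (n + 1)))
        push_cast at this
        rw [Real.logb_mul (by positivity) hpY.ne', Real.logb_mul (by positivity) (by positivity),
          Real.logb_pow] at this
        push_cast at this
        exact this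
      have h2 : Real.logb 2 (n + 1 + 1) ≤ n + 1 := by
        rw [Real.logb_le_iff_le_rpow one_lt_two (by positivity)]
        have := Nat.lt_two_pow_self (n := n + 1)
        have h3 : ((n + 1 + 1 : ℕ) : ℝ) ≤ ((2 ^ (n + 1) : ℕ) : ℝ) := Nat.cast_le.2 this
        push_cast at h3
        rw [← Nat.cast_add_one, Real.rpow_natCast]
        push_cast
        exact h3
      have h3 : (1 + Real.logb 2 k) ≤ ε / 2 * (n + 1) := by
        rw [div_lt_iff₀ (by positivity)] at hM
        have : (M : ℝ) ≤ n + 1 := by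
          have : M ≤ n + 1 := by omega
          exact_mod_cast this
        nlinarith
      have h4 := mul_le_mul_of_nonneg_right h3 (by positivity : (0 : ℝ) ≤ n + 1)
      push_cast at hN
      linarith [h1, h2, h4, hN]
    · rw [le_div_iff₀ (by positivity)]
      refine le_trans ?_ (hlog _)
      have := hlow (n + 1)
      push_cast at this
      exact this
  · ext w
    constructor
    · rintro ⟨x, hx, hw⟩
      have := hproj _ hx
      simpa only [hw] using this
    · intro hw
      obtain ⟨x, hx, hxw⟩ := hproj' w hw
      exact ⟨fun p => x p.1 p.2, hx, hxw⟩

end Assembly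

section Blocks

variable {k : ℕ}

/-- Words of length `n` read at the origin, as functions. -/
def fwords (H : Set (ℤ → Fin k)) (n : ℕ) : Set (Fin n → Fin k) :=
  {q | ∃ x ∈ H, ∀ i : Fin n, x (i : ℤ) = q i}

theorem ncard_fwords (F : Finset (List (Fin k))) (n : ℕ) :
    (fwords (SFT1 F) n).ncard = wordCount (SFT1 F) n := by
  refine Set.ncard_congr (fun q _ => List.ofFn q) ?_ ?_ ?_
  · rintro q ⟨x, hx, hq⟩
    refine ⟨by simp, x, hx, 0, fun m hm => ?_⟩
    rw [List.length_ofFn] at hm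
    simpa using hq ⟨m, hm⟩
  · intro p q _ _ h
    exact List.ofFn_injective h
  · rintro w ⟨rfl, x, hx, i, hi⟩
    refine ⟨fun m => w.get m, ⟨_, shift_mem_SFT1 F hx i, fun m => ?_⟩, by simp⟩
    have := hi m m.2
    rw [add_comm] at this
    exact this

theorem finProd_val {m n : ℕ} (a : Fin m) (r : Fin n) :
    (((finProdFinEquiv (a, r) : Fin (m * n)) : ℕ) : ℤ) = (r : ℤ) + (n : ℤ) * (a : ℤ) := by
  simp [finProdFinEquiv]

theorem ncard_fwords_mul_le (F : Finset (List (Fin k))) (m n : ℕ) :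
    (fwords (SFT1 F) (m * n)).ncard ≤ (fwords (SFT1 F) n).ncard ^ m := by
  let f : fwords (SFT1 F) (m * n) → Fin m → fwords (SFT1 F) n := fun q a =>
    ⟨fun r => q.1 (finProdFinEquiv (a, r)), by
      obtain ⟨q, x, hx, hq⟩ := q
      refine ⟨_, shift_mem_SFT1 F hx (n * a), fun r => ?_⟩
      have := hq (finProdFinEquiv (a, r))
      rwa [finProd_val] at this⟩
  have hf : Function.Injective f := by
    intro p q h
    refine Subtype.ext (funext fun i => ?_)
    obtain ⟨⟨a, r⟩, rfl⟩ := finProdFinEquiv.surjective i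
    exact congrFun (Subtype.ext_iff.1 (congrFun h a)) r
  have := Nat.card_le_card_of_injective f hf
  rwa [Nat.card_fun, Nat.card_fin] at this

theorem ncard_pats_mul_le {Y : Set (ℤ → ℤ → Fin k)} (hY : Sofic Y) (m n : ℕ) :
    (pats Y (m * n)).ncard ≤ (pats Y n).ncard ^ (m ^ 2) := by
  let f : pats Y (m * n) → Fin m × Fin m → pats Y n := fun q a =>
    ⟨fun r s => q.1 (finProdFinEquiv (a.1, r)) (finProdFinEquiv (a.2, s)), by
      obtain ⟨q, x, hx, hq⟩ := q
      refine ⟨_, hY.shift hx (n * a.1) (n * a.2), fun r s => ?_⟩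
      have := hq (finProdFinEquiv (a.1, r)) (finProdFinEquiv (a.2, s))
      rwa [finProd_val, finProd_val] at this⟩
  have hf : Function.Injective f := by
    intro p q h
    refine Subtype.ext (funext fun i => funext fun j => ?_)
    obtain ⟨⟨a, r⟩, rfl⟩ := finProdFinEquiv.surjective i
    obtain ⟨⟨b, s⟩, rfl⟩ := finProdFinEquiv.surjective j
    exact congrFun (congrFun (Subtype.ext_iff.1 (congrFun h (a, b))) r) s
  have := Nat.card_le_card_of_injective f hf
  rwa [Nat.card_fun, Nat.card_prod, Nat.card_fin, ← pow_two] at this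

theorem ncard_pats_rows {F : Finset (List (Fin k))} (hne : (SFT1 F).Nonempty) (N : ℕ) :
    (pats {y : ℤ → ℤ → Fin k | ∀ j, (fun i => y i j) ∈ SFT1 F} N).ncard =
      (fwords (SFT1 F) N).ncard ^ N := by
  obtain ⟨x₀, hx₀⟩ := hne
  set Y := {y : ℤ → ℤ → Fin k | ∀ j, (fun i => y i j) ∈ SFT1 F}
  let f : pats Y N → Fin N → fwords (SFT1 F) N := fun q j =>
    ⟨fun i => q.1 i j, by
      obtain ⟨q, x, hx, hq⟩ := q
      exact ⟨_, hx j, fun i => hq i j⟩⟩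
  have hf : Function.Bijective f := by
    constructor
    · intro p q h
      refine Subtype.ext (funext fun i => funext fun j => ?_)
      exact congrFun (Subtype.ext_iff.1 (congrFun h j)) i
    · intro g
      choose x hx hxg using fun j => (g j).2
      let y : ℤ → ℤ → Fin k := fun i j =>
        if h : 0 ≤ j ∧ j < N then x ⟨j.toNat, by omega⟩ i else x₀ i
      have hy : y ∈ Y := by
        intro j
        by_cases h : 0 ≤ j ∧ j < N
        · simpa only [y, h, and_self, dite_true] using hx ⟨j.toNat, by omega⟩
        · simpa only [y, h, dite_false] using hx₀
      refine ⟨⟨fun i j => (g j).1 i, y, hy, fun i j => ?_⟩, rfl⟩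
      have := hxg j i
      simpa [y] using this
  have := Nat.card_congr (Equiv.ofBijective f hf)
  rwa [Nat.card_fun, Nat.card_fin] at this

theorem exists_sofic_full {F : Finset (List (Fin k))} (hne : (SFT1 F).Nonempty) :
    ∃ Y : Set (ℤ → ℤ → Fin k), Sofic Y ∧ Y.Nonempty ∧ (∀ y ∈ Y, ∀ j, (fun i => y i j) ∈ SFT1 F) ∧
      (∀ N, entropy1 (SFT1 F) * N ^ 2 ≤ Real.logb 2 (pats Y N).ncard) ∧
      ∀ ε > 0, ∃ᶠ N in atTop,
        Real.logb 2 (pats Y N).ncard ≤ (entropy1 (SFT1 F) + ε) * (N : ℝ) ^ 2 := by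
  refine ⟨{y | ∀ j, (fun i => y i j) ∈ SFT1 F}, sofic_rows F, ?_, fun y hy => hy, ?_, ?_⟩
  · obtain ⟨x, hx⟩ := hne
    exact ⟨fun i _ => x i, fun _ => hx⟩
  · intro N
    rw [ncard_pats_rows hne, ncard_fwords, Nat.cast_pow, Real.logb_pow]
    rcases eq_or_ne N 0 with rfl | hN
    · simp
    · have := mul_le_mul_of_nonneg_left (entropy1_le (H := SFT1 F) N hN)
        (Nat.cast_nonneg (α := ℝ) N)
      linarith
  · intro ε hε
    obtain ⟨n, hn⟩ : ∃ n : ℕ, Real.logb 2 (wordCount (SFT1 F) (n + 1)) / ((n : ℝ) + 1) <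
        entropy1 (SFT1 F) + ε := exists_lt_of_ciInf_lt (lt_add_of_pos_right _ hε)
    rw [div_lt_iff₀ (by positivity)] at hn
    refine frequently_atTop.2 fun m => ⟨m * (n + 1), Nat.le_mul_of_pos_right _ n.succ_pos, ?_⟩
    rw [ncard_pats_rows hne, Nat.cast_pow, Real.logb_pow]
    have h1 := ncard_fwords_mul_le F m (n + 1)
    have h2 : 0 < (fwords (SFT1 F) (m * (n + 1))).ncard := by
      rw [ncard_fwords]
      exact wordCount_pos hne _
    have h3 := Real.logb_le_logb_of_le one_lt_two (Nat.cast_pos (α := ℝ).2 h2)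
      (Nat.cast_le (α := ℝ).2 h1)
    rw [Nat.cast_pow, Real.logb_pow, ncard_fwords F (n + 1)] at h3
    have h4 := mul_le_mul_of_nonneg_left hn.le (Nat.cast_nonneg (α := ℝ) m)
    have h5 := mul_le_mul_of_nonneg_left (h3.trans h4) (Nat.cast_nonneg (α := ℝ) (m * (n + 1)))
    refine h5.trans (le_of_eq ?_)
    push_cast
    ring

end Blocks

section Coding

variable {k : ℕ} {B : Type} (W : B → ℕ → Fin k) (b₀ : B) (l : ℕ)

/-- Rows outside `E` are concatenations of the block `b₀`, the other ones of arbitrary blocks. -/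
def Coded (E : Set ℤ) : Set (ℤ → ℤ → Fin k) :=
  {y | ∃ (w : ℤ → ℤ → B) (p : ℤ → ℤ → ℕ), (∀ i j, p i j < l) ∧
    (∀ i j, (p (i + 1) j = p i j + 1 ∧ w (i + 1) j = w i j) ∨
      (p i j + 1 = l ∧ p (i + 1) j = 0)) ∧
    (∀ i j, j ∉ E → w i j = b₀) ∧ ∀ i j, W (w i j) (p i j) = y i j}

open Classical in
/-- The indices below `N` that lie in `E`. -/
noncomputable def indices (E : Set ℤ) (N : ℕ) : Finset (Fin N) :=
  Finset.univ.filter fun j => (j : ℤ) ∈ E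

theorem mem_indices {E : Set ℤ} {N : ℕ} {j : Fin N} : j ∈ indices E N ↔ (j : ℤ) ∈ E := by
  simp [indices]

open Classical in
theorem card_indices (E : Set ℤ) (N : ℕ) :
    (indices E N).card = ((Finset.Ico (0 : ℤ) (0 + N)).filter (fun j => j ∈ E)).card := by
  refine Finset.card_bij (fun j _ => (j : ℤ)) ?_ ?_ ?_
  · intro j hj
    simpa [indices] using hj
  · intro a _ b _ h
    exact Fin.ext (by exact_mod_cast h)
  · intro j hj
    rw [Finset.mem_filter, Finset.mem_Ico] at hj
    refine ⟨⟨j.toNat, by omega⟩, ?_, by simp; omega⟩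
    have : ((j.toNat : ℕ) : ℤ) = j := by omega
    simp [indices, this, hj.2]

theorem exists_blocks {w : ℤ → B} {p : ℤ → ℕ} (hl : 0 < l) (hp : ∀ i, p i < l)
    (hstep : ∀ i, (p (i + 1) = p i + 1 ∧ w (i + 1) = w i) ∨ (p i + 1 = l ∧ p (i + 1) = 0)) :
    ∃ u : ℕ → B, ∀ i : ℕ, w i = u ((p 0 + i) / l) ∧ p i = (p 0 + i) % l := by
  refine ⟨fun q => w ((q * l - p 0 : ℕ) : ℤ), fun i => ?_⟩
  induction i with
  | zero =>
    have : p 0 / l = 0 := Nat.div_eq_of_lt (hp 0)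
    simp [this, Nat.mod_eq_of_lt (hp 0)]
  | succ i ih =>
    obtain ⟨h1, h2⟩ := ih
    have hdm := Nat.div_add_mod (p 0 + i) l
    have hst := hstep i
    have hpl := hp (i + 1)
    push_cast
    dsimp only at h1 ⊢
    rcases hst with ⟨h3, h4⟩ | ⟨h3, h4⟩
    · have h8 : p i + 1 < l := h3 ▸ hpl
      have h5 : p 0 + (i + 1) = l * ((p 0 + i) / l) + (p i + 1) := by omega
      have h6 : (p 0 + (i + 1)) / l = (p 0 + i) / l := by
        rw [h5, Nat.mul_add_div hl, Nat.div_eq_of_lt h8, add_zero]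
      have h7 : (p 0 + (i + 1)) % l = p i + 1 := by
        rw [h5, Nat.mul_add_mod, Nat.mod_eq_of_lt h8]
      rw [h6, h7, h4, h3]
      exact ⟨h1, rfl⟩
    · have h5 : p 0 + (i + 1) = l * ((p 0 + i) / l + 1) := by
        rw [mul_add]
        omega
      have h6 : (p 0 + (i + 1)) / l = (p 0 + i) / l + 1 := by
        rw [h5, Nat.mul_div_cancel_left _ hl]
      have h7 : (p 0 + (i + 1)) % l = 0 := by rw [h5, Nat.mul_mod_right]
      rw [h6, h7, h4]
      refine ⟨?_, rfl⟩
      have : ((p 0 + i) / l + 1) * l - p 0 = i + 1 := by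
        rw [mul_comm]
        omega
      rw [this]
      push_cast
      rfl

theorem ncard_pats_coded_le [Fintype B] [Nonempty B] (hl : 0 < l) {Y : Set (ℤ → ℤ → Fin k)}
    {N n : ℕ} (hY : ∀ y ∈ Y, ∃ E, (indices E N).card ≤ n ∧ y ∈ Coded W b₀ l E) :
    (pats Y N).ncard ≤ 2 ^ N * l ^ N * Fintype.card B ^ ((N / l + 2) * n) := by
  classical
  have hlt : ∀ (a : Fin l) (i : Fin N), (a + i : ℕ) / l < N / l + 2 := by
    intro a i
    have h1 : (a + i : ℕ) ≤ N + l := by omega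
    have h2 := Nat.div_le_div_right (c := l) h1
    rw [Nat.add_div_right _ hl] at h2
    omega
  let g : (q : Finset (Fin N) × (Fin N → Fin l)) → (q.1 → Fin (N / l + 2) → B) →
      Fin N → Fin N → Fin k := fun q u i j =>
    W (if h : j ∈ q.1 then u ⟨j, h⟩ ⟨(q.2 j + i : ℕ) / l, hlt _ _⟩ else b₀) ((q.2 j + i : ℕ) % l)
  let S : Finset (Fin N) × (Fin N → Fin l) → Set (Fin N → Fin N → Fin k) := fun q =>
    if q.1.card ≤ n then Set.range (g q) else ∅
  have hsub : pats Y N ⊆ ⋃ q, S q := by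
    rintro f ⟨y, hy, hf⟩
    obtain ⟨E, hE, w, p, hp, hstep, hw, hout⟩ := hY y hy
    choose u hu using fun j => exists_blocks (w := fun i => w i j) l hl (fun i => hp i j)
      (fun i => hstep i j)
    refine Set.mem_iUnion.2 ⟨(indices E N, fun j => ⟨p 0 j, hp 0 j⟩), ?_⟩
    simp only [S, hE, if_true]
    refine ⟨fun j q => u (j.1 : ℕ) q, ?_⟩
    funext i j
    rw [← hf i j, ← hout, (hu j i).2]
    by_cases hj : j ∈ indices E N
    · simp only [g, hj, dite_true, (hu j i).1]
    · have : ((j : ℕ) : ℤ) ∉ E := by simpa [indices] using hj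
      simp only [g, hj, dite_false, hw _ _ this]
  have hcard : ∀ q, (S q).ncard ≤ Fintype.card B ^ ((N / l + 2) * n) := by
    intro q
    by_cases hq : q.1.card ≤ n
    · simp only [S, hq, if_true]
      rw [← Set.image_univ]
      refine (Set.ncard_image_le (Set.toFinite _)).trans ?_
      rw [Set.ncard_univ, Nat.card_eq_fintype_card, Fintype.card_fun, Fintype.card_fun,
        Fintype.card_fin, Fintype.card_coe, ← pow_mul]
      exact Nat.pow_le_pow_right Fintype.card_pos (Nat.mul_le_mul_left _ hq)
    · simp [S, hq]
  refine (Set.ncard_le_ncard hsub (Set.toFinite _)).trans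
    ((ncard_iUnion_le_sum S fun _ => Set.toFinite _).trans
      ((Finset.sum_le_sum fun q _ => hcard q).trans ?_))
  rw [Finset.sum_const, smul_eq_mul, Finset.card_univ, Fintype.card_prod, Fintype.card_finset,
    Fintype.card_fun, Fintype.card_fin, Fintype.card_fin]

theorem le_ncard_pats_coded [Fintype B] (hW : ∀ a b, (∀ p < l, W a p = W b p) → a = b)
    (hl : 0 < l) (E : Set ℤ) (m : ℕ) :
    Fintype.card B ^ (m * (indices E (m * l)).card) ≤ (pats (Coded W b₀ l E) (m * l)).ncard := by
  classical
  let U : (Fin m × indices E (m * l) → B) → ℤ → ℤ → B := fun u b j =>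
    if h : ∃ q : Fin m × indices E (m * l), (q.1 : ℤ) = b ∧ ((q.2.1 : ℕ) : ℤ) = j then
      u h.choose else b₀
  have hU : ∀ u (q : Fin m × indices E (m * l)), U u q.1 (q.2.1 : ℕ) = u q := by
    intro u q
    have hex : ∃ q' : Fin m × indices E (m * l), (q'.1 : ℤ) = q.1 ∧
        ((q'.2.1 : ℕ) : ℤ) = (q.2.1 : ℕ) := ⟨q, rfl, rfl⟩
    simp only [U, hex, dite_true]
    congr 1
    have := hex.choose_spec
    exact Prod.ext (Fin.ext (by exact_mod_cast this.1))
      (Subtype.ext (Fin.ext (by exact_mod_cast this.2)))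
  let g : (Fin m × indices E (m * l) → B) → pats (Coded W b₀ l E) (m * l) := fun u =>
    ⟨fun i j => W (U u (((i : ℕ) : ℤ) / l) (j : ℕ)) (((i : ℕ) : ℤ) % l).toNat,
      fun i j => W (U u (i / l) j) (i % l).toNat, ⟨fun i j => U u (i / l) j,
        fun i _ => (i % l).toNat, ?_, ?_, ?_, fun _ _ => rfl⟩, fun _ _ => rfl⟩
  · have hg : Function.Injective g := by
      intro u u' h
      funext q
      rw [← hU u, ← hU u']
      refine hW _ _ fun p hp => ?_
      have h1 := congrFun (congrFun (Subtype.ext_iff.1 h) (finProdFinEquiv (q.1, ⟨p, hp⟩))) q.2.1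
      have h2 : ((p : ℤ) + l * (q.1 : ℕ)) / l = (q.1 : ℕ) := by
        rw [Int.add_mul_ediv_left _ _ (by omega), Int.ediv_eq_zero_of_lt (by omega) (by omega),
          zero_add]
      have h3 : (((p : ℤ) + l * (q.1 : ℕ)) % l).toNat = p := by
        rw [Int.add_mul_emod_self_left, Int.emod_eq_of_lt (by omega) (by omega)]
        rfl
      simpa only [g, finProd_val, h2, h3] using h1
    have := Nat.card_le_card_of_injective g hg
    rwa [Nat.card_eq_fintype_card, Fintype.card_fun, Fintype.card_prod, Fintype.card_fin,
      Fintype.card_coe] at this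
  · intro i _
    have := Int.emod_lt_of_pos i (by omega : (0 : ℤ) < l)
    have := Int.emod_nonneg i (by omega : (l : ℤ) ≠ 0)
    dsimp only
    omega
  · intro i j
    have h0 := Int.emod_lt_of_pos i (by omega : (0 : ℤ) < l)
    have h1 := Int.emod_nonneg i (by omega : (l : ℤ) ≠ 0)
    have h2 := Int.mul_ediv_add_emod i l
    by_cases h : i % l + 1 = l
    · right
      have h3 : (i + 1) % l = 0 := by
        have : i + 1 = l * (i / l + 1) := by rw [mul_add]; omega
        rw [this, Int.mul_emod_right]
      refine ⟨?_, ?_⟩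
      · dsimp only
        omega
      · dsimp only
        rw [h3]
        rfl
    · left
      have h4 : i + 1 = (i % l + 1) + l * (i / l) := by omega
      have h5 : (i + 1) % l = i % l + 1 := by
        rw [h4, Int.add_mul_emod_self_left, Int.emod_eq_of_lt (by omega) (by omega)]
      have h6 : (i + 1) / l = i / l := by
        have := Int.mul_ediv_add_emod (i + 1) l
        have h7 : (l : ℤ) * ((i + 1) / l) = l * (i / l) := by omega
        exact Int.eq_of_mul_eq_mul_left (by omega) h7
      refine ⟨?_, ?_⟩
      · dsimp only
        omega
      · dsimp only
        rw [h6]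
  · intro i j hj
    have : ¬ ∃ q : Fin m × indices E (m * l), (q.1 : ℤ) = i / l ∧ ((q.2.1 : ℕ) : ℤ) = j := by
      rintro ⟨q, -, rfl⟩
      exact hj (mem_indices.1 q.2.2)
    simp only [U, this, dite_false]

end Coding

section Partial

variable {k : ℕ}

theorem exists_pow_two_mul_lt (a : ℝ) {δ : ℝ} (hδ : 0 < δ) : ∃ K : ℕ, a / 2 ^ K < δ := by
  obtain ⟨K, hK⟩ := pow_unbounded_of_one_lt (a / δ) (one_lt_two (α := ℝ))
  refine ⟨K, ?_⟩
  rw [div_lt_iff₀ hδ] at hK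
  rw [div_lt_iff₀ (by positivity)]
  linarith

theorem log_bound_lower {h s l N P : ℝ} (hl : 0 < l)
    (H : ∀ K m : ℕ, s * (m * N) * ((h * l / s - 1 / 2 ^ K) * (m * N * l) - K) ≤ (m * l) ^ 2 * P)
    (hs : 0 < s) : h * N ^ 2 ≤ P := by
  by_contra! hlt
  set δ := h * N ^ 2 - P with hδ
  have hδ0 : 0 < δ := sub_pos.2 hlt
  obtain ⟨K, hK⟩ := exists_pow_two_mul_lt (s * N ^ 2) (by positivity : 0 < l * δ / 2)
  obtain ⟨m, hm⟩ := exists_nat_gt (s * N * K / (l ^ 2 * δ / 2))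
  rw [div_lt_iff₀ (by positivity)] at hm
  have h1 := H K (m + 1)
  have h2 : s * ((m + 1 : ℕ) * N) * ((h * l / s - 1 / 2 ^ K) * ((m + 1 : ℕ) * N * l) - K) =
      (m + 1) ^ 2 * l ^ 2 * (h * N ^ 2) - (m + 1) ^ 2 * l * (s * N ^ 2 / 2 ^ K) -
        (m + 1) * (s * N * K) := by
    push_cast
    field_simp
  rw [h2] at h1
  push_cast at h1
  have hm1 : (0 : ℝ) < m + 1 := by positivity
  have h3 : (m + 1 : ℝ) ^ 2 * l * (s * N ^ 2 / 2 ^ K) ≤ (m + 1) ^ 2 * l * (l * δ / 2) := by gcongr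
  have h4 : (m + 1 : ℝ) * (s * N * K) < (m + 1) * ((m + 1) * (l ^ 2 * δ / 2)) := by
    have : (0 : ℝ) < l ^ 2 * δ / 2 := by positivity
    have : s * N * K < (m + 1) * (l ^ 2 * δ / 2) := by linarith
    exact mul_lt_mul_of_pos_left this hm1
  have h5 : (m + 1 : ℝ) ^ 2 * l ^ 2 * δ =
      (m + 1) ^ 2 * l ^ 2 * (h * N ^ 2) - ((m + 1) * l) ^ 2 * P := by
    rw [hδ]
    ring
  linarith

theorem log_bound_upper {h s l ε : ℝ} (hs : 0 < s) (hl : 1 ≤ l) (hε : 0 < ε) :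
    ∃ K : ℕ, ∀ᶠ N : ℕ in atTop,
      N + N * l + s * (N / l + 2) * (h * l / s * N + N / 2 ^ K + K + 1) ≤ (h + ε) * N ^ 2 := by
  obtain ⟨K, hK⟩ := exists_pow_two_mul_lt (s / l) (half_pos hε)
  set C := 1 + l + s * (K + 1) / l + 2 * s * (h * l / s + 1 / 2 ^ K) + 2 * s * (K + 1) with hC
  refine ⟨K, ?_⟩
  filter_upwards [eventually_ge_atTop (⌈C / (ε / 2)⌉₊ + 1)] with N hN
  have hN1 : (1 : ℝ) ≤ N := by
    have : 1 ≤ N := by omega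
    exact_mod_cast this
  have hN2 : C ≤ N * (ε / 2) := by
    rw [← div_le_iff₀ (by positivity)]
    refine (Nat.le_ceil _).trans ?_
    have : ⌈C / (ε / 2)⌉₊ ≤ N := by omega
    exact_mod_cast this
  have h1 : (N : ℝ) + N * l + s * (N / l + 2) * (h * l / s * N + N / 2 ^ K + K + 1) =
      h * N ^ 2 + s / l / 2 ^ K * N ^ 2 +
        (1 + l + s * (K + 1) / l + 2 * s * (h * l / s + 1 / 2 ^ K)) * N + 2 * s * (K + 1) := by
    field_simp
    ring
  have h2 : (2 : ℝ) * s * (K + 1) ≤ 2 * s * (K + 1) * N :=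
    le_mul_of_one_le_right (by positivity) hN1
  have h3 : s / l / 2 ^ K * (N : ℝ) ^ 2 ≤ ε / 2 * N ^ 2 := by gcongr
  have h4 : C * N ≤ N * (ε / 2) * N := by gcongr
  rw [h1]
  rw [hC] at h4
  nlinarith

theorem exists_sofic_partial {F : Finset (List (Fin k))} (hne : (SFT1 F).Nonempty) {h : ℝ}
    (hh : Pi1Computable h) (h0 : 0 ≤ h) (hlt : h < entropy1 (SFT1 F)) :
    ∃ Y : Set (ℤ → ℤ → Fin k), Sofic Y ∧ Y.Nonempty ∧ (∀ y ∈ Y, ∀ j, (fun i => y i j) ∈ SFT1 F) ∧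
      (∀ N, h * N ^ 2 ≤ Real.logb 2 (pats Y N).ncard) ∧
      ∀ ε > 0, ∃ᶠ N in atTop, Real.logb 2 (pats Y N).ncard ≤ (h + ε) * (N : ℝ) ^ 2 := by
  classical
  obtain ⟨l, s, hl, hs, hls, W, hW, hWF⟩ := exists_words F h h0 hlt hne
  obtain ⟨X, hX⟩ := exists_triSys_density hh h0 l s hs
  have hs' : (0 : ℝ) < s := by exact_mod_cast hs
  have hl' : (1 : ℝ) ≤ l := by exact_mod_cast hl
  let b₀ : Fin (2 ^ s) := 0
  let rel : BCell X × Fin (2 ^ s) × Fin l → BCell X × Fin (2 ^ s) × Fin l → Prop := fun a b =>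
    (((b.2.2 : ℕ) = a.2.2 + 1 ∧ b.2.1 = a.2.1) ∨ ((a.2.2 : ℕ) + 1 = l ∧ (b.2.2 : ℕ) = 0)) ∧
      (a.1.v.e ≠ 1 → a.2.1 = b₀)
  let Z : Set (ℤ → ℤ → BCell X × Fin (2 ^ s) × Fin l) := {z | BValid (fun i j => (z i j).1)} ∩
    {z | ∀ i j, rel (z i j) (z (i + 1) j) ∧ True}
  let Y : Set (ℤ → ℤ → Fin k) := {y | ∃ z ∈ Z, ∀ i j, W (z i j).2.1 (z i j).2.2 = y i j}
  have hYs : Sofic Y := ((sofic_BValid.preimage Prod.fst).inter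
    (sofic_adj rel fun _ _ => True)).image
      fun a : BCell X × Fin (2 ^ s) × Fin l => W a.2.1 a.2.2
  have hY : ∀ y, y ∈ Y ↔ ∃ c : ℤ → ℤ → BCell X, BValid c ∧
      y ∈ Coded W b₀ l {j | (c 0 j).v.e = 1} := by
    intro y
    constructor
    · rintro ⟨z, ⟨hz1, hz2⟩, hy⟩
      refine ⟨_, hz1, fun i j => (z i j).2.1, fun i j => (z i j).2.2, fun i j => (z i j).2.2.2,
        fun i j => (hz2 i j).1.1, fun i j hj => (hz2 i j).1.2 ?_, hy⟩
      rwa [hz1.1.toBHalf.v_const i 0 j]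
    · rintro ⟨c, hc, w, p, hp, hstep, hw, hy⟩
      refine ⟨fun i j => (c i j, w i j, ⟨p i j, hp i j⟩), ⟨hc, fun i j => ⟨⟨hstep i j, ?_⟩,
        trivial⟩⟩, hy⟩
      intro h1
      refine hw i j ?_
      rwa [hc.1.toBHalf.v_const i 0 j] at h1
  obtain ⟨c, hc, hdense⟩ := exists_BValid_dense (d := h * l / s) (by positivity)
    (by rw [div_le_one hs']; exact hls) (fun b => (hX b).1)
  have hlow : ∀ m : ℕ, s * (m * (indices {j | (c 0 j).v.e = 1} (m * l)).card : ℝ) ≤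
      Real.logb 2 (pats Y (m * l)).ncard := by
    intro m
    have h1 := le_ncard_pats_coded W b₀ l hW hl {j | (c 0 j).v.e = 1} m
    have h2 : (pats (Coded W b₀ l {j | (c 0 j).v.e = 1}) (m * l)).ncard ≤
        (pats Y (m * l)).ncard :=
      Set.ncard_le_ncard (fun p ⟨x, hx, hp⟩ => ⟨x, (hY x).2 ⟨c, hc, hx⟩, hp⟩) (Set.toFinite _)
    have h3 := Real.logb_le_logb_of_le one_lt_two (by positivity)
      (Nat.cast_le (α := ℝ).2 (h1.trans h2))
    rw [Fintype.card_fin, ← pow_mul, Nat.cast_pow, Real.logb_pow, Nat.cast_ofNat,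
      Real.logb_self_eq_one one_lt_two, mul_one] at h3
    exact_mod_cast h3
  have hYne : Y.Nonempty := by
    have h1 := le_ncard_pats_coded W b₀ l hW hl {j | (c 0 j).v.e = 1} 0
    obtain ⟨p, x, hx, -⟩ := Set.nonempty_of_ncard_ne_zero
      ((Nat.pos_of_ne_zero (by simp)).trans_le h1).ne'
    exact ⟨x, (hY x).2 ⟨c, hc, hx⟩⟩
  refine ⟨Y, hYs, hYne, ?_, ?_, ?_⟩
  · intro y hy j
    obtain ⟨c, -, w, p, hp, hstep, -, hy⟩ := (hY y).1 hy
    simp only [← hy]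
    exact hWF (fun i => w i j) (fun i => p i j) (fun i => hp i j) fun i => hstep i j
  · intro N
    refine log_bound_lower (s := s) (l := l) (by positivity) (fun K m => ?_) hs'
    have h1 := hlow (m * N)
    have h2 := hdense K (m * N * l) 0
    have h3 := card_indices {j | (c 0 j).v.e = 1} (m * N * l)
    have h4 := ncard_pats_mul_le hYs (m * l) N
    have h5 := Real.logb_le_logb_of_le one_lt_two (Nat.cast_pos (α := ℝ).2 (pats_pos hYne _))
      (Nat.cast_le (α := ℝ).2 h4)
    rw [Nat.cast_pow, Real.logb_pow] at h5
    rw [mul_right_comm m N l] at h1 h2 h3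
    simp only [Set.mem_ofPred_eq] at h3
    rw [← h3] at h2
    push_cast at h1 h2 h5
    refine le_trans ?_ (h1.trans h5)
    rw [mul_assoc]
    have h6 : (m : ℝ) * N * l = m * l * N := by ring
    rw [h6]
    gcongr
  · intro ε hε
    obtain ⟨K, hK⟩ := log_bound_upper (h := h) hs' hl' hε
    refine (hK.mono fun N hN => ?_).frequently
    set x : ℝ := h * l / s * N + N / 2 ^ K + K + 1 with hx
    have hx0 : 0 ≤ x := by positivity
    have h1 : ∀ y ∈ Y, ∃ E, (indices E N).card ≤ ⌊x⌋₊ ∧ y ∈ Coded W b₀ l E := by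
      intro y hy
      obtain ⟨c, hc, hy⟩ := (hY y).1 hy
      refine ⟨_, Nat.le_floor ?_, hy⟩
      rw [card_indices]
      simp only [Set.mem_ofPred_eq]
      exact hc.card_le (fun b => (hX b).2) K N 0
    have h2 := ncard_pats_coded_le W b₀ l hl h1
    have h3 := Real.logb_le_logb_of_le one_lt_two (Nat.cast_pos (α := ℝ).2 (pats_pos hYne N))
      (Nat.cast_le (α := ℝ).2 h2)
    refine h3.trans (le_trans ?_ hN)
    have h4 : ((N / l : ℕ) : ℝ) ≤ N / l := Nat.cast_div_le
    have h5 := Nat.floor_le hx0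
    have h6 : Real.logb 2 l ≤ l := by
      rw [Real.logb_le_iff_le_rpow one_lt_two (by positivity), Real.rpow_natCast]
      exact_mod_cast Nat.lt_two_pow_self.le
    rw [Fintype.card_fin, ← pow_mul]
    push_cast
    rw [Real.logb_mul (by positivity) (by positivity), Real.logb_mul (by positivity)
      (by positivity), Real.logb_pow, Real.logb_pow, Real.logb_pow,
      Real.logb_self_eq_one one_lt_two]
    push_cast
    rw [mul_one, mul_one, ← mul_assoc]
    gcongr

end Partial

end Sim

/-- for `H` effective containing a nonempty SFT `H'`, every Π₁-computable
`h ∈ [0, h(H')]` is the entropy of a nonempty two-dimensional sofic subshift whose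
horizontal projective subaction is `H`. -/
theorem stmt9 (k : ℕ) (H : Set (ℤ → Fin k)) (hHeff : IsEffective1 H)
    (H' : Set (ℤ → Fin k)) (hH' : IsSFT1 H') (hsub : H' ⊆ H) (hne : H'.Nonempty)
    (h : ℝ) (hh : Pi1Computable h) (h0 : 0 ≤ h) (h1 : h ≤ entropy1 H') :
    ∃ X : Set (ℤ × ℤ → Fin k), IsSofic2 X ∧ X.Nonempty ∧ entropy2 X = h ∧
      {w : ℤ → Fin k | ∃ x ∈ X, ∀ i : ℤ, x (i, 0) = w i} = H := by
  obtain ⟨F, rfl⟩ := hH'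
  obtain ⟨Y, hY, hYne, hrow, hlow, hup⟩ : ∃ Y : Set (ℤ → ℤ → Fin k), Sim.Sofic Y ∧ Y.Nonempty ∧
      (∀ y ∈ Y, ∀ j, (fun i => y i j) ∈ SFT1 F) ∧
      (∀ N, h * N ^ 2 ≤ Real.logb 2 (Sim.pats Y N).ncard) ∧
      ∀ ε > 0, ∃ᶠ N in atTop, Real.logb 2 (Sim.pats Y N).ncard ≤ (h + ε) * (N : ℝ) ^ 2 := by
    rcases h1.lt_or_eq with hlt | rfl
    · exact Sim.exists_sofic_partial hne hh h0 hlt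
    · exact Sim.exists_sofic_full hne
  exact Sim.exists_sofic_of_rows hHeff hY hYne (fun y hy j => hsub (hrow y hy j)) hlow hup
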